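/- Let p ∈ {2, 3, 5, 7, 13} be prime. Then, as functions on the upper half-plane, 2·j_p'(τ) - G₂^{(p*)}(τ) = ((3 - p·σ₁(2/p))/(p-1))·E₂^{(p)}(τ), where j_p'(τ) = (2πi)^{-1} d/dτ j_p(τ), σ₁(2/p) = 1 if p = 2 and 0 otherwise, and E₂^{(p)}(τ) = pE₂(pτ) - E₂(τ) = (p-1) + 24Σ_{n≥1} σ₁^{(p)}(n)qⁿ. -/

import Mathlib

open Complex Matrix

noncomputable section

/-- `SL(2, ℝ)`. -/
abbrev SL2R := Matrix.SpecialLinearGroup (Fin 2) ℝ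

/-- `q = e^{2πiz}` (also used as `ζ = e^{2πiz}`). -/
def qc (z : ℂ) : ℂ := Complex.exp (2 * Real.pi * Complex.I * z)

/-- The Dedekind eta function `η(z) = q^{1/24} ∏_{n ≥ 1} (1 - q^n)` (intended for `Im z > 0`). -/
def dedekindEta (z : ℂ) : ℂ :=
  Complex.exp (Real.pi * Complex.I * z / 12) *
    ∏' n : ℕ, (1 - Complex.exp (2 * Real.pi * Complex.I * ((n : ℂ) + 1) * z))

/-- The hauptmodul `j_N` of `Γ₀(N)` for `N ∈ {2, 3, 5, 7, 13, 6, 10}`. -/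
def jn (N : ℕ) (z : ℂ) : ℂ :=
  if N = 6 then (dedekindEta (2 * z) * dedekindEta (3 * z) ^ 3 / (dedekindEta z * dedekindEta (6 * z) ^ 3)) ^ 3 - 3
  else if N = 10 then dedekindEta (2 * z) * dedekindEta (5 * z) ^ 5 / (dedekindEta z * dedekindEta (10 * z) ^ 5) - 1
  else (dedekindEta z / dedekindEta ((N : ℂ) * z)) ^ (24 / (N - 1)) + 24 / ((N : ℂ) - 1)

/-- The hauptmodul `j_N^*` of the Fricke group `Γ₀^*(N)` for `N ∈ {2, 3, 5, 7, 13, 6, 10}`. -/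
def jnStar (N : ℕ) (z : ℂ) : ℂ :=
  if N = 6 then
    (dedekindEta z * dedekindEta (3 * z) / (dedekindEta (2 * z) * dedekindEta (6 * z))) ^ 6 + 6 +
      2 ^ 6 * (dedekindEta (2 * z) * dedekindEta (6 * z) / (dedekindEta z * dedekindEta (3 * z))) ^ 6
  else if N = 10 then
    (dedekindEta z * dedekindEta (5 * z) / (dedekindEta (2 * z) * dedekindEta (10 * z))) ^ 4 + 4 +
      2 ^ 4 * (dedekindEta (2 * z) * dedekindEta (10 * z) / (dedekindEta z * dedekindEta (5 * z))) ^ 4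
  else
    (dedekindEta z / dedekindEta ((N : ℂ) * z)) ^ (24 / (N - 1)) + 24 / ((N : ℂ) - 1) +
      (N : ℂ) ^ (12 / (N - 1)) * (dedekindEta ((N : ℂ) * z) / dedekindEta z) ^ (24 / (N - 1))

/-- `f` has the `q`-expansion `f(τ) = Σ_{n ≥ n₀} (a n) q^n` on the upper half-plane. -/
def HasQExp (f : ℂ → ℂ) (a : ℤ → ℂ) (n₀ : ℤ) : Prop :=
  (∀ n < n₀, a n = 0) ∧
    ∀ τ : ℂ, 0 < τ.im →
      HasSum (fun m : ℕ => a (n₀ + m) * qc τ ^ (n₀ + (m : ℤ))) (f τ)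

/-- `Γ₀(N)` viewed as a subgroup of `SL(2, ℝ)`. -/
def Gamma0SL2R (N : ℕ) : Subgroup SL2R :=
  (CongruenceSubgroup.Gamma0 N).map
    (Matrix.SpecialLinearGroup.map (Int.castRingHom ℝ))

/-- The set of Atkin–Lehner matrices `W_e` of level `N`:
`W_e = e^{-1/2} [[xe, y], [zN, we]]`, `x, y, z, w ∈ ℤ` (determinant `1` being automatic). -/
def atkinLehnerSet (N e : ℕ) : Set SL2R :=
  { g | ∃ x y z w : ℤ,
      g.1 = (Real.sqrt e)⁻¹ • !![(x : ℝ) * e, (y : ℝ); (z : ℝ) * N, (w : ℝ) * e] }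

/-- The Fricke group `Γ₀^*(N)`, generated by `Γ₀(N)` and all Atkin–Lehner involutions `W_e`
for `e ∣ N` with `gcd(e, N/e) = 1`. -/
def FrickeGroup (N : ℕ) : Subgroup SL2R :=
  Subgroup.closure
    ((Gamma0SL2R N : Set SL2R) ∪
      ⋃ e ∈ {e : ℕ | e ∣ N ∧ Nat.Coprime e (N / e)}, atkinLehnerSet N e)

/-- The Gram matrix of the integral binary quadratic form `[a, b, c]`. -/
def formMat (a b c : ℤ) : Matrix (Fin 2) (Fin 2) ℝ :=
  !![(a : ℝ), (b : ℝ) / 2; (b : ℝ) / 2, (c : ℝ)]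

/-- `𝒬_{d,N}`: positive definite integral binary quadratic forms `[a, b, c]` of
discriminant `-d` with `N ∣ a`. -/
def QdN (d : ℤ) (N : ℕ) : Set (Matrix (Fin 2) (Fin 2) ℝ) :=
  { M | ∃ a b c : ℤ, M = formMat a b c ∧ 0 < a ∧ b ^ 2 - 4 * a * c = -d ∧ (N : ℤ) ∣ a }

/-- `𝒬_{d,N,h}`: members of `𝒬_{d,N}` with `b ≡ h (mod 2N)`. -/
def QdNh (d : ℤ) (N : ℕ) (h : ℤ) : Set (Matrix (Fin 2) (Fin 2) ℝ) :=
  { M | ∃ a b c : ℤ, M = formMat a b c ∧ 0 < a ∧ b ^ 2 - 4 * a * c = -d ∧ (N : ℤ) ∣ a ∧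
      (b : ZMod (2 * N)) = (h : ZMod (2 * N)) }

/-- Orbit relation of the (right) action `Q ↦ Q ∘ g`, i.e. `M ↦ gᵀ M g`, of `Γ ≤ SL(2, ℝ)`
on a set `S` of Gram matrices of quadratic forms. -/
def formRel (Γ : Subgroup SL2R) (S : Set (Matrix (Fin 2) (Fin 2) ℝ)) (Q Q' : S) : Prop :=
  ∃ g ∈ Γ, Q'.1 = (g.1)ᵀ * Q.1 * g.1

/-- The CM point `α_Q` of a positive definite form (as a point of `ℂ`; it lies in the upper
half-plane): `α_Q = (-b + i √d) / (2a) = (-(b/2) + i √(det M)) / a`. -/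
def cmPointC (M : Matrix (Fin 2) (Fin 2) ℝ) : ℂ :=
  ((-(M 0 1) : ℝ) + Complex.I * Real.sqrt M.det) / ((M 0 0 : ℝ) : ℂ)

/-- The order of the stabilizer of the form `M` in `Γ/{±1}` (the stabilizer in `Γ` contains
`±1` and has twice the cardinality). -/
def stabOrder (Γ : Subgroup SL2R) (M : Matrix (Fin 2) (Fin 2) ℝ) : ℕ :=
  Nat.card { g : SL2R // g ∈ Γ ∧ (g.1)ᵀ * M * g.1 = M } / 2

/-- The modular trace `Σ_{Q ∈ S/Γ} f(α_Q) / |Γ̄_Q|`. -/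
def classTrace (Γ : Subgroup SL2R) (f : ℂ → ℂ)
    (S : Set (Matrix (Fin 2) (Fin 2) ℝ)) : ℂ :=
  ∑ᶠ O : Quot (formRel Γ S),
    f (cmPointC (Quot.out O).1) / (stabOrder Γ (Quot.out O).1 : ℂ)

/-- `t₂^{(N*)}(d)`, where `P` is the polynomial with `φ₂(j_N^*) = P(j_N^*)`;
includes the paper's conventions at nonpositive indices. -/
def t2Star (N : ℕ) (P : Polynomial ℂ) (d : ℤ) : ℂ :=
  if 0 < d then
    classTrace (FrickeGroup N) (fun z => Polynomial.eval (jnStar N z) P) (QdN d N)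
  else if d = 0 then (if N = 2 then 5 else if N = 6 ∨ N = 10 then 5 / 2 else 3)
  else if d = -1 then -1
  else if d = -4 then -2
  else 0

/-- `σ₁^{(N)}(x) = Σ_{d ∣ x, N ∤ d} d` for `x ∈ ℤ_{>0}`, `(N-1)/24` at `x = 0`, and `0`
off `ℤ_{≥0}`. -/
def sigmaN (N : ℕ) (x : ℚ) : ℂ :=
  if x = 0 then ((N : ℂ) - 1) / 24
  else if 0 < x ∧ x.den = 1 then
    ∑ d ∈ (Nat.divisors x.num.toNat).filter (fun d => ¬ N ∣ d), (d : ℂ)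
  else 0

/-- `σ₁(x) = Σ_{d ∣ x} d` for `x ∈ ℤ_{>0}` and `0` otherwise. -/
def sigmaQ (x : ℚ) : ℂ :=
  if 0 < x ∧ x.den = 1 then ∑ d ∈ Nat.divisors x.num.toNat, (d : ℂ) else 0

/-- A weakly holomorphic Jacobi form of weight `k` and index `m`. -/
structure WeakJacobiForm (k : ℤ) (m : ℕ) where
  toFun : ℂ → ℂ → ℂ
  holo : DifferentiableOn ℂ (fun p : ℂ × ℂ => toFun p.1 p.2)
      ({τ : ℂ | 0 < τ.im} ×ˢ (Set.univ : Set ℂ))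
  slash_inv : ∀ a b c d : ℤ, a * d - b * c = 1 → ∀ τ z : ℂ, 0 < τ.im →
    ((c : ℂ) * τ + d) ^ (-k) *
        Complex.exp (-(2 * Real.pi * Complex.I * m * c * z ^ 2) / ((c : ℂ) * τ + d)) *
        toFun (((a : ℂ) * τ + b) / ((c : ℂ) * τ + d)) (z / ((c : ℂ) * τ + d)) =
      toFun τ z
  elliptic : ∀ lm mu : ℤ, ∀ τ z : ℂ, 0 < τ.im →
    Complex.exp (2 * Real.pi * Complex.I * m * ((lm : ℂ) ^ 2 * τ + 2 * lm * z)) *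
        toFun τ (z + lm * τ + mu) = toFun τ z
  coeff : ℤ → ℤ → ℂ
  coeff_neg_finite : {n : ℤ | n < 0 ∧ ∃ r : ℤ, coeff n r ≠ 0}.Finite
  expansion : ∀ τ z : ℂ, 0 < τ.im →
    HasSum (fun p : ℤ × ℤ => coeff p.1 p.2 * qc τ ^ p.1 * qc z ^ p.2) (toFun τ z)

/-- Meromorphy of weight `k` at all cusps: at each cusp `γ∞`, the function `F|_k γ` has a
Fourier expansion in fractional powers of `q` with only finitely many negative terms. -/
def MeromAtCusps (k : ℤ) (F : ℂ → ℂ) : Prop :=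
  ∀ a b c d : ℤ, a * d - b * c = 1 →
    ∃ (M : ℕ) (cs : ℤ → ℂ) (n₀ : ℤ), 0 < M ∧
      ∀ τ : ℂ, 0 < τ.im →
        HasSum
          (fun j : ℕ => cs (n₀ + j) *
            Complex.exp (2 * Real.pi * Complex.I * τ / M) ^ (n₀ + (j : ℤ)))
          (((c : ℂ) * τ + d) ^ (-k) * F (((a : ℂ) * τ + b) / ((c : ℂ) * τ + d)))

/-- The Möbius action of an element of `SL(2, ℝ)` on `ℂ`. -/
def moebius (g : SL2R) (z : ℂ) : ℂ :=
  ((g.1 0 0 : ℝ) * z + ((g.1 0 1 : ℝ) : ℂ)) / ((g.1 1 0 : ℝ) * z + ((g.1 1 1 : ℝ) : ℂ))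

/-- A weakly holomorphic modular function on `Γ`: holomorphic on the upper half-plane,
`Γ`-invariant, with poles only at the cusps. -/
def IsWeaklyHolModularFn (Γ : Subgroup SL2R) (f : ℂ → ℂ) : Prop :=
  DifferentiableOn ℂ f {z : ℂ | 0 < z.im} ∧
    (∀ g ∈ Γ, ∀ z : ℂ, 0 < z.im → f (moebius g z) = f z) ∧
    MeromAtCusps 0 f

/-- The set `L_{h, d/4N}` of vectors
`X = [[b + h/2N, c/N], [-a, -(b + h/2N)]]`, `a, b, c ∈ ℤ`, of norm `q(X) = d/4N`. -/
def LhSet (N : ℕ) (h d : ℤ) : Set (Matrix (Fin 2) (Fin 2) ℝ) :=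
  { X | ∃ a b c : ℤ,
      X = !![(b : ℝ) + (h : ℝ) / (2 * N), (c : ℝ) / N;
             -(a : ℝ), -((b : ℝ) + (h : ℝ) / (2 * N))] ∧
      (2 * b * N + h) ^ 2 - 4 * a * c * N = -d }

/-- The map `X ↦ N ⬝ [[0,-1],[1,0]] ⬝ X` from vectors to Gram matrices of quadratic forms. -/
def vecToForm (N : ℕ) (X : Matrix (Fin 2) (Fin 2) ℝ) : Matrix (Fin 2) (Fin 2) ℝ :=
  (N : ℝ) • (!![(0 : ℝ), -1; 1, 0] * X)

/-- Orbit relation of `Γ` acting by conjugation `g.X = g X g⁻¹` on a set `S` of vectors. -/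
def vecRel (Γ : Subgroup SL2R) (S : Set (Matrix (Fin 2) (Fin 2) ℝ)) (X X' : S) : Prop :=
  ∃ g ∈ Γ, X'.1 = g.1 * X.1 * (g⁻¹).1

/-- The Heegner point `D_X ∈ ℍ` of a vector `X` of positive norm. -/
def heegnerC (X : Matrix (Fin 2) (Fin 2) ℝ) : ℂ :=
  ((X 0 0 / X 1 0 : ℝ) : ℂ) + Complex.I * Real.sqrt (X.det / (X 1 0) ^ 2)

/-- The order of the stabilizer of the vector `X` in `Γ/{±1}`. -/
def vecStabOrder (Γ : Subgroup SL2R) (X : Matrix (Fin 2) (Fin 2) ℝ) : ℕ :=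
  Nat.card { g : SL2R // g ∈ Γ ∧ g.1 * X * (g⁻¹).1 = X } / 2

/-- The modular trace `t_f(h, m) = Σ_{X ∈ Γ\L_{h,m}} f(D_X) / |Γ̄_X|`. -/
def vecTrace (Γ : Subgroup SL2R) (f : ℂ → ℂ) (S : Set (Matrix (Fin 2) (Fin 2) ℝ)) : ℂ :=
  ∑ᶠ O : Quot (vecRel Γ S), f (heegnerC (Quot.out O).1) / (vecStabOrder Γ (Quot.out O).1 : ℂ)

/-- The weight-2 Eisenstein series `E₂(z) = 1 - 24 Σ_{n ≥ 1} σ₁(n) qⁿ`. -/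
def E2 (z : ℂ) : ℂ :=
  1 - 24 * ∑' n : ℕ, (∑ d ∈ Nat.divisors (n + 1), (d : ℂ)) * qc z ^ (n + 1)

/-- `E₂^{(N)}(z) = N E₂(Nz) - E₂(z)`. -/
def E2N (N : ℕ) (z : ℂ) : ℂ := (N : ℂ) * E2 ((N : ℂ) * z) - E2 z

noncomputable section

namespace FrickeTrace

open Filter Topology

/-- The primes `p` for which `X₀(p)` has genus zero. -/
class Lvl (p : ℕ) : Prop where
  mem : p = 2 ∨ p = 3 ∨ p = 5 ∨ p = 7 ∨ p = 13

theorem Lvl.prime (p : ℕ) [Lvl p] : p.Prime := by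
  rcases Lvl.mem (p := p) with h | h | h | h | h <;> subst h <;> norm_num

theorem Lvl.pos (p : ℕ) [Lvl p] : 0 < p := (Lvl.prime p).pos

theorem Lvl.two_le (p : ℕ) [Lvl p] : 2 ≤ p := (Lvl.prime p).two_le

theorem Lvl.cast_ne (p : ℕ) [Lvl p] : (p : ℂ) ≠ 0 := by exact_mod_cast (Lvl.pos p).ne'

/-- The exponent `24 / (p - 1)`. -/
def sx (p : ℕ) : ℕ := 24 / (p - 1)

theorem sx_mul (p : ℕ) [Lvl p] : sx p * (p - 1) = 24 := by
  rcases Lvl.mem (p := p) with h | h | h | h | h <;> subst h <;> rfl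

theorem sx_half (p : ℕ) [Lvl p] : sx p = 2 * (12 / (p - 1)) := by
  rcases Lvl.mem (p := p) with h | h | h | h | h <;> subst h <;> rfl

theorem sx_cast (p : ℕ) [Lvl p] : (sx p : ℂ) = 24 / ((p : ℂ) - 1) := by
  rcases Lvl.mem (p := p) with h | h | h | h | h <;> subst h <;> norm_num [sx]

/-! ### The local parameter at infinity -/

theorem qc_ne_zero (z : ℂ) : qc z ≠ 0 := Complex.exp_ne_zero _

theorem norm_qc (z : ℂ) : ‖qc z‖ = Real.exp (-(2 * Real.pi * z.im)) := by
  rw [qc, Complex.norm_exp]; congr 1; simp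

theorem norm_qc_lt_one {z : ℂ} (hz : 0 < z.im) : ‖qc z‖ < 1 := by
  rw [norm_qc, Real.exp_lt_one_iff]; have := Real.pi_pos; nlinarith [mul_pos this hz]

theorem qc_add (z w : ℂ) : qc (z + w) = qc z * qc w := by
  rw [qc, qc, qc, ← Complex.exp_add]; ring_nf

theorem qc_int (n : ℤ) : qc n = 1 := by
  rw [qc, Complex.exp_eq_one_iff]; exact ⟨n, by ring⟩

theorem qc_add_int (z : ℂ) (n : ℤ) : qc (z + n) = qc z := by rw [qc_add, qc_int, mul_one]

theorem qc_add_one (z : ℂ) : qc (z + 1) = qc z := by simpa using qc_add_int z 1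

theorem qc_nat_mul (n : ℕ) (z : ℂ) : qc (n * z) = qc z ^ n := by
  rw [qc, qc, ← Complex.exp_nat_mul]; ring_nf

theorem qc_eq_iff (z w : ℂ) : qc z = qc w ↔ ∃ n : ℤ, z = w + n := by
  rw [qc, qc, Complex.exp_eq_exp_iff_exists_int]
  have h0 : (2 * Real.pi * I : ℂ) ≠ 0 := by simp [Real.pi_ne_zero]
  constructor
  · rintro ⟨n, h⟩; refine ⟨n, mul_left_cancel₀ h0 ?_⟩; rw [h]; ring
  · rintro ⟨n, h⟩; exact ⟨n, by rw [h]; ring⟩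

theorem hasDerivAt_qc (z : ℂ) : HasDerivAt qc (2 * Real.pi * I * qc z) z := by
  have h := ((hasDerivAt_id z).const_mul (2 * Real.pi * I : ℂ)).cexp
  simp only [id, mul_one] at h
  rw [mul_comm]; exact h

theorem differentiable_qc : Differentiable ℂ qc := fun z => (hasDerivAt_qc z).differentiableAt

/-- The filter of neighbourhoods of `i∞`. -/
abbrev cusp : Filter ℂ := comap Complex.im atTop

theorem tendsto_qc_cusp : Tendsto qc cusp (𝓝 0) := by
  rw [tendsto_zero_iff_norm_tendsto_zero]
  simp only [norm_qc]
  refine Real.tendsto_exp_neg_atTop_nhds_zero.comp (Tendsto.const_mul_atTop (by positivity) tendsto_comap)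

instance : cusp.NeBot := by
  refine comap_neBot_iff_frequently.2 ?_
  refine Frequently.of_forall (fun y => ⟨⟨0, y⟩, rfl⟩)

theorem cusp_eventually_im (c : ℝ) : ∀ᶠ z in cusp, c < z.im := tendsto_comap.eventually_gt_atTop c

/-! ### The eta function -/

/-- Euler's product `∏ (1 - x^n)`. -/
def eul (x : ℂ) : ℂ := ∏' n : ℕ, (1 - x ^ (n + 1))

theorem dedekindEta_eq (z : ℂ) :
    dedekindEta z = Complex.exp (Real.pi * Complex.I * z / 12) * eul (qc z) := by
  rw [dedekindEta, eul]
  congr 1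
  refine tprod_congr fun n => ?_
  rw [qc, ← Complex.exp_nat_mul]; push_cast; ring_nf

theorem dedekindEta_eq_eta (z : ℂ) : dedekindEta z = ModularForm.eta z := by
  rw [dedekindEta, ModularForm.eta]
  congr 1
  · rw [Function.Periodic.qParam]; congr 1; push_cast; ring
  · refine tprod_congr fun n => ?_
    rw [ModularForm.eta_q_eq_cexp]

theorem dedekindEta_ne_zero {z : ℂ} (hz : 0 < z.im) : dedekindEta z ≠ 0 := by
  rw [dedekindEta_eq_eta]; exact ModularForm.eta_ne_zero hz

end FrickeTrace

end

noncomputable section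

namespace FrickeTrace

open Filter Topology

/-! ### Möbius transformations with integral coefficients -/

/-- Integral two by two matrices. -/
abbrev M2 := Matrix (Fin 2) (Fin 2) ℤ

/-- The denominator `c z + d`. -/
def den (M : M2) (z : ℂ) : ℂ := (M 1 0 : ℂ) * z + (M 1 1 : ℂ)

/-- The Möbius transformation attached to an integral matrix. -/
def mob (M : M2) (z : ℂ) : ℂ := ((M 0 0 : ℂ) * z + (M 0 1 : ℂ)) / den M z

theorem den_ne_zero {M : M2} (hM : 0 < M.det) {z : ℂ} (hz : 0 < z.im) : den M z ≠ 0 := by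
  intro h
  have h1 := congrArg Complex.im h
  have h2 := congrArg Complex.re h
  simp only [den, add_im, mul_im, intCast_re, intCast_im, zero_mul, add_zero, zero_im,
    add_re, mul_re, sub_zero, zero_re] at h1 h2
  have hc : M 1 0 = 0 := by
    rcases mul_eq_zero.1 h1 with h | h
    · exact_mod_cast h
    · exact absurd h hz.ne'
  rw [hc] at h2
  have hd : M 1 1 = 0 := by
    have : ((M 1 1 : ℤ) : ℝ) = 0 := by simpa using h2
    exact_mod_cast this
  rw [Matrix.det_fin_two, hc, hd] at hM
  simp at hM

theorem mob_im {M : M2} (z : ℂ) :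
    (mob M z).im = M.det * z.im / Complex.normSq (den M z) := by
  rw [mob, Complex.div_im, Matrix.det_fin_two]
  simp only [den, add_im, mul_im, intCast_re, intCast_im, zero_mul, add_zero, add_re, mul_re, sub_zero]
  rw [← sub_div]; congr 1; push_cast; ring

theorem mob_im_pos {M : M2} (hM : 0 < M.det) {z : ℂ} (hz : 0 < z.im) : 0 < (mob M z).im := by
  rw [mob_im]
  have := Complex.normSq_pos.2 (den_ne_zero hM hz)
  have : (0:ℝ) < M.det := by exact_mod_cast hM
  positivity

theorem den_mul {A B : M2} (hB : 0 < B.det) {z : ℂ} (hz : 0 < z.im) :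
    den (A * B) z = den A (mob B z) * den B z := by
  have hb := den_ne_zero hB hz
  rw [den, den, mob, add_mul, ← mul_div_assoc, div_mul_cancel₀ _ hb, den]
  simp only [Matrix.mul_apply, Fin.sum_univ_two]; push_cast; ring

theorem mob_mul {A B : M2} (hA : 0 < A.det) (hB : 0 < B.det) {z : ℂ} (hz : 0 < z.im) :
    mob (A * B) z = mob A (mob B z) := by
  have hb := den_ne_zero hB hz
  have ha := den_ne_zero hA (mob_im_pos hB hz)
  have : (A * B) 0 0 * z + (A * B) 0 1 = ((A 0 0 : ℂ) * mob B z + A 0 1) * den B z := by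
    rw [mob, add_mul, ← mul_div_assoc, div_mul_cancel₀ _ hb, den]
    simp only [Matrix.mul_apply, Fin.sum_univ_two]; push_cast; ring
  rw [mob, den_mul hB hz, this, mul_div_mul_right _ _ hb, ← mob]

theorem mob_one (z : ℂ) : mob 1 z = z := by simp [mob, den]

theorem mob_smul {k : ℤ} (hk : k ≠ 0) (M : M2) (z : ℂ) : mob (k • M) z = mob M z := by
  have hk' : (k : ℂ) ≠ 0 := by exact_mod_cast hk
  simp only [mob, den, Matrix.smul_apply, smul_eq_mul]; push_cast
  rw [← mul_div_mul_left ((M 0 0 : ℂ) * z + M 0 1) _ hk']; congr 1 <;> ring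

theorem mob_neg (M : M2) (z : ℂ) : mob (-M) z = mob M z := by
  simpa using mob_smul (k := -1) (by norm_num) M z

theorem hasDerivAt_mob {M : M2} (hM : 0 < M.det) {z : ℂ} (hz : 0 < z.im) :
    HasDerivAt (mob M) (M.det / den M z ^ 2) z := by
  have hd := den_ne_zero hM hz
  have h1 : HasDerivAt (fun z : ℂ => (M 0 0 : ℂ) * z + (M 0 1 : ℂ)) (M 0 0 : ℂ) z := by
    simpa using ((hasDerivAt_id z).const_mul (M 0 0 : ℂ)).add_const (M 0 1 : ℂ)
  have h2 : HasDerivAt (fun z : ℂ => (M 1 0 : ℂ) * z + (M 1 1 : ℂ)) (M 1 0 : ℂ) z := by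
    simpa using ((hasDerivAt_id z).const_mul (M 1 0 : ℂ)).add_const (M 1 1 : ℂ)
  have := h1.div h2 hd
  refine this.congr_deriv ?_
  rw [Matrix.det_fin_two, den]; push_cast; ring

theorem differentiableAt_mob {M : M2} (hM : 0 < M.det) {z : ℂ} (hz : 0 < z.im) :
    DifferentiableAt ℂ (mob M) z := (hasDerivAt_mob hM hz).differentiableAt

/-- Membership in `Γ₀(p)`. -/
structure IsG (p : ℕ) (M : M2) : Prop where
  det : M.det = 1
  dvd : (p : ℤ) ∣ M 1 0

theorem IsG.det_pos {p : ℕ} {M : M2} (h : IsG p M) : 0 < M.det := by rw [h.det]; norm_num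

theorem IsG.one (p : ℕ) : IsG p 1 := ⟨by simp, by simp⟩

theorem IsG.mul {p : ℕ} {A B : M2} (hA : IsG p A) (hB : IsG p B) : IsG p (A * B) := by
  refine ⟨by rw [Matrix.det_mul, hA.det, hB.det]; norm_num, ?_⟩
  simp only [Matrix.mul_apply, Fin.sum_univ_two]
  exact dvd_add (hA.dvd.mul_right _) (hB.dvd.mul_left _)

theorem IsG.adj {p : ℕ} {A : M2} (hA : IsG p A) : IsG p A.adjugate := by
  refine ⟨by rw [Matrix.det_adjugate, hA.det]; simp, ?_⟩
  simp [Matrix.adjugate_fin_two, hA.dvd]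

theorem IsG.mul_adj {p : ℕ} {A : M2} (hA : IsG p A) : A * A.adjugate = 1 := by
  rw [Matrix.mul_adjugate, hA.det, one_smul]

theorem IsG.adj_mul {p : ℕ} {A : M2} (hA : IsG p A) : A.adjugate * A = 1 := by
  rw [Matrix.adjugate_mul, hA.det, one_smul]

theorem IsG.neg {p : ℕ} {A : M2} (hA : IsG p A) : IsG p (-A) :=
  ⟨by rw [Matrix.det_neg, hA.det]; simp, by simpa using hA.dvd⟩

theorem IsG.mob_adj_mob {p : ℕ} {A : M2} (hA : IsG p A) {z : ℂ} (hz : 0 < z.im) :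
    mob A.adjugate (mob A z) = z := by
  rw [← mob_mul hA.adj.det_pos hA.det_pos hz, hA.adj_mul, mob_one]

theorem IsG.mob_mob_adj {p : ℕ} {A : M2} (hA : IsG p A) {z : ℂ} (hz : 0 < z.im) :
    mob A (mob A.adjugate z) = z := by
  rw [← mob_mul hA.det_pos hA.adj.det_pos hz, hA.mul_adj, mob_one]

theorem delta_mob {M : M2} (hM : M.det = 1) {z : ℂ} (hz : 0 < z.im) :
    dedekindEta (mob M z) ^ 24 = den M z ^ 12 * dedekindEta z ^ 24 := by
  let γ : Matrix.SpecialLinearGroup (Fin 2) ℤ := ⟨M, hM⟩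
  have h := SlashInvariantForm.slash_action_eqn' CuspForm.discriminant
    (γ := Matrix.SpecialLinearGroup.mapGL ℝ γ) (MonoidHom.mem_range.2 ⟨γ, rfl⟩) ⟨z, hz⟩
  have h2 : ((γ • (⟨z, hz⟩ : UpperHalfPlane) : UpperHalfPlane) : ℂ) = mob M z := by
    rw [UpperHalfPlane.coe_specialLinearGroup_apply]; simp [mob, den, γ]
  rw [dedekindEta_eq_eta, dedekindEta_eq_eta, ← h2]
  have h3 : den M z = (((Matrix.SpecialLinearGroup.mapGL ℝ γ) 1 0 : ℝ) : ℂ) * z +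
      (((Matrix.SpecialLinearGroup.mapGL ℝ γ) 1 1 : ℝ) : ℂ) := by
    change _ = ((algebraMap ℤ ℝ (M 1 0) : ℝ) : ℂ) * z + ((algebraMap ℤ ℝ (M 1 1) : ℝ) : ℂ)
    simp [den]
  rw [h3]
  exact_mod_cast h

end FrickeTrace

end

noncomputable section

namespace FrickeTrace

open Filter Topology

variable (p : ℕ)

/-! ### The Hauptmodul -/

/-- The eta quotient `(η(z)/η(pz))^{24/(p-1)}`. -/
def up (z : ℂ) : ℂ := (dedekindEta z / dedekindEta (p * z)) ^ sx p

/-- The Hauptmodul of `Γ₀(p)` with vanishing constant term. -/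
def hm (z : ℂ) : ℂ := up p z + sx p

/-- The Fricke involution. -/
def Wf (z : ℂ) : ℂ := -1 / (p * z)

/-- The constant `p^{12/(p-1)}`. -/
def kap : ℂ := (p : ℂ) ^ (12 / (p - 1))

theorem kap_ne [Lvl p] : kap p ≠ 0 := pow_ne_zero _ (Lvl.cast_ne p)

theorem jn_eq [Lvl p] (z : ℂ) : jn p z = hm p z := by
  have h6 : p ≠ 6 := by rcases Lvl.mem (p := p) with h | h | h | h | h <;> omega
  have h10 : p ≠ 10 := by rcases Lvl.mem (p := p) with h | h | h | h | h <;> omega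
  rw [jn, if_neg h6, if_neg h10, hm, up, sx_cast, sx]

theorem jnStar_eq [Lvl p] (z : ℂ) : jnStar p z = hm p z + kap p / up p z := by
  have h6 : p ≠ 6 := by rcases Lvl.mem (p := p) with h | h | h | h | h <;> omega
  have h10 : p ≠ 10 := by rcases Lvl.mem (p := p) with h | h | h | h | h <;> omega
  rw [jnStar, if_neg h6, if_neg h10, hm, up, sx_cast, sx, kap, div_eq_mul_inv (_ ^ _) (_ ^ _),
    ← inv_pow, inv_div]

theorem im_mul_pos [Lvl p] {z : ℂ} (hz : 0 < z.im) : 0 < ((p : ℂ) * z).im := by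
  have : (0 : ℝ) < p := by exact_mod_cast Lvl.pos p
  simp; positivity

theorem up_ne_zero [Lvl p] {z : ℂ} (hz : 0 < z.im) : up p z ≠ 0 :=
  pow_ne_zero _ (div_ne_zero (dedekindEta_ne_zero hz) (dedekindEta_ne_zero (im_mul_pos p hz)))

theorem Wf_im_pos [Lvl p] {z : ℂ} (hz : 0 < z.im) : 0 < (Wf p z).im := by
  have h := im_mul_pos p hz
  rw [Wf, neg_div, Complex.neg_im, one_div, Complex.inv_im, neg_div, neg_neg]
  exact div_pos h (Complex.normSq_pos.2 (by intro h0; rw [h0] at h; simp at h))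

theorem ne_zero_of_im_pos {z : ℂ} (hz : 0 < z.im) : z ≠ 0 := by
  intro h; rw [h] at hz; simp at hz

theorem Wf_Wf [Lvl p] {z : ℂ} (hz : 0 < z.im) : Wf p (Wf p z) = z := by
  have := ne_zero_of_im_pos hz
  have := Lvl.cast_ne p
  rw [Wf, Wf]; field_simp

theorem eta_S {z : ℂ} (hz : 0 < z.im) :
    dedekindEta (-1 / z) = (Complex.sqrt I)⁻¹ * (Complex.sqrt z * dedekindEta z) := by
  have h := ModularForm.eta_comp_eq_csqrt_I_inv (x := z) hz
  rw [dedekindEta_eq_eta, dedekindEta_eq_eta]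
  simpa using h

theorem csqrt_sq {z : ℂ} : Complex.sqrt z ^ 2 = z := by
  rw [Complex.sqrt, ← Complex.cpow_nat_mul]; simp

theorem csqrt_ne {z : ℂ} (hz : z ≠ 0) : Complex.sqrt z ≠ 0 := by
  intro h; apply hz; rw [← csqrt_sq (z := z), h]; simp

theorem up_Wf [Lvl p] {z : ℂ} (hz : 0 < z.im) : up p (Wf p z) = kap p / up p z := by
  have hpz := im_mul_pos p hz
  have hp0 := Lvl.cast_ne p
  have hz0 := ne_zero_of_im_pos hz
  have e2 : (p : ℂ) * Wf p z = -1 / z := by rw [Wf]; field_simp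
  have h1 := dedekindEta_ne_zero hz
  have h2 := dedekindEta_ne_zero hpz
  have h3 := csqrt_ne hz0
  have h4 := csqrt_ne I_ne_zero
  rw [up, e2, Wf, eta_S hz, eta_S hpz, up, kap]
  have key : ((Complex.sqrt I)⁻¹ * (Complex.sqrt (p * z) * dedekindEta (p * z))) /
      ((Complex.sqrt I)⁻¹ * (Complex.sqrt z * dedekindEta z)) =
      (Complex.sqrt (p * z) / Complex.sqrt z) * (dedekindEta z / dedekindEta (p * z))⁻¹ := by
    field_simp
  rw [key, mul_pow, inv_pow, ← div_eq_mul_inv]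
  congr 1
  rw [sx_half, pow_mul]
  congr 1
  rw [div_pow, csqrt_sq, csqrt_sq, mul_div_cancel_right₀ _ hz0]

/-! ### Expansion at infinity -/

theorem differentiableOn_eul : DifferentiableOn ℂ eul (Metric.ball 0 1) :=
  ModularForm.differentiableOn_tprod_one_sub_pow

theorem eul_zero : eul 0 = 1 := by simp [eul]

theorem exists_qc {x : ℂ} (h0 : x ≠ 0) (hx : ‖x‖ < 1) : ∃ z : ℂ, 0 < z.im ∧ qc z = x := by
  refine ⟨Function.Periodic.invQParam 1 x, ?_, ?_⟩
  · rw [Function.Periodic.im_invQParam]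
    have : Real.log ‖x‖ < 0 := Real.log_neg (norm_pos_iff.2 h0) hx
    have := Real.pi_pos
    rw [neg_div, neg_mul, neg_pos]; exact mul_neg_of_pos_of_neg (by positivity) (by assumption)
  · have := Function.Periodic.qParam_right_inv (h := 1) one_ne_zero h0
    rw [Function.Periodic.qParam] at this
    simpa [qc] using this

theorem eul_ne_zero {x : ℂ} (hx : ‖x‖ < 1) : eul x ≠ 0 := by
  rcases eq_or_ne x 0 with rfl | h0
  · simp [eul_zero]
  · obtain ⟨z, hz, rfl⟩ := exists_qc h0 hx
    have := dedekindEta_ne_zero hz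
    rw [dedekindEta_eq] at this
    exact right_ne_zero_of_mul this

/-- The function of `q` given by `q` times the eta quotient. -/
def U0 (x : ℂ) : ℂ := (eul x / eul (x ^ p)) ^ sx p

theorem norm_pow_lt_one [Lvl p] {x : ℂ} (hx : ‖x‖ < 1) : ‖x ^ p‖ < 1 := by
  rw [norm_pow]; exact pow_lt_one₀ (norm_nonneg _) hx (Lvl.pos p).ne'

theorem differentiableOn_U0 [Lvl p] : DifferentiableOn ℂ (U0 p) (Metric.ball 0 1) := by
  refine DifferentiableOn.pow (DifferentiableOn.div differentiableOn_eul ?_ ?_) _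
  · refine differentiableOn_eul.comp (by fun_prop) fun x hx => ?_
    simp only [Metric.mem_ball, dist_zero_right] at hx ⊢
    exact norm_pow_lt_one p hx
  · intro x hx
    simp only [Metric.mem_ball, dist_zero_right] at hx
    exact eul_ne_zero (norm_pow_lt_one p hx)

theorem U0_zero [Lvl p] : U0 p 0 = 1 := by
  simp [U0, eul_zero, (Lvl.pos p).ne']

theorem up_eq [Lvl p] (z : ℂ) : up p z = U0 p (qc z) / qc z := by
  rw [up, dedekindEta_eq, dedekindEta_eq, qc_nat_mul, U0, mul_div_mul_comm, mul_pow, mul_comm,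
    div_eq_mul_inv _ (qc z)]
  congr 1
  rw [← Complex.exp_sub, ← Complex.exp_nat_mul, qc, ← Complex.exp_neg]
  congr 1
  have h : (sx p : ℂ) * ((p : ℂ) - 1) = 24 := by
    have := sx_mul p
    have h2 := Lvl.two_le p
    zify [show 1 ≤ p by omega] at this
    exact_mod_cast this
  linear_combination (-(Real.pi * I * z / 12)) * h

theorem up_add_int [Lvl p] (z : ℂ) (n : ℤ) : up p (z + n) = up p z := by
  rw [up_eq, up_eq, qc_add_int]

theorem differentiableAt_up [Lvl p] {z : ℂ} (hz : 0 < z.im) : DifferentiableAt ℂ (up p) z := by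
  have : up p = fun z => U0 p (qc z) / qc z := funext (up_eq p)
  rw [this]
  refine DifferentiableAt.div ?_ (differentiable_qc z) (qc_ne_zero z)
  refine DifferentiableAt.comp (g := U0 p) z ?_ (differentiable_qc z)
  exact (differentiableOn_U0 p).differentiableAt
    (Metric.isOpen_ball.mem_nhds (by simpa using norm_qc_lt_one hz))

theorem differentiableAt_hm [Lvl p] {z : ℂ} (hz : 0 < z.im) : DifferentiableAt ℂ (hm p) z :=
  (differentiableAt_up p hz).add_const _

theorem differentiableAt_Wf [Lvl p] {z : ℂ} (hz : 0 < z.im) : DifferentiableAt ℂ (Wf p) z := by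
  refine DifferentiableAt.div (by fun_prop) (by fun_prop) ?_
  exact ne_zero_of_im_pos (im_mul_pos p hz)

theorem isOpen_uhp : IsOpen {z : ℂ | 0 < z.im} := isOpen_lt continuous_const Complex.continuous_im

theorem isPreconnected_uhp : IsPreconnected {z : ℂ | 0 < z.im} :=
  (convex_halfSpace_im_gt 0).isPreconnected

/-! ### Invariance under `Γ₀(p)` -/

theorem up_pow [Lvl p] (z : ℂ) :
    up p z ^ (p - 1) = dedekindEta z ^ 24 / dedekindEta (p * z) ^ 24 := by
  rw [up, ← pow_mul, sx_mul, div_pow]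

theorem mul_mob [Lvl p] {M : M2} {c : ℤ} (hc : M 1 0 = p * c) (z : ℂ) :
    (p : ℂ) * mob M z = mob !![M 0 0, p * M 0 1; c, M 1 1] (p * z) ∧
      den !![M 0 0, p * M 0 1; c, M 1 1] (p * z) = den M z := by
  have h1 : den !![M 0 0, p * M 0 1; c, M 1 1] (p * z) = den M z := by
    simp [den, hc]; ring
  refine ⟨?_, h1⟩
  rw [mob, mob, h1, ← mul_div_assoc]; simp; ring

theorem up_mob_pow [Lvl p] {M : M2} (hM : IsG p M) {z : ℂ} (hz : 0 < z.im) :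
    up p (mob M z) ^ (p - 1) = up p z ^ (p - 1) := by
  obtain ⟨c, hc⟩ := hM.dvd
  obtain ⟨h1, h2⟩ := mul_mob p hc z
  have hd : Matrix.det !![M 0 0, p * M 0 1; c, M 1 1] = 1 := by
    have := hM.det
    rw [Matrix.det_fin_two, hc] at this
    rw [Matrix.det_fin_two_of]; linear_combination this
  rw [up_pow, up_pow, h1, delta_mob hM.det hz, delta_mob hd (im_mul_pos p hz), h2]
  rw [mul_div_mul_left]
  exact pow_ne_zero _ (den_ne_zero hM.det_pos hz)

theorem exists_char [Lvl p] {M : M2} (hM : IsG p M) :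
    ∃ χ : ℂ, ∀ z : ℂ, 0 < z.im → up p (mob M z) = χ * up p z := by
  let f : ℂ → ℂ := fun z => up p (mob M z) / up p z
  have hf : ∀ z : ℂ, 0 < z.im → DifferentiableAt ℂ f z := fun z hz =>
    ((differentiableAt_up p (mob_im_pos hM.det_pos hz)).comp z
      (differentiableAt_mob hM.det_pos hz)).div (differentiableAt_up p hz) (up_ne_zero p hz)
  have h1 : ∀ z : ℂ, 0 < z.im → f z ^ (p - 1) = 1 := fun z hz => by
    simp only [f]
    rw [div_pow, up_mob_pow p hM hz, div_self (pow_ne_zero _ (up_ne_zero p hz))]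
  have hd : Set.EqOn (deriv f) 0 {z : ℂ | 0 < z.im} := by
    intro z hz
    have e : (fun w => f w ^ (p - 1)) =ᶠ[𝓝 z] fun _ => 1 := by
      filter_upwards [isOpen_uhp.mem_nhds hz] with w hw using h1 w hw
    have h2 := e.deriv_eq
    rw [deriv_const, ((hf z hz).hasDerivAt.fun_pow (p - 1)).deriv] at h2
    have hne : f z ≠ 0 := div_ne_zero (up_ne_zero p (mob_im_pos hM.det_pos hz)) (up_ne_zero p hz)
    have hp1 : ((p - 1 : ℕ) : ℂ) ≠ 0 := by
      have := Lvl.two_le p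
      exact_mod_cast (by omega : p - 1 ≠ 0)
    simpa [hp1, hne] using h2
  obtain ⟨χ, hχ⟩ := isOpen_uhp.exists_is_const_of_deriv_eq_zero isPreconnected_uhp
    (fun z hz => (hf z hz).differentiableWithinAt) hd
  refine ⟨χ, fun z hz => ?_⟩
  rw [← hχ z hz, div_mul_cancel₀ _ (up_ne_zero p hz)]

/-- The matrices in `Γ₀(p)` that fix the eta quotient. -/
structure InK (M : M2) : Prop where
  isG : IsG p M
  inv : ∀ z : ℂ, 0 < z.im → up p (mob M z) = up p z

variable {p}

theorem InK.mul {A B : M2} (hA : InK p A) (hB : InK p B) : InK p (A * B) :=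
  ⟨hA.isG.mul hB.isG, fun z hz => by
    rw [mob_mul hA.isG.det_pos hB.isG.det_pos hz, hA.inv _ (mob_im_pos hB.isG.det_pos hz),
      hB.inv z hz]⟩

theorem InK.adj {A : M2} (hA : InK p A) : InK p A.adjugate :=
  ⟨hA.isG.adj, fun z hz => by
    rw [← hA.inv _ (mob_im_pos hA.isG.adj.det_pos hz), hA.isG.mob_mob_adj hz]⟩

theorem InK.neg {A : M2} (hA : InK p A) : InK p (-A) :=
  ⟨hA.isG.neg, fun z hz => by rw [mob_neg, hA.inv z hz]⟩

theorem InK.of_mul {A B : M2} (hB : InK p B) (h : InK p (A * B)) : InK p A := by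
  have := h.mul hB.adj
  rwa [mul_assoc, hB.isG.mul_adj, mul_one] at this

theorem InK.T [Lvl p] (k : ℤ) : InK p !![1, k; 0, 1] :=
  ⟨⟨by simp, by simp⟩, fun z _ => by
    rw [← up_add_int p z k]; simp [mob, den]⟩

theorem InK.elliptic [Lvl p] {M : M2} (hM : IsG p M) (hc : 0 < M 1 0)
    (ht : (M 0 0 + M 1 1) ^ 2 < 4) : InK p M := by
  refine ⟨hM, ?_⟩
  obtain ⟨χ, hχ⟩ := exists_char p hM
  have hdet := hM.det
  rw [Matrix.det_fin_two] at hdet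
  set a := M 0 0
  set b := M 0 1
  set c := M 1 0
  set d := M 1 1
  let y : ℝ := Real.sqrt (4 - ((a + d : ℤ) : ℝ) ^ 2)
  have hy0 : (0 : ℝ) < 4 - ((a + d : ℤ) : ℝ) ^ 2 := by
    have : (((a + d) ^ 2 : ℤ) : ℝ) < 4 := by exact_mod_cast ht
    push_cast at this ⊢; linarith
  have hy : 0 < y := Real.sqrt_pos.2 hy0
  have hcR : (0 : ℝ) < c := by exact_mod_cast hc
  have hcC : (c : ℂ) ≠ 0 := by exact_mod_cast hc.ne'
  let z : ℂ := ((a - d : ℤ) + y * I) / (2 * c)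
  have hyy : (y : ℂ) ^ 2 = 4 - ((a : ℂ) + d) ^ 2 := by
    have := Real.sq_sqrt hy0.le
    have h2 : ((y ^ 2 : ℝ) : ℂ) = ((4 - ((a + d : ℤ) : ℝ) ^ 2 : ℝ) : ℂ) := by rw [← this]
    push_cast at h2; exact h2
  have hz : 0 < z.im := by
    have : z = ((((a - d : ℤ) : ℝ) / (2 * c) : ℝ) : ℂ) + ((y / (2 * c) : ℝ) : ℂ) * I := by
      simp only [z]; push_cast; field_simp
    rw [this, add_im, ofReal_im, zero_add, im_ofReal_mul, I_im, mul_one]; positivity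
  have hzz : z * (2 * c) = (a - d : ℤ) + y * I := by
    simp only [z]; field_simp
  have hfix : mob M z = z := by
    have hden := den_ne_zero hM.det_pos hz
    rw [mob, div_eq_iff hden, den]
    have hdet' : (a : ℂ) * d - b * c = 1 := by exact_mod_cast hdet
    refine mul_left_cancel₀ (mul_ne_zero (by norm_num : (4 : ℂ) ≠ 0) hcC) ?_
    push_cast at hzz
    change (4 * c : ℂ) * (a * z + b) = 4 * c * (z * (c * z + d))
    linear_combination (-4 : ℂ) * hdet' - (z * 2 * c - (a - d) + y * I) * hzz + hyy
      - (y : ℂ) ^ 2 * I_sq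
  have h1 := hχ z hz
  rw [hfix] at h1
  have hχ1 : χ = 1 := by
    have := up_ne_zero p hz
    field_simp at h1
    exact h1.symm
  intro w hw
  rw [hχ w hw, hχ1, one_mul]

end FrickeTrace

end

noncomputable section

namespace FrickeTrace

open Filter Topology

variable {p : ℕ}

theorem InK.V [Lvl p] : InK p !![1, 0; (p : ℤ), 1] := by
  have hG : IsG p !![1, 0; (p : ℤ), 1] := ⟨by simp, by simp⟩
  refine ⟨hG, fun z hz => ?_⟩
  have hw := mob_im_pos hG.det_pos hz
  have hden := den_ne_zero hG.det_pos hz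
  have hp0 := Lvl.cast_ne p
  have hz0 := ne_zero_of_im_pos hz
  have e : Wf p (mob !![1, 0; (p : ℤ), 1] z) = Wf p z + (-1 : ℤ) := by
    simp only [den, of_apply, cons_val', cons_val_zero, cons_val_one, cons_val_fin_one,
      Int.cast_natCast, Int.cast_one] at hden
    simp only [Wf, mob, den, of_apply, cons_val', cons_val_zero, cons_val_one, cons_val_fin_one,
      Int.cast_natCast, Int.cast_one, Int.cast_zero, one_mul, add_zero, Int.cast_neg]
    field_simp; ring
  have h1 := up_Wf p (Wf_im_pos p hw)
  have h2 := up_Wf p (Wf_im_pos p hz)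
  rw [Wf_Wf p hw, e, up_add_int, ← h2, Wf_Wf p hz] at h1
  exact h1

/-- The integer `a` is the upper left entry of an element of `InK` with lower left entry `p`. -/
def Good (p : ℕ) (a : ℤ) : Prop := ∃ M : M2, InK p M ∧ M 1 0 = p ∧ M 0 0 = a

theorem Good.add_mul [Lvl p] {a : ℤ} (h : Good p a) (k : ℤ) : Good p (a + k * p) := by
  obtain ⟨M, hM, h1, h2⟩ := h
  refine ⟨!![1, k; 0, 1] * M, (InK.T k).mul hM, ?_, ?_⟩
  · simp [Matrix.mul_apply, Fin.sum_univ_two, h1]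
  · simp [Matrix.mul_apply, Fin.sum_univ_two, h1, h2]

theorem Good.of_emod [Lvl p] {a : ℤ} (h : Good p (a % p)) : Good p a := by
  have := h.add_mul (a / p)
  rwa [mul_comm, Int.emod_add_mul_ediv] at this

theorem InK.ell [Lvl p] (a b d : ℤ) (h : a * d - b * p = 1) (ht : (a + d) ^ 2 < 4) :
    InK p !![a, b; (p : ℤ), d] := by
  refine InK.elliptic ⟨by rw [Matrix.det_fin_two_of]; exact h, by simp⟩ ?_ ?_
  · simpa using Lvl.pos p
  · simpa using ht

theorem Good.ell [Lvl p] {a : ℤ} (b d : ℤ) (h : a * d - b * p = 1) (ht : (a + d) ^ 2 < 4) :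
    Good p a := ⟨_, InK.ell a b d h ht, by simp, by simp⟩

theorem Good.one [Lvl p] : Good p 1 := ⟨_, InK.V, by simp, by simp⟩

theorem Good.neg_one [Lvl p] : Good p (p - 1) := by
  have : Good p (-1) := ⟨_, (InK.V (p := p)).adj.neg, by simp [Matrix.adjugate_fin_two],
    by simp [Matrix.adjugate_fin_two]⟩
  convert this.add_mul 1 using 1; ring

theorem Good.of_prod [Lvl p] {A B : M2} {a : ℤ} (hA : InK p A) (hB : InK p B) (j : ℤ)
    (h1 : (A * !![1, j; 0, 1] * B) 1 0 = p) (h2 : (A * !![1, j; 0, 1] * B) 0 0 = a) : Good p a :=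
  ⟨_, (hA.mul (InK.T j)).mul hB, h1, h2⟩

theorem Good.of_prod_neg [Lvl p] {A B : M2} {a : ℤ} (hA : InK p A) (hB : InK p B) (j : ℤ)
    (h1 : (A * !![1, j; 0, 1] * B) 1 0 = -p) (h2 : (A * !![1, j; 0, 1] * B) 0 0 = -a) :
    Good p a :=
  ⟨_, ((hA.mul (InK.T j)).mul hB).neg, by simp [h1], by simp [h2]⟩

theorem good_five : ∀ a : ℤ, 0 < a → a < 5 → Good 5 a := by
  have : Lvl 5 := ⟨by norm_num⟩
  intro a h0 h1
  interval_cases a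
  · exact Good.one
  · exact Good.ell (-1) (-2) (by norm_num) (by norm_num)
  · exact Good.ell (-2) (-3) (by norm_num) (by norm_num)
  · exact Good.neg_one

theorem good_seven : ∀ a : ℤ, 0 < a → a < 7 → Good 7 a := by
  have : Lvl 7 := ⟨by norm_num⟩
  intro a h0 h1
  interval_cases a
  · exact Good.one
  · exact Good.ell (-1) (-3) (by norm_num) (by norm_num)
  · exact Good.ell (-1) (-2) (by norm_num) (by norm_num)
  · exact Good.ell (-3) (-5) (by norm_num) (by norm_num)
  · exact Good.ell (-3) (-4) (by norm_num) (by norm_num)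
  · exact Good.neg_one

theorem good_thirteen : ∀ a : ℤ, 0 < a → a < 13 → Good 13 a := by
  have : Lvl 13 := ⟨by norm_num⟩
  intro a h0 h1
  interval_cases a
  · exact Good.one
  · have : Good 13 (-11) := Good.of_prod (InK.ell (-10) (-7) 9 (by norm_num) (by norm_num))
      (InK.ell 5 (-2) (-5) (by norm_num) (by norm_num)) (-1) (by norm_num [Matrix.mul_apply, Fin.sum_univ_two])
      (by norm_num [Matrix.mul_apply, Fin.sum_univ_two])
    exact this.add_mul 1
  · exact Good.ell (-1) (-4) (by norm_num) (by norm_num)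
  · exact Good.ell (-1) (-3) (by norm_num) (by norm_num)
  · exact Good.ell (-2) (-5) (by norm_num) (by norm_num)
  · have : Good 13 (-7) := Good.of_prod_neg (InK.ell (-8) (-5) 8 (by norm_num) (by norm_num))
      (InK.ell 4 (-1) (-3) (by norm_num) (by norm_num)) (-1) (by norm_num [Matrix.mul_apply, Fin.sum_univ_two])
      (by norm_num [Matrix.mul_apply, Fin.sum_univ_two])
    exact this.add_mul 1
  · have : Good 13 (-6) := Good.of_prod (InK.ell (-5) (-2) 5 (by norm_num) (by norm_num))
      (InK.ell 9 (-7) (-10) (by norm_num) (by norm_num)) (-1) (by norm_num [Matrix.mul_apply, Fin.sum_univ_two])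
      (by norm_num [Matrix.mul_apply, Fin.sum_univ_two])
    exact this.add_mul 1
  · exact Good.ell (-5) (-8) (by norm_num) (by norm_num)
  · exact Good.ell (-7) (-10) (by norm_num) (by norm_num)
  · exact Good.ell (-7) (-9) (by norm_num) (by norm_num)
  · have : Good 13 (-2) := Good.of_prod_neg (InK.ell (-3) (-1) 4 (by norm_num) (by norm_num))
      (InK.ell 8 (-5) (-8) (by norm_num) (by norm_num)) (-1) (by norm_num [Matrix.mul_apply, Fin.sum_univ_two])
      (by norm_num [Matrix.mul_apply, Fin.sum_univ_two])
    exact this.add_mul 1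
  · exact Good.neg_one

theorem good_of_not_dvd [hp : Lvl p] {a : ℤ} (ha : ¬ (p : ℤ) ∣ a) : Good p a := by
  apply Good.of_emod
  have hpos : (0 : ℤ) < p := by exact_mod_cast Lvl.pos p
  have h1 := Int.emod_nonneg a hpos.ne'
  have h2 := Int.emod_lt_of_pos a hpos
  have h3 : a % p ≠ 0 := fun h => ha (Int.dvd_of_emod_eq_zero h)
  have h4 : 0 < a % p := lt_of_le_of_ne h1 h3.symm
  generalize a % p = b at h2 h4
  rcases hp.mem with h | h | h | h | h <;> subst h
  · have : b = 1 := by push_cast at h2; omega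
    rw [this]; exact Good.one
  · have : b = 1 ∨ b = 2 := by push_cast at h2; omega
    rcases this with rfl | rfl
    · exact Good.one
    · exact Good.neg_one
  · exact good_five b h4 (by exact_mod_cast h2)
  · exact good_seven b h4 (by exact_mod_cast h2)
  · exact good_thirteen b h4 (by exact_mod_cast h2)

theorem inK_of_isG_aux [Lvl p] (n : ℕ) : ∀ M : M2, IsG p M → ∀ C : ℤ, M 1 0 = p * C →
    C.natAbs ≤ n → InK p M := by
  have hpos : (0 : ℤ) < p := by exact_mod_cast Lvl.pos p
  have hp2 : (2 : ℤ) ≤ p := by exact_mod_cast Lvl.two_le p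
  induction n with
  | zero =>
    intro M hM C hC hn
    have hC0 : C = 0 := by omega
    have h10 : M 1 0 = 0 := by rw [hC, hC0, mul_zero]
    have hdet := hM.det
    rw [Matrix.det_fin_two, h10, mul_zero, sub_zero] at hdet
    rcases Int.mul_eq_one_iff_eq_one_or_neg_one.1 hdet with ⟨h1, h2⟩ | ⟨h1, h2⟩
    · have : M = !![1, M 0 1; 0, 1] := by
        ext i j; fin_cases i <;> fin_cases j <;> simp [h1, h2, h10]
      rw [this]; exact InK.T _
    · have : M = -!![1, -M 0 1; 0, 1] := by
        ext i j; fin_cases i <;> fin_cases j <;> simp [h1, h2, h10]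
      rw [this]; exact (InK.T _).neg
  | succ n ih =>
    intro M hM C hC hn
    by_cases hlt : C.natAbs ≤ n
    · exact ih M hM C hC hlt
    have hC0 : C ≠ 0 := by omega
    have step : ∀ a : ℤ, ¬ (p : ℤ) ∣ a → |C * a + M 1 1| < |C| → InK p M := by
      intro a ha hlt'
      obtain ⟨E, hE, h1, h2⟩ := good_of_not_dvd ha
      refine InK.of_mul hE (ih _ (hM.mul hE.isG) (C * a + M 1 1) ?_ ?_)
      · rw [Matrix.mul_apply, Fin.sum_univ_two, hC, h1, h2]; ring
      · have h3 : (C * a + M 1 1).natAbs < C.natAbs := by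
          rwa [Int.abs_eq_natAbs, Int.abs_eq_natAbs, Nat.cast_lt] at hlt'
        omega
    have hdiv := Int.emod_add_mul_ediv (M 1 1) C
    have hr0 := Int.emod_nonneg (M 1 1) hC0
    have hr1 := Int.emod_lt_abs (M 1 1) hC0
    set r := M 1 1 % C
    set a := -(M 1 1 / C) with ha
    have hr : C * a + M 1 1 = r := by rw [ha]; linarith
    by_cases hpa : (p : ℤ) ∣ a
    · have hr' : r ≠ 0 := by
        intro h0
        have hdet := hM.det
        rw [Matrix.det_fin_two, hC] at hdet
        obtain ⟨k, hk⟩ := hpa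
        have : (p : ℤ) ∣ 1 := ⟨- M 0 0 * C * k - M 0 1 * C, by
          rw [← hdet]
          have : M 1 1 = - (C * (p * k)) := by rw [← hk]; linarith
          rw [this]; ring⟩
        have := Int.le_of_dvd one_pos this
        omega
      have hnd : ∀ e : ℤ, (e = 1 ∨ e = -1) → ¬ (p : ℤ) ∣ a + e := by
        intro e he hd
        have h1 := (dvd_add_right hpa).1 hd
        have : (p : ℤ) ∣ 1 := by rcases he with rfl | rfl <;> simpa using h1
        have := Int.le_of_dvd one_pos this
        omega
      rcases lt_or_gt_of_ne hC0 with hneg | hpos'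
      · refine step (a + 1) (hnd 1 (Or.inl rfl)) ?_
        rw [show C * (a + 1) + M 1 1 = r + C by rw [← hr]; ring]
        rw [abs_of_neg hneg] at hr1 ⊢
        rw [abs_lt]; constructor <;> omega
      · refine step (a + -1) (hnd (-1) (Or.inr rfl)) ?_
        rw [show C * (a + -1) + M 1 1 = r - C by rw [← hr]; ring]
        rw [abs_of_pos hpos'] at hr1 ⊢
        rw [abs_lt]; constructor <;> omega
    · refine step a hpa ?_
      rw [hr, abs_of_nonneg hr0]; exact hr1

theorem up_mob [Lvl p] {M : M2} (hM : IsG p M) {z : ℂ} (hz : 0 < z.im) :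
    up p (mob M z) = up p z := by
  obtain ⟨C, hC⟩ := hM.dvd
  exact (inK_of_isG_aux _ M hM C hC le_rfl).inv z hz

theorem hm_mob [Lvl p] {M : M2} (hM : IsG p M) {z : ℂ} (hz : 0 < z.im) :
    hm p (mob M z) = hm p z := by rw [hm, up_mob hM hz, hm]

end FrickeTrace

end

noncomputable section

namespace FrickeTrace

open Filter Topology

variable {p : ℕ}

/-- Invariance under `Γ₀(p)`. -/
def Inv (p : ℕ) (f : ℂ → ℂ) : Prop := ∀ M, IsG p M → ∀ z : ℂ, 0 < z.im → f (mob M z) = f z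

/-- Holomorphy on the upper half-plane. -/
def Hol (f : ℂ → ℂ) : Prop := ∀ z : ℂ, 0 < z.im → DifferentiableAt ℂ f z

/-- Boundedness near `i∞`. -/
def BddC (f : ℂ → ℂ) : Prop := ∃ C A : ℝ, ∀ z : ℂ, A ≤ z.im → ‖f z‖ ≤ C

theorem BddC.of_tendsto {f : ℂ → ℂ} {l : ℂ} (h : Tendsto f cusp (𝓝 l)) : BddC f := by
  have h1 : ∀ᶠ z in cusp, ‖f z‖ ≤ ‖l‖ + 1 := by
    filter_upwards [h.norm.eventually_lt_const (lt_add_one ‖l‖)] with z hz using hz.le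
  obtain ⟨s, hs, h2⟩ := mem_comap.1 h1
  obtain ⟨A, hA⟩ := mem_atTop_sets.1 hs
  exact ⟨‖l‖ + 1, A, fun z hz => h2 (hA _ hz)⟩

/-- The matrix of `S T^j`. -/
abbrev ST (j : ℤ) : M2 := !![0, -1; 1, j]

theorem ST_det (j : ℤ) : (ST j).det = 1 := by simp

theorem mob_ST (j : ℤ) (z : ℂ) : mob (ST j) z = -1 / (z + j) := by simp [mob, den]

theorem exists_ST_mul [Lvl p] {M : M2} (hM : M.det = 1) (hc : ¬ (p : ℤ) ∣ M 1 0) :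
    ∃ j : ℤ, 0 ≤ j ∧ j < p ∧ IsG p (ST j * M) := by
  have hpos : (0 : ℤ) < p := by exact_mod_cast Lvl.pos p
  have hp := Nat.prime_iff_prime_int.1 (Lvl.prime p)
  have hcop : IsCoprime (p : ℤ) (M 1 0) := (Prime.coprime_iff_not_dvd hp).2 hc
  obtain ⟨x, y, hxy⟩ := hcop
  refine ⟨(-(y * M 0 0)) % p, Int.emod_nonneg _ hpos.ne', Int.emod_lt_of_pos _ hpos,
    by rw [Matrix.det_mul, ST_det, hM, one_mul], ?_⟩
  have h1 : (ST ((-(y * M 0 0)) % p) * M) 1 0 = M 0 0 + (-(y * M 0 0)) % p * M 1 0 := by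
    simp [Matrix.mul_apply, Fin.sum_univ_two]
  rw [h1]
  obtain ⟨k, hk⟩ : ∃ k, (-(y * M 0 0)) % p = -(y * M 0 0) + p * k :=
    ⟨-(-(y * M 0 0) / p), by have := Int.emod_add_mul_ediv (-(y * M 0 0)) p; linarith⟩
  rw [hk]
  exact ⟨M 0 0 * x + k * M 1 0, by linear_combination (-(M 0 0)) * hxy⟩

theorem Wf_div [Lvl p] (z : ℂ) : Wf p (z / p) = -1 / z := by
  have := Lvl.cast_ne p
  rw [Wf, mul_div_cancel₀ _ this]

theorem exists_reduce [Lvl p] {z : ℂ} (hz : 0 < z.im) :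
    ∃ M, IsG p M ∧ ∃ w : ℂ, |w.re| ≤ 1 ∧ 1 / (2 * p) ≤ w.im ∧
      (mob M z = w ∨ mob M z = Wf p w) := by
  obtain ⟨γ, hγ⟩ := ModularGroup.exists_smul_mem_fd ⟨z, hz⟩
  set y : ℂ := ((γ • (⟨z, hz⟩ : UpperHalfPlane) : UpperHalfPlane) : ℂ) with hy
  have hymob : mob γ.1 z = y := by
    rw [hy, UpperHalfPlane.coe_specialLinearGroup_apply]; simp [mob, den]
  have hre : |y.re| ≤ 1 / 2 := hγ.2
  have him : 1 / 2 ≤ y.im := by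
    have h1 := ModularGroup.three_le_four_mul_im_sq_of_mem_fd hγ
    have h2 : 3 ≤ 4 * y.im ^ 2 := h1
    have h3 : 0 < y.im := (γ • (⟨z, hz⟩ : UpperHalfPlane)).im_pos
    nlinarith
  have hp1 : (2 : ℝ) ≤ p := by exact_mod_cast Lvl.two_le p
  have hyim : 0 < y.im := by linarith
  by_cases hc : (p : ℤ) ∣ γ.1 1 0
  · refine ⟨γ.1, ⟨γ.2, hc⟩, y, by linarith, ?_, Or.inl hymob⟩
    refine le_trans ?_ him
    apply one_div_le_one_div_of_le <;> linarith
  · obtain ⟨j, hj0, hjp, hG⟩ := exists_ST_mul γ.2 hc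
    have hj0' : (0 : ℝ) ≤ j := by exact_mod_cast hj0
    have hjp' : (j : ℝ) ≤ p - 1 := by
      have : j ≤ (p : ℤ) - 1 := by omega
      exact_mod_cast this
    refine ⟨_, hG, (y + j) / p, ?_, ?_, Or.inr ?_⟩
    · have : ((y + j) / p).re = (y.re + j) / p := by
        rw [Complex.div_natCast_re]; simp
      rw [this, abs_div, Nat.abs_cast, div_le_one (by linarith)]
      calc |y.re + j| ≤ |y.re| + |(j : ℝ)| := abs_add_le _ _
        _ ≤ 1 / 2 + (p - 1) := by rw [abs_of_nonneg hj0']; gcongr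
        _ ≤ p := by linarith
    · have : ((y + j) / p).im = y.im / p := by
        rw [Complex.div_natCast_im]; simp
      rw [this, div_le_div_iff₀ (by linarith) (by linarith)]
      nlinarith
    · rw [Wf_div, mob_mul (by rw [ST_det]; norm_num) (by rw [γ.2]; norm_num) hz, hymob, mob_ST]

open scoped ModularForm in
theorem liouville [Lvl p] {f : ℂ → ℂ} (hf : Hol f) (hinv : Inv p f) (h1 : BddC f)
    (h2 : BddC (fun z => f (Wf p z))) : ∃ c, ∀ z : ℂ, 0 < z.im → f z = c := by
  have : NeZero p := ⟨(Lvl.pos p).ne'⟩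
  let g : UpperHalfPlane → ℂ := fun z => f z
  have hsl : ∀ γ : Matrix.SpecialLinearGroup (Fin 2) ℤ, ∀ z : UpperHalfPlane,
      ((γ • z : UpperHalfPlane) : ℂ) = mob γ.1 z := fun γ z => by
    rw [UpperHalfPlane.coe_specialLinearGroup_apply]; simp [mob, den]
  let F : ModularForm ((CongruenceSubgroup.Gamma0 p : Subgroup _) :
      Subgroup (Matrix.GeneralLinearGroup (Fin 2) ℝ)) 0 :=
    { toFun := g
      slash_action_eq' := by
        rintro A hA
        obtain ⟨γ, hγ, rfl⟩ := hA
        have : g ∣[(0 : ℤ)] γ = g := by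
          ext z
          rw [ModularForm.SL_slash_apply]
          simp only [neg_zero, zpow_zero, mul_one, g]
          rw [hsl]
          refine hinv _ ⟨γ.2, ?_⟩ _ z.im_pos
          have := CongruenceSubgroup.Gamma0_mem.1 hγ
          exact (ZMod.intCast_zmod_eq_zero_iff_dvd _ _).1 this
        exact this
      holo' := by
        rw [UpperHalfPlane.mdifferentiable_iff]
        intro z hz
        refine (DifferentiableAt.differentiableWithinAt (hf z hz)).congr ?_ ?_
        · intro w hw; simp [g, UpperHalfPlane.ofComplex_apply_of_im_pos hw]
        · simp [g, UpperHalfPlane.ofComplex_apply_of_im_pos hz]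
      bdd_at_cusps' := by
        intro c hc
        rw [Subgroup.IsArithmetic.isCusp_iff_isCusp_SL2Z] at hc
        rw [OnePoint.isBoundedAt_iff_forall_SL2Z hc]
        intro γ _
        rw [UpperHalfPlane.isBoundedAtImInfty_iff]
        obtain ⟨C1, A1, hA1⟩ := h1
        obtain ⟨C2, A2, hA2⟩ := h2
        by_cases hd : (p : ℤ) ∣ γ.1 1 0
        · refine ⟨C1, A1, fun z hz => ?_⟩
          rw [ModularForm.SL_slash_apply]
          simp only [neg_zero, zpow_zero, mul_one, g]
          rw [hsl, hinv _ ⟨γ.2, hd⟩ _ z.im_pos]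
          exact hA1 _ hz
        · refine ⟨C2, p * A2, fun z hz => ?_⟩
          rw [ModularForm.SL_slash_apply]
          simp only [neg_zero, zpow_zero, mul_one, g]
          rw [hsl]
          have hd' : ¬ (p : ℤ) ∣ (γ⁻¹).1 1 0 := by
            simpa [Matrix.SpecialLinearGroup.SL2_inv_expl] using hd
          obtain ⟨j, -, -, hG⟩ := exists_ST_mul (γ⁻¹).2 hd'
          have hpos : ∀ δ : Matrix.SpecialLinearGroup (Fin 2) ℤ, 0 < δ.1.det := fun δ => by
            rw [δ.2]; norm_num
          rw [← hinv _ hG _ (mob_im_pos (hpos γ) z.im_pos), ← mob_mul hG.det_pos (hpos γ) z.im_pos,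
            mul_assoc, ← Matrix.SpecialLinearGroup.coe_mul, inv_mul_cancel,
            Matrix.SpecialLinearGroup.coe_one, mul_one, mob_ST, ← Wf_div (p := p)]
          refine hA2 _ ?_
          have hp0 : (0 : ℝ) < p := by exact_mod_cast Lvl.pos p
          rw [Complex.div_natCast_im, le_div_iff₀ hp0, mul_comm]
          simpa using hz }
  obtain ⟨c, hc⟩ := ModularForm.eq_const_of_weight_zero F
  refine ⟨c, fun z hz => ?_⟩
  exact congrFun hc ⟨z, hz⟩

end FrickeTrace

end

noncomputable section

namespace FrickeTrace

open Filter Topology Asymptotics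

variable {p : ℕ}

/-! ### Second order expansions at infinity -/

/-- `f = 1 + α q + ((α² - l)/2) q² + o(q²)` at `i∞`; the number `l` is additive in `f`. -/
def Ex (f : ℂ → ℂ) (α l : ℂ) : Prop :=
  (fun z => f z - (1 + α * qc z + (α ^ 2 - l) / 2 * qc z ^ 2)) =o[cusp] fun z => qc z ^ 2

theorem isLittleO_pow {m n : ℕ} (h : m < n) : (fun z => qc z ^ n) =o[cusp] fun z => qc z ^ m := by
  have := (Asymptotics.isLittleO_pow_pow (𝕜 := ℂ) h).comp_tendsto tendsto_qc_cusp
  exact this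

theorem Ex.congr {f g : ℂ → ℂ} {α l : ℂ} (hf : Ex f α l) (h : f =ᶠ[cusp] g) : Ex g α l := by
  refine IsLittleO.congr' hf ?_ EventuallyEq.rfl
  filter_upwards [h] with z hz; rw [hz]

theorem Ex.tendsto {f : ℂ → ℂ} {α l : ℂ} (hf : Ex f α l) : Tendsto f cusp (𝓝 1) := by
  have h1 : Tendsto (fun z => 1 + α * qc z + (α ^ 2 - l) / 2 * qc z ^ 2) cusp (𝓝 1) := by
    have := ((tendsto_qc_cusp.const_mul α).const_add 1).add
      ((tendsto_qc_cusp.pow 2).const_mul ((α ^ 2 - l) / 2))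
    simpa using this
  have h2 : Tendsto (fun z => qc z ^ 2) cusp (𝓝 0) := by simpa using tendsto_qc_cusp.pow 2
  have h3 := (IsLittleO.isBigO hf).trans_tendsto h2
  simpa using h3.add h1

theorem isBigO_one_of_tendsto {f : ℂ → ℂ} {l : ℂ} (hf : Tendsto f cusp (𝓝 l)) :
    f =O[cusp] fun _ => (1 : ℂ) := hf.isBigO_one ℂ

theorem Ex.one : Ex (fun _ => 1) 0 0 := by
  simp [Ex]

theorem Ex.mul {f g : ℂ → ℂ} {α l β m : ℂ} (hf : Ex f α l) (hg : Ex g β m) :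
    Ex (fun z => f z * g z) (α + β) (l + m) := by
  have hg1 := isBigO_one_of_tendsto hg.tendsto
  have hq1 : (fun z => 1 + α * qc z + (α ^ 2 - l) / 2 * qc z ^ 2) =O[cusp] fun _ => (1 : ℂ) := by
    refine isBigO_one_of_tendsto (l := 1) ?_
    have := ((tendsto_qc_cusp.const_mul α).const_add 1).add
      ((tendsto_qc_cusp.pow 2).const_mul ((α ^ 2 - l) / 2))
    simpa using this
  have h1 : (fun z => (f z - (1 + α * qc z + (α ^ 2 - l) / 2 * qc z ^ 2)) * g z) =o[cusp]
      fun z => qc z ^ 2 := by simpa using IsLittleO.mul_isBigO hf hg1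
  have h2 : (fun z => (1 + α * qc z + (α ^ 2 - l) / 2 * qc z ^ 2) *
      (g z - (1 + β * qc z + (β ^ 2 - m) / 2 * qc z ^ 2))) =o[cusp]
      fun z => qc z ^ 2 := by simpa using hq1.mul_isLittleO hg
  have h3 : (fun z => (α * ((β ^ 2 - m) / 2) + β * ((α ^ 2 - l) / 2)) * qc z ^ 3) =o[cusp]
      fun z => qc z ^ 2 := (isLittleO_pow (by norm_num)).const_mul_left _
  have h4 : (fun z => ((β ^ 2 - m) / 2 * ((α ^ 2 - l) / 2)) * qc z ^ 4) =o[cusp]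
      fun z => qc z ^ 2 := (isLittleO_pow (by norm_num)).const_mul_left _
  refine (((h1.add h2).add h3).add h4).congr_left fun z => ?_
  ring

theorem Ex.inv {f : ℂ → ℂ} {α l : ℂ} (hf : Ex f α l) : Ex (fun z => (f z)⁻¹) (-α) (-l) := by
  have hne : ∀ᶠ z in cusp, f z ≠ 0 := hf.tendsto.eventually_ne one_ne_zero
  have hi := isBigO_one_of_tendsto (hf.tendsto.inv₀ one_ne_zero)
  set P : ℂ → ℂ := fun z => 1 + -α * qc z + ((-α) ^ 2 - -l) / 2 * qc z ^ 2 with hP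
  have hP1 : P =O[cusp] fun _ => (1 : ℂ) := by
    refine isBigO_one_of_tendsto (l := 1) ?_
    have := ((tendsto_qc_cusp.const_mul (-α)).const_add 1).add
      ((tendsto_qc_cusp.pow 2).const_mul (((-α) ^ 2 - -l) / 2))
    simpa [hP] using this
  have h2 : (fun z => P z * (f z - (1 + α * qc z + (α ^ 2 - l) / 2 * qc z ^ 2))) =o[cusp]
      fun z => qc z ^ 2 := by simpa using hP1.mul_isLittleO hf
  have h3 : (fun z => (-α * ((α ^ 2 - l) / 2) + α * ((α ^ 2 + l) / 2)) * qc z ^ 3) =o[cusp]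
      fun z => qc z ^ 2 := (isLittleO_pow (by norm_num)).const_mul_left _
  have h4 : (fun z => ((α ^ 2 + l) / 2 * ((α ^ 2 - l) / 2)) * qc z ^ 4) =o[cusp]
      fun z => qc z ^ 2 := (isLittleO_pow (by norm_num)).const_mul_left _
  have h5 : (fun z => P z * f z - 1) =o[cusp] fun z => qc z ^ 2 := by
    refine ((h2.add h3).add h4).congr_left fun z => ?_
    simp only [hP]; ring
  have h6 : (fun z => (P z * f z - 1) * (f z)⁻¹) =o[cusp] fun z => qc z ^ 2 := by
    simpa using h5.mul_isBigO hi
  refine IsLittleO.congr' h6.neg_left ?_ EventuallyEq.rfl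
  filter_upwards [hne] with z hz
  simp only [hP]; field_simp; ring

theorem Ex.pow {f : ℂ → ℂ} {α l : ℂ} (hf : Ex f α l) (n : ℕ) :
    Ex (fun z => f z ^ n) (n * α) (n * l) := by
  induction n with
  | zero => simpa using Ex.one
  | succ n ih =>
    have := ih.mul hf
    simp only [pow_succ]; push_cast
    rw [add_mul, add_mul, one_mul, one_mul]; exact this

theorem Ex.unique {f : ℂ → ℂ} {α l β m : ℂ} (hf : Ex f α l) (hg : Ex f β m) :
    α = β ∧ l = m := by
  have h := IsLittleO.sub hg hf
  have h1 : (fun z => (α - β) * qc z + ((α ^ 2 - l) / 2 - (β ^ 2 - m) / 2) * qc z ^ 2) =o[cusp]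
      fun z => qc z ^ 2 := h.congr_left fun z => by ring
  have key : ∀ (c : ℂ) (n : ℕ), (fun z => c * qc z ^ n) =o[cusp] (fun z => qc z ^ n) → c = 0 := by
    intro c n hc
    have h2 := IsLittleO.mul_isBigO hc (isBigO_refl (fun z => (qc z ^ n)⁻¹) cusp)
    have h3 : (fun _ : ℂ => c) =o[cusp] fun _ : ℂ => (1 : ℂ) := by
      refine h2.congr (fun z => ?_) (fun z => ?_)
      · rw [mul_assoc, mul_inv_cancel₀ (pow_ne_zero _ (qc_ne_zero z)), mul_one]
      · rw [mul_inv_cancel₀ (pow_ne_zero _ (qc_ne_zero z))]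
    exact isLittleO_const_const_iff.1 h3
  have hα : α - β = 0 := by
    apply key _ 1
    have h2 := h1.trans (isLittleO_pow (m := 1) (n := 2) (by norm_num))
    have h3 : (fun z => ((α ^ 2 - l) / 2 - (β ^ 2 - m) / 2) * qc z ^ 2) =o[cusp]
      fun z => qc z ^ 1 := (isLittleO_pow (by norm_num)).const_mul_left _
    exact (h2.sub h3).congr_left fun z => by ring
  have hαβ : α = β := sub_eq_zero.1 hα
  have hl := key _ 2 (h1.congr_left fun z => by rw [hα, zero_mul, zero_add])
  refine ⟨hαβ, ?_⟩
  rw [hαβ] at hl; linear_combination (-2 : ℂ) * hl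

/-! ### Euler's product near the origin -/

theorem norm_tail_le {x : ℂ} (hx : ‖x‖ ≤ 1 / 2) :
    ‖(∏' n : ℕ, (1 - x ^ (n + 3))) - 1‖ ≤ 4 * ‖x‖ ^ 3 := by
  have hx1 : ‖x‖ < 1 := by linarith
  have hs : Summable fun n : ℕ => ‖-x ^ (n + 3)‖ := by
    simp only [norm_neg, norm_pow]
    exact (summable_nat_add_iff 3).2 (summable_geometric_of_lt_one (norm_nonneg _) hx1)
  have hm : Multipliable fun n : ℕ => 1 + -x ^ (n + 3) := multipliable_one_add_of_summable hs
  have hb : ∀ s : Finset ℕ, ‖∏ n ∈ s, (1 + -x ^ (n + 3)) - 1‖ ≤ 4 * ‖x‖ ^ 3 := by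
    intro s
    refine (s.norm_prod_one_add_sub_one_le _).trans ?_
    have h1 : ∑ n ∈ s, ‖-x ^ (n + 3)‖ ≤ 2 * ‖x‖ ^ 3 := by
      refine (hs.sum_le_tsum s fun _ _ => norm_nonneg _).trans ?_
      simp only [norm_neg, pow_add, norm_mul, norm_pow]
      rw [tsum_mul_right, tsum_geometric_of_lt_one (norm_nonneg _) hx1]
      gcongr
      rw [inv_le_comm₀ (by linarith) (by norm_num)]; linarith
    have h0 : 0 ≤ ∑ n ∈ s, ‖-x ^ (n + 3)‖ := Finset.sum_nonneg fun _ _ => norm_nonneg _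
    set t := ∑ n ∈ s, ‖-x ^ (n + 3)‖
    have h2 : 2 * ‖x‖ ^ 3 ≤ 1 := by
      have : ‖x‖ ^ 3 ≤ (1 / 2) ^ 3 := by gcongr
      linarith
    have := Real.abs_exp_sub_one_le (x := t) (by rw [abs_of_nonneg h0]; linarith)
    rw [abs_of_nonneg h0] at this
    have := le_abs_self (Real.exp t - 1)
    linarith
  have ht := (hm.hasProd.sub_const 1).norm
  simp only [← sub_eq_add_neg] at ht hb
  exact le_of_tendsto ht (Eventually.of_forall hb)

theorem tprod_one_sub_pow_succ {x : ℂ} (hx : ‖x‖ < 1) (k : ℕ) : ∏' n : ℕ, (1 - x ^ (n + k)) =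
      (1 - x ^ k) * ∏' n : ℕ, (1 - x ^ (n + (k + 1))) := by
  have hm : ∀ k : ℕ, Multipliable fun n : ℕ => 1 - x ^ (n + k) := fun k => by
    have hs : Summable fun n : ℕ => ‖-x ^ (n + k)‖ := by
      simp only [norm_neg, norm_pow]
      exact (summable_nat_add_iff k).2 (summable_geometric_of_lt_one (norm_nonneg _) hx)
    have := multipliable_one_add_of_summable hs
    simp only [← sub_eq_add_neg] at this
    exact this
  have h1 : ∀ n : ℕ, n + 1 + k = n + (k + 1) := fun n => by ring
  have h2 : Multipliable fun n : ℕ => 1 - x ^ (n + 1 + k) := by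
      simp only [h1]; exact hm _
  have h3 := tprod_eq_zero_mul' (f := fun n : ℕ => 1 - x ^ (n + k)) h2
  simp only [h1, zero_add] at h3
  exact h3

theorem eul_eq {x : ℂ} (hx : ‖x‖ < 1) :
    eul x = (1 - x) * (1 - x ^ 2) * ∏' n : ℕ, (1 - x ^ (n + 3)) := by
  have h1 := tprod_one_sub_pow_succ hx 1
  have h2 := tprod_one_sub_pow_succ hx 2
  have h0 : eul x = ∏' n : ℕ, (1 - x ^ (n + 1)) := rfl
  rw [pow_one] at h1
  rw [h0, h1, mul_assoc]
  congr 1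

theorem eul_sub_isBigO :
    (fun x : ℂ => eul x - (1 - x) * (1 - x ^ 2)) =O[𝓝 0] fun x => x ^ 3 := by
  have ht : (fun x : ℂ => (∏' n : ℕ, (1 - x ^ (n + 3))) - 1) =O[𝓝 0] fun x => x ^ 3 := by
    refine IsBigO.of_bound 4 ?_
    filter_upwards [Metric.closedBall_mem_nhds (0 : ℂ) (by norm_num : (0 : ℝ) < 1 / 2)] with x hx
    rw [norm_pow]
    exact norm_tail_le (by simpa using hx)
  have hc : (fun x : ℂ => (1 - x) * (1 - x ^ 2)) =O[𝓝 0] fun _ => (1 : ℂ) := by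
    have : ContinuousAt (fun x : ℂ => (1 - x) * (1 - x ^ 2)) 0 := by fun_prop
    exact this.tendsto.isBigO_one ℂ
  refine (hc.mul ht).congr' ?_ (by simp)
  filter_upwards [Metric.ball_mem_nhds (0 : ℂ) one_pos] with x hx
  rw [eul_eq (by simpa using hx)]; ring

theorem Ex_eul : Ex (fun z => eul (qc z)) (-1) 3 := by
  have h1 := (eul_sub_isBigO.comp_tendsto tendsto_qc_cusp).trans_isLittleO
    (isLittleO_pow (m := 2) (n := 3) (by norm_num))
  have h2 : (fun z => qc z ^ 3) =o[cusp] fun z => qc z ^ 2 := isLittleO_pow (by norm_num)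
  refine (h1.add h2).congr_left fun z => ?_
  simp only [Function.comp]; ring

theorem Ex_eul_pow [Lvl p] :
    Ex (fun z => eul (qc z ^ p)) 0 (if p = 2 then 2 else 0) := by
  have ht : Tendsto (fun z => qc z ^ p) cusp (𝓝 0) := by
    simpa [(Lvl.pos p).ne'] using tendsto_qc_cusp.pow p
  have h1 : (fun z => eul (qc z ^ p) - (1 - qc z ^ p) * (1 - (qc z ^ p) ^ 2)) =o[cusp]
      fun z => qc z ^ 2 := by
    refine ((eul_sub_isBigO.comp_tendsto ht).congr_right fun z => ?_).trans_isLittleO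
      (isLittleO_pow (m := 2) (n := p * 3) (by have := Lvl.two_le p; omega))
    simp only [Function.comp]; rw [← pow_mul]
  have h2 : (fun z => -(qc z ^ p) ^ 2 + (qc z ^ p) ^ 3) =o[cusp] fun z => qc z ^ 2 := by
    simp only [← pow_mul]
    exact (isLittleO_pow (by have := Lvl.two_le p; omega)).neg_left.add
      (isLittleO_pow (by have := Lvl.two_le p; omega))
  by_cases hp : p = 2
  · subst hp
    refine (h1.add h2).congr_left fun z => ?_
    simp; ring
  · have h3 : (fun z => -(qc z ^ p)) =o[cusp] fun z => qc z ^ 2 :=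
      (isLittleO_pow (by have := Lvl.two_le p; omega)).neg_left
    refine ((h1.add h2).add h3).congr_left fun z => ?_
    simp [hp]; ring

/-- The number `3 - 2[p = 2]` times `24/(p-1)`. -/
def cW (p : ℕ) : ℂ := sx p * (3 - if p = 2 then 2 else 0)

theorem Ex_U0 [Lvl p] : Ex (fun z => U0 p (qc z)) (-sx p) (cW p) := by
  have h := ((Ex_eul.mul (Ex_eul_pow (p := p)).inv).pow (sx p))
  have e1 : -(sx p : ℂ) = sx p * (-1 + -0) := by ring
  have e2 : cW p = sx p * (3 + -(if p = 2 then 2 else 0)) := by unfold cW; ring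
  rw [e1, e2]
  refine h.congr (Eventually.of_forall fun z => ?_)
  simp only [U0, div_eq_mul_inv]

end FrickeTrace

end

noncomputable section

namespace FrickeTrace

open Filter Topology Asymptotics

/-! ### Taylor coefficients of the Hauptmodul -/

/-- The `k`-th Taylor coefficient of `f` at the origin. -/
def tcoef (f : ℂ → ℂ) (k : ℕ) : ℂ := iteratedDeriv k f 0 / (k.factorial : ℂ)

theorem taylor_isBigO {f : ℂ → ℂ} (hf : AnalyticAt ℂ f 0) (n : ℕ) :
    (fun y => f y - ∑ k ∈ Finset.range n, tcoef f k * y ^ k) =O[𝓝 0] fun y => y ^ n := by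
  have h := hf.hasFPowerSeriesAt.isBigO_sub_partialSum_pow n
  have h2 : (fun y => f y - ∑ k ∈ Finset.range n, tcoef f k * y ^ k) =O[𝓝 0]
      fun y => ‖y‖ ^ n := by
    refine h.congr_left fun y => ?_
    simp [FormalMultilinearSeries.partialSum, tcoef, mul_comm]
  refine h2.trans (IsBigO.of_bound 1 (Eventually.of_forall fun y => ?_))
  simp

theorem hasSum_tcoef {f : ℂ → ℂ} (hf : DifferentiableOn ℂ f (Metric.ball 0 1)) {x : ℂ}
    (hx : ‖x‖ < 1) : HasSum (fun k => tcoef f k * x ^ k) (f x) := by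
  have := Complex.hasSum_taylorSeries_on_ball hf (z := x) (by simpa using hx)
  refine this.congr_fun fun k => ?_
  simp [tcoef]; ring

theorem tcoef_zero (f : ℂ → ℂ) : tcoef f 0 = f 0 := by simp [tcoef]

theorem tcoef_one (f : ℂ → ℂ) : tcoef f 1 = deriv f 0 := by simp [tcoef]

variable (p : ℕ)

/-- The holomorphic function `G` with `h(z) = 1/q + G(q)`. -/
def G0 (x : ℂ) : ℂ := dslope (U0 p) 0 x + sx p

theorem ball_mem : Metric.ball (0 : ℂ) 1 ∈ 𝓝 (0 : ℂ) := Metric.ball_mem_nhds _ one_pos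

theorem differentiableOn_G0 [Lvl p] : DifferentiableOn ℂ (G0 p) (Metric.ball 0 1) :=
  ((Complex.differentiableOn_dslope ball_mem).2 (differentiableOn_U0 p)).add_const _

theorem dslope_mul (f : ℂ → ℂ) (x : ℂ) : f x = f 0 + x * dslope f 0 x := by
  have := sub_smul_dslope f 0 x
  rw [sub_zero, smul_eq_mul] at this
  rw [this]; ring

theorem up_eq_G0 [Lvl p] (z : ℂ) : up p z = 1 / qc z + (G0 p (qc z) - sx p) := by
  rw [up_eq, dslope_mul (U0 p), U0_zero, G0]
  have := qc_ne_zero z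
  field_simp; ring

theorem hm_eq [Lvl p] (z : ℂ) : hm p z = 1 / qc z + G0 p (qc z) := by
  rw [hm, up_eq_G0]; ring

/-- The second Taylor coefficient of `U0`. -/
def c1 : ℂ := ((sx p : ℂ) ^ 2 - cW p) / 2

/-- `G(x)/x`. -/
def g1 (x : ℂ) : ℂ := dslope (G0 p) 0 x

theorem differentiableOn_g1 [Lvl p] : DifferentiableOn ℂ (g1 p) (Metric.ball 0 1) :=
  (Complex.differentiableOn_dslope ball_mem).2 (differentiableOn_G0 p)

theorem analyticAt_of_ball {f : ℂ → ℂ} (hf : DifferentiableOn ℂ f (Metric.ball 0 1)) :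
    AnalyticAt ℂ f 0 := hf.analyticAt ball_mem

theorem G0_zero_and_g1_zero [Lvl p] : G0 p 0 = 0 ∧ g1 p 0 = c1 p := by
  have hx : ∀ x, U0 p x = 1 + (G0 p 0 - sx p) * x + g1 p x * x ^ 2 := fun x => by
    have h1 := dslope_mul (U0 p) x
    have h2 := dslope_mul (G0 p) x
    have h3 : dslope (U0 p) 0 x = G0 p x - sx p := by rw [G0]; ring
    rw [U0_zero, h3] at h1
    rw [h1, h2, g1]; ring
  have hg : Tendsto (fun z => g1 p (qc z) - g1 p 0) cusp (𝓝 0) := by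
    have h := (analyticAt_of_ball (differentiableOn_g1 p)).continuousAt.tendsto.comp
      tendsto_qc_cusp
    simpa using h.sub_const (g1 p 0)
  have hE : Ex (fun z => U0 p (qc z)) (G0 p 0 - sx p) ((G0 p 0 - sx p) ^ 2 - 2 * g1 p 0) := by
    have h1 := ((isLittleO_one_iff ℂ).2 hg).mul_isBigO (isBigO_refl (fun z => qc z ^ 2) cusp)
    refine h1.congr (fun z => ?_) (fun z => by ring)
    simp only [hx]; ring
  obtain ⟨h1, h2⟩ := hE.unique Ex_U0
  have h3 : G0 p 0 = 0 := by linear_combination h1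
  refine ⟨h3, ?_⟩
  rw [h3] at h2
  rw [c1]; linear_combination (-1 / 2 : ℂ) * h2

theorem G0_zero [Lvl p] : G0 p 0 = 0 := (G0_zero_and_g1_zero p).1

theorem g1_zero [Lvl p] : g1 p 0 = c1 p := (G0_zero_and_g1_zero p).2

theorem G0_eq [Lvl p] (x : ℂ) : G0 p x = x * g1 p x := by
  have := dslope_mul (G0 p) x
  rwa [G0_zero, zero_add] at this

/-- The coefficient of `q^k` of the Hauptmodul (for `k ≥ 0`). -/
def cf (k : ℕ) : ℂ := tcoef (G0 p) k

theorem cf_one [Lvl p] : cf p 1 = c1 p := by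
  rw [cf, tcoef_one, ← g1_zero, g1, dslope_same]

end FrickeTrace

end

noncomputable section

namespace FrickeTrace

open Filter Topology Asymptotics

variable {p : ℕ}

/-! ### Leading terms at infinity -/

/-- `g ~ C q^{-D}` at `i∞`. -/
def Lead (g : ℂ → ℂ) (D : ℤ) : Prop :=
  ∃ C : ℂ, C ≠ 0 ∧ Tendsto (fun z => g z * qc z ^ D) cusp (𝓝 C)

/-- `g = C q^{-D} (1 + α q + ((α² - l)/2) q² + o(q²))` at `i∞`. -/
def Asy (g : ℂ → ℂ) (D : ℤ) (l : ℂ) : Prop :=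
  ∃ C : ℂ, C ≠ 0 ∧ ∃ α : ℂ, Ex (fun z => g z * qc z ^ D / C) α l

theorem Asy.lead {g : ℂ → ℂ} {D : ℤ} {l : ℂ} (h : Asy g D l) : Lead g D := by
  obtain ⟨C, hC, α, hE⟩ := h
  refine ⟨C, hC, ?_⟩
  have := hE.tendsto.const_mul C
  rw [mul_one] at this
  refine this.congr fun z => ?_
  field_simp

theorem Lead.unique {g : ℂ → ℂ} {D D' : ℤ} (h : Lead g D) (h' : Lead g D') : D = D' := by
  have key : ∀ {D D' : ℤ}, Lead g D → Lead g D' → ¬ D < D' := by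
    rintro D D' ⟨C, hC, h⟩ ⟨C', hC', h'⟩ hlt
    obtain ⟨k, hk⟩ := Int.eq_ofNat_of_zero_le (sub_nonneg.2 hlt.le)
    have h1 : Tendsto (fun z => qc z ^ k) cusp (𝓝 0) := by
      have := tendsto_qc_cusp.pow k
      rwa [zero_pow (by omega)] at this
    have h2 := h.mul h1
    rw [mul_zero] at h2
    refine hC' (tendsto_nhds_unique h' (h2.congr fun z => ?_))
    rw [mul_assoc, ← zpow_natCast, ← zpow_add₀ (qc_ne_zero z)]
    congr 2; omega
  exact le_antisymm (not_lt.1 (key h' h)) (not_lt.1 (key h h'))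

theorem Lead.congr {f g : ℂ → ℂ} {D : ℤ} (h : Lead f D) (he : f =ᶠ[cusp] g) : Lead g D := by
  obtain ⟨C, hC, h⟩ := h
  refine ⟨C, hC, h.congr' ?_⟩
  filter_upwards [he] with z hz; rw [hz]

theorem Lead.mul {f g : ℂ → ℂ} {D D' : ℤ} (hf : Lead f D) (hg : Lead g D') :
    Lead (fun z => f z * g z) (D + D') := by
  obtain ⟨C, hC, h⟩ := hf
  obtain ⟨C', hC', h'⟩ := hg
  refine ⟨C * C', mul_ne_zero hC hC', (h.mul h').congr fun z => ?_⟩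
  rw [zpow_add₀ (qc_ne_zero z)]; ring

theorem Lead.const {c : ℂ} (hc : c ≠ 0) : Lead (fun _ => c) 0 :=
  ⟨c, hc, by simp⟩

theorem Lead.inv {f : ℂ → ℂ} {D : ℤ} (hf : Lead f D) : Lead (fun z => (f z)⁻¹) (-D) := by
  obtain ⟨C, hC, h⟩ := hf
  refine ⟨C⁻¹, inv_ne_zero hC, (h.inv₀ hC).congr fun z => ?_⟩
  simp only [mul_inv, _root_.zpow_neg]

theorem Lead.prod {ι : Type*} (s : Finset ι) {f : ι → ℂ → ℂ} {D : ι → ℤ}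
    (h : ∀ i ∈ s, Lead (f i) (D i)) : Lead (fun z => ∏ i ∈ s, f i z) (∑ i ∈ s, D i) := by
  classical
  induction s using Finset.induction_on with
  | empty => simpa using Lead.const one_ne_zero
  | insert a s ha ih =>
    simp only [Finset.prod_insert ha, Finset.sum_insert ha]
    exact (h a (Finset.mem_insert_self a s)).mul
      (ih fun i hi => h i (Finset.mem_insert_of_mem hi))

theorem Lead.pow {f : ℂ → ℂ} {D : ℤ} (hf : Lead f D) (n : ℕ) :
    Lead (fun z => f z ^ n) (n * D) := by
  have := Lead.prod (Finset.range n) (f := fun _ => f) (D := fun _ => D) fun _ _ => hf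
  simpa using this

theorem Lead.zpow {f : ℂ → ℂ} {D : ℤ} (hf : Lead f D) (n : ℤ) :
    Lead (fun z => f z ^ n) (n * D) := by
  obtain ⟨k, rfl | rfl⟩ := n.eq_nat_or_neg
  · simpa using hf.pow k
  · simpa using (hf.pow k).inv

theorem Lead.ne_zero {f : ℂ → ℂ} {D : ℤ} (hf : Lead f D) : ∀ᶠ z in cusp, f z ≠ 0 := by
  obtain ⟨C, hC, h⟩ := hf
  filter_upwards [h.eventually_ne hC] with z hz h0
  exact hz (by rw [h0, zero_mul])

theorem Asy.congr {f g : ℂ → ℂ} {D : ℤ} {l : ℂ} (h : Asy f D l) (he : f =ᶠ[cusp] g) :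
    Asy g D l := by
  obtain ⟨C, hC, α, h⟩ := h
  refine ⟨C, hC, α, h.congr ?_⟩
  filter_upwards [he] with z hz; rw [hz]

theorem Asy.unique {g : ℂ → ℂ} {D D' : ℤ} {l l' : ℂ} (h : Asy g D l) (h' : Asy g D' l') :
    D = D' ∧ l = l' := by
  obtain rfl := h.lead.unique h'.lead
  refine ⟨rfl, ?_⟩
  obtain ⟨C, hC, α, h⟩ := h
  obtain ⟨C', hC', α', h'⟩ := h'
  have e1 := h.tendsto.const_mul C
  have e2 := h'.tendsto.const_mul C'
  have hCC : C = C' := by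
    rw [mul_one] at e1 e2
    refine tendsto_nhds_unique e1 (e2.congr fun z => ?_)
    field_simp
  subst hCC
  exact (h.unique h').2

theorem Asy.mul {f g : ℂ → ℂ} {D D' : ℤ} {l l' : ℂ} (hf : Asy f D l) (hg : Asy g D' l') :
    Asy (fun z => f z * g z) (D + D') (l + l') := by
  obtain ⟨C, hC, α, h⟩ := hf
  obtain ⟨C', hC', α', h'⟩ := hg
  refine ⟨C * C', mul_ne_zero hC hC', α + α', (h.mul h').congr (Eventually.of_forall fun z => ?_)⟩
  simp only [zpow_add₀ (qc_ne_zero z)]; ring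

theorem Asy.const {c : ℂ} (hc : c ≠ 0) : Asy (fun _ => c) 0 0 :=
  ⟨c, hc, 0, Ex.one.congr (Eventually.of_forall fun z => by simp [hc])⟩

theorem Asy.inv {f : ℂ → ℂ} {D : ℤ} {l : ℂ} (hf : Asy f D l) :
    Asy (fun z => (f z)⁻¹) (-D) (-l) := by
  obtain ⟨C, hC, α, h⟩ := hf
  refine ⟨C⁻¹, inv_ne_zero hC, -α, h.inv.congr (Eventually.of_forall fun z => ?_)⟩
  simp only [_root_.zpow_neg, div_eq_mul_inv, mul_inv]

theorem Asy.prod {ι : Type*} (s : Finset ι) {f : ι → ℂ → ℂ} {D : ι → ℤ} {l : ι → ℂ}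
    (h : ∀ i ∈ s, Asy (f i) (D i) (l i)) :
    Asy (fun z => ∏ i ∈ s, f i z) (∑ i ∈ s, D i) (∑ i ∈ s, l i) := by
  classical
  induction s using Finset.induction_on with
  | empty => simpa using Asy.const one_ne_zero
  | insert a s ha ih =>
    simp only [Finset.prod_insert ha, Finset.sum_insert ha]
    exact (h a (Finset.mem_insert_self a s)).mul
      (ih fun i hi => h i (Finset.mem_insert_of_mem hi))

theorem Asy.pow {f : ℂ → ℂ} {D : ℤ} {l : ℂ} (hf : Asy f D l) (n : ℕ) :
    Asy (fun z => f z ^ n) (n * D) (n * l) := by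
  have := Asy.prod (Finset.range n) (f := fun _ => f) (D := fun _ => D) (l := fun _ => l)
    fun _ _ => hf
  simpa using this

theorem Asy.zpow {f : ℂ → ℂ} {D : ℤ} {l : ℂ} (hf : Asy f D l) (n : ℤ) :
    Asy (fun z => f z ^ n) (n * D) (n * l) := by
  obtain ⟨k, rfl | rfl⟩ := n.eq_nat_or_neg
  · simpa using hf.pow k
  · simpa using (hf.pow k).inv

theorem Ex.asy {f : ℂ → ℂ} {α l : ℂ} (h : Ex f α l) : Asy f 0 l :=
  ⟨1, one_ne_zero, α, h.congr (Eventually.of_forall fun z => by simp)⟩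

theorem Asy_qc_zpow (D : ℤ) : Asy (fun z => qc z ^ (-D)) D 0 :=
  ⟨1, one_ne_zero, 0, Ex.one.congr (Eventually.of_forall fun z => by
    simp only [← zpow_add₀ (qc_ne_zero z)]; simp)⟩

theorem Asy_up [Lvl p] : Asy (up p) 1 (cW p) := by
  refine ⟨1, one_ne_zero, _, (Ex_U0 (p := p)).congr (Eventually.of_forall fun z => ?_)⟩
  have := qc_ne_zero z
  simp only [up_eq, zpow_one]; field_simp

/-- The polynomial `X² - 2 c₁`, normalised so that `F₂(h) = q⁻² + O(q)`. -/
def F2 (p : ℕ) (x : ℂ) : ℂ := x ^ 2 - 2 * c1 p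

theorem Asy_hm_sub [Lvl p] (x : ℂ) : Asy (fun z => hm p z - x) 1 (F2 p x) := by
  have hg : Tendsto (fun z => g1 p (qc z) - g1 p 0) cusp (𝓝 0) := by
    have h := (analyticAt_of_ball (differentiableOn_g1 p)).continuousAt.tendsto.comp
      tendsto_qc_cusp
    simpa using h.sub_const (g1 p 0)
  refine ⟨1, one_ne_zero, -x, ?_⟩
  have h1 := ((isLittleO_one_iff ℂ).2 hg).mul_isBigO (isBigO_refl (fun z => qc z ^ 2) cusp)
  refine h1.congr (fun z => ?_) (fun z => by ring)
  have := qc_ne_zero z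
  simp only [hm_eq, G0_eq, g1_zero, F2, zpow_one]; field_simp; ring

/-! ### Polynomials in the Hauptmodul -/

theorem BddC_iff {f : ℂ → ℂ} : BddC f ↔ f =O[cusp] fun _ => (1 : ℂ) := by
  constructor
  · rintro ⟨C, A, h⟩
    refine IsBigO.of_bound C ?_
    filter_upwards [cusp_eventually_im A] with z hz
    simpa using h z hz.le
  · intro h
    obtain ⟨C, hC⟩ := h.bound
    obtain ⟨A, -, hA⟩ := (atTop_basis.comap Complex.im).eventually_iff.1 hC
    exact ⟨C, A, fun z hz => by simpa using hA hz⟩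

theorem Inv.add_int {f : ℂ → ℂ} (hf : Inv p f) {z : ℂ} (hz : 0 < z.im) (k : ℤ) :
    f (z + k) = f z := by
  have := hf !![1, k; 0, 1] ⟨by simp [Matrix.det_fin_two], by simp⟩ z hz
  simpa [mob, den] using this

/-- A periodic holomorphic function bounded at `i∞` is a constant plus `O(q)`. -/
theorem exists_sub_const_isBigO {f : ℂ → ℂ} (hf : Hol f)
    (hper : ∀ z : ℂ, 0 < z.im → f (z + 1) = f z) (hb : f =O[cusp] fun _ => (1 : ℂ)) :
    ∃ C : ℂ, (fun z => f z - C) =O[cusp] qc := by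
  classical
  set F : ℂ → ℂ := fun z => if 0 < z.im then f z else 0 with hF
  have hev : F =ᶠ[cusp] f := by
    filter_upwards [cusp_eventually_im 0] with z hz; simp [hF, hz]
  have hFp : Function.Periodic F ((1 : ℝ) : ℂ) := by
    intro z
    by_cases hz : 0 < z.im
    · simpa [hF, hz] using hper z hz
    · simp [hF, hz]
  have hd : ∀ᶠ z in cusp, DifferentiableAt ℂ F z := by
    filter_upwards [cusp_eventually_im 0] with z hz
    refine (hf z hz).congr_of_eventuallyEq ?_
    filter_upwards [isOpen_uhp.mem_nhds hz] with w hw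
    have hw' : 0 < w.im := hw
    simp [hF, hw']
  have hFb : BoundedAtFilter cusp F := by
    have := hb.congr' hev.symm EventuallyEq.rfl
    refine this.trans (isBigO_const_const _ one_ne_zero _)
  have h := Function.Periodic.exp_decay_sub_of_bounded_at_inf one_pos hFp hd hFb
  refine ⟨Function.Periodic.cuspFunction 1 F 0, ?_⟩
  have h2 : (fun z => f z - Function.Periodic.cuspFunction 1 F 0) =O[cusp]
      fun z => Real.exp (-2 * Real.pi * z.im / 1) :=
    h.congr' (by filter_upwards [hev] with z hz; rw [hz]) EventuallyEq.rfl
  refine h2.trans (IsBigO.of_bound 1 (Eventually.of_forall fun z => ?_))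
  rw [norm_qc, Real.norm_eq_abs, abs_of_pos (Real.exp_pos _), one_mul]
  refine le_of_eq (congrArg _ ?_)
  ring

theorem Hol_hm [Lvl p] : Hol (hm p) := fun _ hz => differentiableAt_hm p hz

theorem Inv_hm [Lvl p] : Inv p (hm p) := fun _ hM _ hz => hm_mob hM hz

theorem hm_Wf [Lvl p] {z : ℂ} (hz : 0 < z.im) : hm p (Wf p z) = sx p + kap p / up p z := by
  rw [hm, up_Wf p hz]; ring

theorem tendsto_inv_up [Lvl p] : Tendsto (fun z => (up p z)⁻¹) cusp (𝓝 0) := by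
  obtain ⟨C, hC, h⟩ := (Asy_up (p := p)).inv.lead
  have := h.mul tendsto_qc_cusp
  rw [mul_zero] at this
  refine this.congr fun z => ?_
  simp [qc_ne_zero z]

theorem tendsto_hm_Wf [Lvl p] : Tendsto (fun z => hm p (Wf p z)) cusp (𝓝 (sx p)) := by
  have h := (tendsto_inv_up (p := p)).const_mul (kap p) |>.const_add (sx p : ℂ)
  rw [mul_zero, add_zero] at h
  refine h.congr' ?_
  filter_upwards [cusp_eventually_im 0] with z hz
  rw [hm_Wf hz, div_eq_mul_inv]

theorem exists_poly_of_isBigO [Lvl p] (N : ℕ) {f : ℂ → ℂ} (hf : Hol f) (hinv : Inv p f)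
    (hb : (fun z => f z * qc z ^ N) =O[cusp] fun _ => (1 : ℂ))
    (hW : BddC fun z => f (Wf p z)) :
    ∃ R : Polynomial ℂ, ∀ z : ℂ, 0 < z.im → f z = R.eval (hm p z) := by
  induction N generalizing f with
  | zero =>
    obtain ⟨c, hc⟩ := liouville hf hinv (BddC_iff.2 (by simpa using hb)) hW
    exact ⟨Polynomial.C c, fun z hz => by rw [hc z hz]; simp⟩
  | succ N ih =>
    obtain ⟨C, hC⟩ := exists_sub_const_isBigO (f := fun z => f z * qc z ^ (N + 1))
      (fun z hz => (hf z hz).mul ((differentiable_qc z).pow _))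
      (fun z hz => by
        simp only [qc_add_one]; congr 1; simpa using hinv.add_int hz 1) hb
    have h1 : (fun z => (hm p z * qc z) ^ (N + 1) - 1) =O[cusp] qc := by
      have hh : ∀ z, hm p z * qc z = 1 + qc z * G0 p (qc z) := fun z => by
        have := qc_ne_zero z
        rw [hm_eq]; field_simp
      have ha : DifferentiableAt ℂ (fun x => (1 + x * G0 p x) ^ (N + 1)) 0 := by
        have := (analyticAt_of_ball (differentiableOn_G0 p)).differentiableAt
        fun_prop
      have := ha.isBigO_sub.comp_tendsto tendsto_qc_cusp
      refine this.congr (fun z => ?_) (fun z => ?_)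
      · simp [hh]
      · simp
    have h2 : (fun z => (f z - C * hm p z ^ (N + 1)) * qc z ^ (N + 1)) =O[cusp] qc := by
      refine (hC.sub (h1.const_mul_left C)).congr_left fun z => ?_
      rw [mul_pow]; ring
    have h3 : (fun z => (f z - C * hm p z ^ (N + 1)) * qc z ^ N) =O[cusp] fun _ => (1 : ℂ) := by
      have := h2.mul (isBigO_refl (fun z => (qc z)⁻¹) cusp)
      refine this.congr (fun z => ?_) (fun z => mul_inv_cancel₀ (qc_ne_zero z))
      rw [pow_succ (qc z), mul_assoc, mul_assoc, mul_inv_cancel₀ (qc_ne_zero z), mul_one]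
    obtain ⟨R, hR⟩ := ih (f := fun z => f z - C * hm p z ^ (N + 1))
      (fun z hz => (hf z hz).sub (((Hol_hm z hz).pow _).const_mul C))
      (fun M hM z hz => by simp only [hinv M hM z hz, Inv_hm M hM z hz]) h3
      (BddC_iff.2 ((BddC_iff.1 hW).sub
        (((tendsto_hm_Wf (p := p)).pow (N + 1)).const_mul C |>.isBigO_one ℂ)))
    refine ⟨R + Polynomial.C C * Polynomial.X ^ (N + 1), fun z hz => ?_⟩
    simp [← hR z hz]

theorem Asy_eval_hm [Lvl p] {R : Polynomial ℂ} (hR : R ≠ 0) :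
    Asy (fun z => R.eval (hm p z)) (R.roots.card) ((R.roots.map (F2 p)).sum) := by
  have hs := IsAlgClosed.splits R
  have he := hs.eq_prod_roots
  have hl : R.leadingCoeff ≠ 0 := Polynomial.leadingCoeff_ne_zero.2 hR
  have key : ∀ S : Multiset ℂ, Asy (fun z => ((S.map fun a => Polynomial.X - Polynomial.C a).prod).eval
      (hm p z)) (S.card) ((S.map (F2 p)).sum) := by
    intro S
    induction S using Multiset.induction_on with
    | empty => simpa using Asy.const one_ne_zero
    | cons a S ih =>
      have := (Asy_hm_sub (p := p) a).mul ih
      simp only [Multiset.map_cons, Multiset.prod_cons, Multiset.card_cons, Multiset.sum_cons,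
        Polynomial.eval_mul, Polynomial.eval_sub, Polynomial.eval_X, Polynomial.eval_C]
      push_cast
      rw [add_comm (S.card : ℤ)]; exact this
  have h := (Asy.const hl).mul (key R.roots)
  rw [zero_add, zero_add] at h
  refine h.congr (Eventually.of_forall fun z => ?_)
  conv_rhs => rw [he]
  simp only [Polynomial.eval_mul, Polynomial.eval_C]

/-- The sum of `F₂` over the zeros of an invariant function in terms of its cusp expansions. -/
theorem exists_poly_of_asy [Lvl p] {g : ℂ → ℂ} {D e : ℤ} {l : ℂ} (hg : Hol g) (hinv : Inv p g)
    (h1 : Asy g D l) (h2 : Lead (fun z => g (Wf p z)) (-e)) :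
    ∃ R : Polynomial ℂ, R ≠ 0 ∧ R.eval (sx p : ℂ) ≠ 0 ∧
      (∀ z : ℂ, 0 < z.im → g z = R.eval (hm p z) * up p z ^ e) ∧
      (R.roots.map fun x => F2 p x - cW p / 2).sum = l - cW p * (D + e) / 2 := by
  set f : ℂ → ℂ := fun z => g z * up p z ^ (-e) with hf
  have hfH : Hol f := fun z hz =>
    (hg z hz).mul ((differentiableAt_up p hz).zpow (Or.inl (up_ne_zero p hz)))
  have hfI : Inv p f := fun M hM z hz => by simp only [hf, hinv M hM z hz, up_mob hM hz]
  have hfA : Asy f (D - e) (l - e * cW p) := by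
    have := h1.mul ((Asy_up (p := p)).zpow (-e))
    convert this using 1 <;> push_cast <;> ring
  have hfW : Lead (fun z => f (Wf p z)) 0 := by
    have h3 : Lead (fun z => (kap p * (up p z)⁻¹) ^ (-e)) (-e * -1) := by
      have := ((Lead.const (kap_ne p)).mul (Asy_up (p := p)).lead.inv).zpow (-e)
      simpa using this
    have := (h2.mul h3).congr (g := fun z => f (Wf p z)) ?_
    · simpa using this
    · filter_upwards [cusp_eventually_im 0] with z hz
      simp only [hf, up_Wf p hz, div_eq_mul_inv]
  have hfWb : BddC fun z => f (Wf p z) := by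
    obtain ⟨C, -, hC⟩ := hfW
    exact BddC.of_tendsto (by simpa using hC)
  have hR : ∃ R : Polynomial ℂ, ∀ z : ℂ, 0 < z.im → f z = R.eval (hm p z) := by
    refine exists_poly_of_isBigO (D - e).toNat hfH hfI ?_ hfWb
    obtain ⟨C, -, hC⟩ := hfA.lead
    have h4 : (fun z => qc z ^ (((D - e).toNat : ℤ) - (D - e))) =O[cusp] fun _ => (1 : ℂ) := by
      obtain ⟨k, hk⟩ := Int.eq_ofNat_of_zero_le
        (show 0 ≤ ((D - e).toNat : ℤ) - (D - e) by omega)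
      rw [hk]
      exact (tendsto_qc_cusp.pow k).isBigO_one ℂ
    have h5 := (hC.isBigO_one ℂ).mul h4
    refine h5.congr (fun z => ?_) (fun z => by simp)
    rw [mul_assoc, ← zpow_add₀ (qc_ne_zero z), ← zpow_natCast]
    congr 2; ring
  obtain ⟨R, hR⟩ := hR
  have hgR : ∀ z : ℂ, 0 < z.im → g z = R.eval (hm p z) * up p z ^ e := fun z hz => by
    rw [← hR z hz]
    simp only [hf]
    rw [mul_assoc, ← zpow_add₀ (up_ne_zero p hz)]; simp
  have hR0 : R ≠ 0 := by
    rintro rfl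
    obtain ⟨z, hz, hz0⟩ := (hfA.lead.ne_zero.and (cusp_eventually_im 0)).exists
    exact hz (by rw [hR z hz0]; simp)
  have hRA := (Asy_eval_hm (p := p) hR0).congr (g := f) (by
    filter_upwards [cusp_eventually_im 0] with z hz; rw [hR z hz])
  obtain ⟨hD, hl⟩ := hRA.unique hfA
  refine ⟨R, hR0, ?_, hgR, ?_⟩
  · obtain ⟨C, hC, h⟩ := hfW
    have h6 : Tendsto (fun z => R.eval (hm p (Wf p z))) cusp (𝓝 (R.eval (sx p : ℂ))) :=
      (R.continuous.tendsto _).comp tendsto_hm_Wf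
    have h7 : Tendsto (fun z => R.eval (hm p (Wf p z))) cusp (𝓝 C) := by
      refine h.congr' ?_
      filter_upwards [cusp_eventually_im 0] with z hz
      rw [hR _ (Wf_im_pos p hz)]; simp
    rwa [tendsto_nhds_unique h6 h7]
  · rw [Multiset.sum_map_sub, hl]
    simp only [Multiset.map_const', Multiset.sum_replicate, nsmul_eq_mul]
    have : (R.roots.card : ℂ) = D - e := by exact_mod_cast congrArg (Int.cast (R := ℂ)) hD
    rw [this]; ring

end FrickeTrace

end

noncomputable section
namespace FrickeTrace
open Filter Topology Asymptotics

/-! ### Injectivity of the Hauptmodul modulo `Γ₀(p)` -/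

variable {p : ℕ}

/-- Equivalence of points under `Γ₀(p)`. -/
def Eqv (p : ℕ) (z w : ℂ) : Prop := ∃ M, IsG p M ∧ mob M z = w

theorem Eqv.symm {z w : ℂ} (hz : 0 < z.im) (h : Eqv p z w) : Eqv p w z := by
  obtain ⟨M, hM, rfl⟩ := h
  exact ⟨_, hM.adj, hM.mob_adj_mob hz⟩

theorem Eqv.trans {z w v : ℂ} (hz : 0 < z.im) (h : Eqv p z w) (h' : Eqv p w v) : Eqv p z v := by
  obtain ⟨M, hM, rfl⟩ := h
  obtain ⟨N, hN, rfl⟩ := h'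
  exact ⟨_, hN.mul hM, mob_mul hN.det_pos hM.det_pos hz⟩

theorem Eqv.im_pos {z w : ℂ} (hz : 0 < z.im) (h : Eqv p z w) : 0 < w.im := by
  obtain ⟨M, hM, rfl⟩ := h
  exact mob_im_pos hM.det_pos hz

theorem Eqv.hm_eq [Lvl p] {z w : ℂ} (hz : 0 < z.im) (h : Eqv p z w) : hm p w = hm p z := by
  obtain ⟨M, hM, rfl⟩ := h
  exact hm_mob hM hz

theorem abs_le_of_norm_le {a b : ℤ} {x : ℂ} {δ C K : ℝ} (hδ : 0 < δ) (hx : δ ≤ x.im)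
    (hC : ‖x‖ ≤ C) (h : ‖(a : ℂ) * x + b‖ ≤ K) :
    |(a : ℝ)| ≤ K / δ ∧ |(b : ℝ)| ≤ K + K / δ * C := by
  have h1 : |(a : ℝ)| ≤ K / δ := by
    rw [le_div_iff₀ hδ]
    have := (Complex.abs_im_le_norm _).trans h
    simp only [add_im, mul_im, intCast_re, intCast_im, zero_mul, add_zero, abs_mul] at this
    exact (mul_le_mul_of_nonneg_left (hx.trans (le_abs_self _)) (abs_nonneg _)).trans this
  refine ⟨h1, ?_⟩
  have h2 : (b : ℂ) = ((a : ℂ) * x + b) - a * x := by ring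
  have h3 : ‖(b : ℂ)‖ ≤ K + ‖(a : ℂ)‖ * ‖x‖ := by
    conv_lhs => rw [h2]
    refine (norm_sub_le _ _).trans ?_
    rw [norm_mul]; gcongr
  rw [Complex.norm_intCast, Complex.norm_intCast] at h3
  refine h3.trans ?_
  have : 0 ≤ K / δ := (abs_nonneg _).trans h1
  gcongr

theorem finite_near (n : ℤ) (hn : 0 < n) {z w : ℂ} (hz : 0 < z.im) (hw : 0 < w.im) :
    ∃ S : Set M2, S.Finite ∧ ∀ᶠ xy in 𝓝 z ×ˢ 𝓝 w, ∀ M : M2, M.det = n →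
      mob M xy.1 = xy.2 → M ∈ S := by
  set δ : ℝ := min z.im w.im / 2 with hδ
  set C : ℝ := max ‖z‖ ‖w‖ + 1 with hC
  have hδ0 : 0 < δ := by have := lt_min hz hw; positivity
  have hC0 : 0 < C := by positivity
  have hδz : δ < z.im := by have := min_le_left z.im w.im; linarith [lt_min hz hw]
  have hδw : δ < w.im := by have := min_le_right z.im w.im; linarith [lt_min hz hw]
  set K : ℝ := n * C / δ + 1 with hK
  have hn' : (0 : ℝ) < n := by exact_mod_cast hn
  have hK1 : 1 ≤ K := by rw [hK]; have : 0 < n * C / δ := by positivity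
                         linarith
  set L : ℝ := (K + C * K) + (K + C * K) / δ * C + (K + C * K) / δ with hL
  obtain ⟨N, hN⟩ := exists_nat_ge L
  refine ⟨{M : M2 | ∀ i j, M i j ∈ Set.Icc (-N : ℤ) N},
    Set.Finite.pi' fun _ => Set.Finite.pi' fun _ => Set.finite_Icc _ _, ?_⟩
  have e1 : ∀ᶠ x in 𝓝 z, δ < x.im ∧ ‖x‖ < C :=
    (Complex.continuous_im.continuousAt.eventually_const_lt hδz).and
      (continuous_norm.continuousAt.eventually_lt_const
        (by rw [hC]; exact (le_max_left _ _).trans_lt (lt_add_one _)))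
  have e2 : ∀ᶠ x in 𝓝 w, δ < x.im ∧ ‖x‖ < C :=
    (Complex.continuous_im.continuousAt.eventually_const_lt hδw).and
      (continuous_norm.continuousAt.eventually_lt_const
        (by rw [hC]; exact (le_max_right _ _).trans_lt (lt_add_one _)))
  filter_upwards [e1.prod_mk e2] with ⟨x, y⟩ ⟨⟨hx1, hx2⟩, hy1, hy2⟩ M hM hxy
  simp only at hx1 hx2 hy1 hy2 hxy
  have hx0 : 0 < x.im := hδ0.trans hx1
  have hd := den_ne_zero (hM ▸ hn) hx0
  have hden : ‖den M x‖ ≤ K := by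
    have h1 := mob_im (M := M) x
    rw [hxy, hM, eq_div_iff (Complex.normSq_pos.2 hd).ne', Complex.normSq_eq_norm_sq] at h1
    have h2 : ‖den M x‖ ^ 2 ≤ n * C / δ := by
      rw [le_div_iff₀ hδ0]
      have h3 : x.im ≤ C := (Complex.im_le_norm x).trans hx2.le
      nlinarith [sq_nonneg ‖den M x‖]
    nlinarith [norm_nonneg (den M x)]
  have hnum : ‖(M 0 0 : ℂ) * x + M 0 1‖ ≤ C * K := by
    have : (M 0 0 : ℂ) * x + M 0 1 = y * den M x := by
      rw [← hxy, mob, div_mul_cancel₀ _ hd]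
    rw [this, norm_mul]; gcongr
  have hCK : 0 ≤ C * K := by positivity
  obtain ⟨b1, b2⟩ := abs_le_of_norm_le hδ0 hx1.le hx2.le (hden.trans (le_add_of_nonneg_right hCK))
  obtain ⟨b3, b4⟩ := abs_le_of_norm_le hδ0 hx1.le hx2.le
    (hnum.trans (le_add_of_nonneg_left (by linarith : 0 ≤ K)))
  have p1 : 0 ≤ K + C * K := by positivity
  have p2 : 0 ≤ (K + C * K) / δ := by positivity
  have p3 : 0 ≤ (K + C * K) / δ * C := by positivity
  have key : ∀ a : ℤ, |(a : ℝ)| ≤ L → a ∈ Set.Icc (-N : ℤ) N := fun a ha => by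
    have h1 := abs_le.1 (ha.trans hN)
    exact ⟨by exact_mod_cast h1.1, by exact_mod_cast h1.2⟩
  intro i j
  apply key
  fin_cases i <;> fin_cases j <;> simp only [Fin.zero_eta, Fin.mk_one, Fin.isValue] <;> linarith

theorem eventually_not_Eqv {z w : ℂ} (hz : 0 < z.im) (hw : 0 < w.im) (h : ¬ Eqv p z w) :
    ∀ᶠ xy in 𝓝 z ×ˢ 𝓝 w, ¬ Eqv p xy.1 xy.2 := by
  obtain ⟨S, hS, hS'⟩ := finite_near 1 one_pos hz hw
  have h1 : ∀ᶠ xy in 𝓝 z ×ˢ 𝓝 w, ∀ M ∈ S, IsG p M → mob M xy.1 ≠ xy.2 := by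
    rw [Filter.eventually_all_finite hS]
    intro M _
    by_cases hM : IsG p M
    · have hc : Tendsto (fun xy : ℂ × ℂ => (mob M xy.1, xy.2)) (𝓝 z ×ˢ 𝓝 w)
          (𝓝 (mob M z) ×ˢ 𝓝 w) :=
        ((differentiableAt_mob hM.det_pos hz).continuousAt.tendsto.comp tendsto_fst).prodMk
          tendsto_snd
      have : ∀ᶠ ab in 𝓝 (mob M z) ×ˢ 𝓝 w, ab.1 ≠ ab.2 := by
        rw [← nhds_prod_eq]
        exact (isOpen_ne_fun continuous_fst continuous_snd).mem_nhds fun e => h ⟨M, hM, e⟩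
      filter_upwards [hc.eventually this] with xy hxy _ using hxy
    · exact Eventually.of_forall fun _ h => absurd h hM
  filter_upwards [h1, hS'] with xy h1 h2 ⟨M, hM, e⟩
  exact h1 M (h2 M hM.det e) hM e

theorem analyticOnNhd_of_Hol {f : ℂ → ℂ} (hf : Hol f) : AnalyticOnNhd ℂ f {z | 0 < z.im} :=
  DifferentiableOn.analyticOnNhd (fun z hz => (hf z hz).differentiableWithinAt) isOpen_uhp

theorem analyticAt_hm [Lvl p] {z : ℂ} (hz : 0 < z.im) : AnalyticAt ℂ (hm p) z :=
  analyticOnNhd_of_Hol Hol_hm z hz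

theorem tendsto_norm_hm [Lvl p] : Tendsto (fun z => ‖hm p z‖) cusp atTop := by
  have h : Tendsto (fun z => ‖up p z‖) cusp atTop := by
    have h1 : Tendsto (fun z => ‖(up p z)⁻¹‖) cusp (𝓝[>] 0) := by
      refine tendsto_nhdsWithin_iff.2 ⟨by simpa using (tendsto_inv_up (p := p)).norm, ?_⟩
      filter_upwards [cusp_eventually_im 0] with z hz
      simpa using up_ne_zero p hz
    refine h1.inv_tendsto_nhdsGT_zero.congr fun z => by simp
  refine tendsto_atTop_mono (fun z => ?_) (tendsto_atTop_add_const_right _ (-‖(sx p : ℂ)‖) h)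
  have := norm_sub_norm_le (up p z) (-(sx p : ℂ))
  rw [norm_neg, sub_neg_eq_add] at this
  exact this

theorem hm_not_locally_const [Lvl p] {z : ℂ} (hz : 0 < z.im) :
    ¬ ∀ᶠ x in 𝓝 z, hm p x = hm p z := by
  intro h
  have h1 := (analyticOnNhd_of_Hol (Hol_hm (p := p))).eqOn_of_preconnected_of_eventuallyEq
    (analyticOnNhd_const (v := hm p z)) isPreconnected_uhp hz h
  have h2 := (tendsto_norm_hm (p := p)).eventually_gt_atTop ‖hm p z‖
  obtain ⟨x, hx, hx'⟩ := (h2.and (cusp_eventually_im 0)).exists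
  rw [h1 hx'] at hx
  exact lt_irrefl _ hx

/-- The points at which injectivity modulo `Γ₀(p)` fails. -/
def Bad (p : ℕ) : Set ℂ := {z | 0 < z.im ∧ ∃ w : ℂ, 0 < w.im ∧ ¬ Eqv p z w ∧ hm p w = hm p z}

theorem isOpen_Bad [Lvl p] : IsOpen (Bad p) := by
  rw [isOpen_iff_mem_nhds]
  rintro z ⟨hz, w, hw, hn, he⟩
  obtain ⟨U, hU, V, hV, hUV⟩ := mem_prod_iff.1 (eventually_not_Eqv hz hw hn)
  have h1 : 𝓝 (hm p w) ≤ map (hm p) (𝓝 w) :=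
    (analyticAt_hm hw).eventually_constant_or_nhds_le_map_nhds.resolve_left
      (hm_not_locally_const hw)
  have h2 : hm p '' (V ∩ {z | 0 < z.im}) ∈ 𝓝 (hm p z) := he ▸
    h1 (image_mem_map (inter_mem hV (isOpen_uhp.mem_nhds hw)))
  filter_upwards [hU, isOpen_uhp.mem_nhds hz, (analyticAt_hm hz).continuousAt h2] with x hx hx' h3
  obtain ⟨y, ⟨hy, hy'⟩, e⟩ := h3
  exact ⟨hx', y, hy', hUV (Set.mk_mem_prod hx hy), e⟩

theorem exists_im_gt_of_cusp {P : ℂ → Prop} (h : ∀ᶠ z in cusp, P z) :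
    ∃ A : ℝ, 0 < A ∧ ∀ z : ℂ, A < z.im → P z := by
  obtain ⟨s, hs, h2⟩ := mem_comap.1 h
  obtain ⟨A, hA⟩ := mem_atTop_sets.1 hs
  exact ⟨max A 1, by positivity, fun z hz => h2 (hA _ ((le_max_left _ _).trans hz.le))⟩

/-- The rectangle `[-1, 1] × [1/(2p), A]`. -/
def rect (p : ℕ) (A : ℝ) : Set ℂ := Set.Icc (-1) 1 ×ℂ Set.Icc (1 / (2 * p)) A

theorem isCompact_rect (A : ℝ) : IsCompact (rect p A) := isCompact_Icc.reProdIm isCompact_Icc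

theorem im_pos_of_mem_rect [Lvl p] {A : ℝ} {z : ℂ} (h : z ∈ rect p A) : 0 < z.im := by
  have := (Complex.mem_reProdIm.1 h).2.1
  have hp : (0 : ℝ) < p := by exact_mod_cast Lvl.pos p
  exact lt_of_lt_of_le (by positivity) this

theorem isCompact_reps [Lvl p] (A : ℝ) : IsCompact (rect p A ∪ Wf p '' rect p A) := by
  refine (isCompact_rect A).union ((isCompact_rect A).image_of_continuousOn fun z hz => ?_)
  exact (differentiableAt_Wf p (im_pos_of_mem_rect hz)).continuousAt.continuousWithinAt

theorem im_pos_of_mem_reps [Lvl p] {A : ℝ} {z : ℂ} (h : z ∈ rect p A ∪ Wf p '' rect p A) :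
    0 < z.im := by
  rcases h with h | ⟨w, h, rfl⟩
  · exact im_pos_of_mem_rect h
  · exact Wf_im_pos p (im_pos_of_mem_rect h)

theorem exists_reduce_reps [Lvl p] (A : ℝ) {z : ℂ} (hz : 0 < z.im) :
    (∃ w ∈ rect p A ∪ Wf p '' rect p A, Eqv p z w) ∨
      ∃ w : ℂ, A < w.im ∧ (Eqv p z w ∨ Eqv p z (Wf p w)) := by
  obtain ⟨M, hM, w, h1, h2, h3⟩ := exists_reduce (p := p) hz
  rcases le_or_gt w.im A with hA | hA
  · have hw : w ∈ rect p A := Complex.mem_reProdIm.2 ⟨abs_le.1 h1, h2, hA⟩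
    left
    rcases h3 with h3 | h3
    · exact ⟨w, Or.inl hw, M, hM, h3⟩
    · exact ⟨Wf p w, Or.inr ⟨w, hw, rfl⟩, M, hM, h3⟩
  · right
    exact ⟨w, hA, h3.imp (fun h => ⟨M, hM, h⟩) fun h => ⟨M, hM, h⟩⟩

theorem hm_ne_sx [Lvl p] {z : ℂ} (hz : 0 < z.im) : hm p z ≠ sx p := by
  simpa [hm] using up_ne_zero p hz

theorem exists_compact_reps [Lvl p] {z : ℂ} (hz : 0 < z.im) :
    ∃ A : ℝ, ∀ᶠ x in 𝓝 z, ∀ y : ℂ, 0 < y.im → hm p y = hm p x →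
      ∃ w ∈ rect p A ∪ Wf p '' rect p A, Eqv p y w := by
  have hε : 0 < ‖hm p z - sx p‖ / 2 := by
    have := norm_pos_iff.2 (sub_ne_zero.2 (hm_ne_sx (p := p) hz)); positivity
  have h1 := (tendsto_norm_hm (p := p)).eventually_gt_atTop (‖hm p z‖ + 1)
  have h2 : ∀ᶠ w in cusp, ‖hm p (Wf p w) - sx p‖ < ‖hm p z - sx p‖ / 2 := by
    have := (tendsto_hm_Wf (p := p)).sub_const (sx p : ℂ)
    rw [sub_self] at this
    simpa using (this.norm.eventually_lt_const (by simpa using hε))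
  obtain ⟨A, hA0, hA⟩ := exists_im_gt_of_cusp (h1.and h2)
  refine ⟨A, ?_⟩
  have hc := (analyticAt_hm (p := p) hz).continuousAt
  have e1 : ∀ᶠ x in 𝓝 z, ‖hm p x‖ < ‖hm p z‖ + 1 :=
    hc.norm.eventually_lt_const (lt_add_one _)
  have e2 : ∀ᶠ x in 𝓝 z, ‖hm p z - sx p‖ / 2 < ‖hm p x - sx p‖ :=
    (hc.sub continuousAt_const).norm.eventually_const_lt
      (show ‖hm p z - sx p‖ / 2 < ‖hm p z - sx p‖ by linarith)
  filter_upwards [e1, e2] with x hx1 hx2 y hy he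
  rcases exists_reduce_reps (p := p) A hy with h | ⟨w, hw, h | h⟩
  · exact h
  · have := h.hm_eq hy
    have h3 := (hA w hw).1
    rw [this, he] at h3
    linarith
  · have := h.hm_eq hy
    have h3 := (hA w hw).2
    rw [this, he] at h3
    linarith

theorem exists_injOn {f : ℂ → ℂ} {a : ℂ} (hf : AnalyticAt ℂ f a) (h : deriv f a ≠ 0) :
    ∃ U ∈ 𝓝 a, Set.InjOn f U := by
  have h1 := (hf.hasStrictDerivAt).hasStrictFDerivAt_equiv h
  refine ⟨(h1.toOpenPartialHomeomorph f).source,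
    (h1.toOpenPartialHomeomorph f).open_source.mem_nhds h1.mem_toOpenPartialHomeomorph_source, ?_⟩
  simpa using (h1.toOpenPartialHomeomorph f).injOn

theorem mem_Bad_of_mem_closure [Lvl p] {z : ℂ} (hz : 0 < z.im) (hd : deriv (hm p) z ≠ 0)
    (hc : z ∈ closure (Bad p)) : z ∈ Bad p := by
  by_contra hb
  obtain ⟨A, hA⟩ := exists_compact_reps (p := p) hz
  obtain ⟨U, hU, hinj⟩ := exists_injOn (analyticAt_hm (p := p) hz) hd
  have key : ∀ᶠ x in 𝓝 z, ∀ y ∈ rect p A ∪ Wf p '' rect p A, hm p y = hm p x → Eqv p x y := by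
    refine (isCompact_reps A).eventually_forall_of_forall_eventually fun y hy => ?_
    have hy0 := im_pos_of_mem_reps hy
    rw [nhds_prod_eq]
    by_cases he : hm p y = hm p z
    · have hzy : Eqv p z y := by
        by_contra hn
        exact hb ⟨hz, y, hy0, hn, he⟩
      obtain ⟨M, hM, hMy⟩ := hzy.symm hz
      have hU' : mob M ⁻¹' U ∈ 𝓝 y :=
        (differentiableAt_mob hM.det_pos hy0).continuousAt (hMy.symm ▸ hU)
      filter_upwards [prod_mem_prod hU (inter_mem hU' (isOpen_uhp.mem_nhds hy0))] with
        ⟨x, y'⟩ ⟨hx, hy', hy'0⟩ h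
      have : mob M y' = x := hinj hy' hx (by rw [hm_mob hM hy'0, h])
      exact Eqv.symm hy'0 ⟨M, hM, this⟩
    · have : ∀ᶠ xy in 𝓝 z ×ˢ 𝓝 y, hm p xy.2 ≠ hm p xy.1 := by
        have h1 := ((analyticAt_hm (p := p) hy0).continuousAt.tendsto.comp
          (tendsto_snd (f := 𝓝 z))).prodMk_nhds
          ((analyticAt_hm (p := p) hz).continuousAt.tendsto.comp (tendsto_fst (g := 𝓝 y)))
        exact h1.eventually ((isOpen_ne_fun continuous_fst continuous_snd).mem_nhds he)
      filter_upwards [this] with xy h h' using absurd h' h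
  obtain ⟨x, ⟨hx0, w, hw, hn, he⟩, hx1, hx2⟩ :=
    ((mem_closure_iff_frequently.1 hc).and_eventually (hA.and key)).exists
  obtain ⟨y, hy, hwy⟩ := hx1 w hw he
  exact hn ((hx2 y hy ((hwy.hm_eq hw).trans he)).trans hx0 (hwy.symm hw))

theorem hm_inv_eq [Lvl p] (z : ℂ) : (hm p z)⁻¹ = qc z / (1 + qc z * G0 p (qc z)) := by
  have := qc_ne_zero z
  rw [hm_eq p z, ← one_div, div_eq_div_iff_comm, div_add' _ _ _ this]
  simp [mul_comm]

theorem exists_high_not_Bad [Lvl p] : ∃ T : ℝ, 0 < T ∧ ∀ z : ℂ, T < z.im → z ∉ Bad p := by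
  have hG : AnalyticAt ℂ (G0 p) 0 := analyticAt_of_ball (differentiableOn_G0 p)
  set ψ : ℂ → ℂ := fun x => x / (1 + x * G0 p x) with hψ
  have hψa : AnalyticAt ℂ ψ 0 := by
    refine analyticAt_id.div ((analyticAt_const).add (analyticAt_id.mul hG)) (by simp)
  have hψd : deriv ψ 0 ≠ 0 := by
    have : HasDerivAt ψ 1 0 := by
      have h1 : HasDerivAt (fun x : ℂ => 1 + x * G0 p x) (G0 p 0) 0 := by
        simpa using ((hasDerivAt_id (0 : ℂ)).mul hG.differentiableAt.hasDerivAt).const_add 1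
      have h2 := (hasDerivAt_id (0 : ℂ)).div h1 (by simp)
      simp only [id, zero_mul, add_zero, sub_zero, mul_one, one_pow, div_one] at h2
      exact h2
    rw [this.deriv]; norm_num
  obtain ⟨U, hU, hinj⟩ := exists_injOn hψa hψd
  have e1 := tendsto_qc_cusp.eventually hU
  have e2 : ∀ᶠ w in cusp, ‖hm p (Wf p w)‖ < ‖(sx p : ℂ)‖ + 1 :=
    (tendsto_hm_Wf (p := p)).norm.eventually_lt_const (lt_add_one _)
  obtain ⟨A, hA0, hA⟩ := exists_im_gt_of_cusp (e1.and e2)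
  obtain ⟨C, hC⟩ := (isCompact_reps (p := p) A).exists_bound_of_continuousOn (f := hm p)
    fun z hz => (analyticAt_hm (im_pos_of_mem_reps hz)).continuousAt.continuousWithinAt
  have e3 := (tendsto_norm_hm (p := p)).eventually_gt_atTop (max C (‖(sx p : ℂ)‖ + 1))
  obtain ⟨T, hT0, hT⟩ := exists_im_gt_of_cusp (e1.and e3)
  refine ⟨T, hT0, fun z hz ⟨hz0, w, hw, hn, he⟩ => hn ?_⟩
  obtain ⟨hT1, hT2⟩ := hT z hz
  rcases exists_reduce_reps (p := p) A hw with ⟨v, hv, h⟩ | ⟨v, hv, h | h⟩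
  · have h1 := hC v hv
    rw [h.hm_eq hw, he] at h1
    exact absurd ((le_max_left _ _).trans_lt hT2) (not_lt.2 h1)
  · have h1 : ψ (qc v) = ψ (qc z) := by
      rw [hψ]; simp only
      rw [← hm_inv_eq, ← hm_inv_eq, h.hm_eq hw, he]
    have h2 := hinj (hA v hv).1 hT1 h1
    obtain ⟨n, hn⟩ := (qc_eq_iff _ _).1 h2
    refine Eqv.trans hz0 (Eqv.symm (h.im_pos hw) ⟨!![1, -n; 0, 1], ⟨by simp, by simp⟩, ?_⟩)
      (h.symm hw)
    simp [mob, den, hn]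
  · have h1 := (hA v hv).2
    rw [h.hm_eq hw, he] at h1
    exact absurd ((le_max_right _ _).trans_lt hT2) (not_lt.2 h1.le)

theorem countable_crit [Lvl p] : {z : ℂ | 0 < z.im ∧ deriv (hm p) z = 0}.Countable := by
  have ha : AnalyticOnNhd ℂ (deriv (hm p)) {z | 0 < z.im} :=
    (analyticOnNhd_of_Hol (Hol_hm (p := p))).deriv
  rcases ha.eqOn_zero_or_eventually_ne_zero_of_preconnected isPreconnected_uhp with h | h
  · exfalso
    have hi : (0 : ℝ) < I.im := by simp
    refine hm_not_locally_const (p := p) hi ?_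
    filter_upwards [isOpen_uhp.mem_nhds hi] with x hx
    exact isOpen_uhp.is_const_of_deriv_eq_zero isPreconnected_uhp
      (fun z hz => (Hol_hm (p := p) z hz).differentiableWithinAt) h hx hi
  · have h1 : ({z : ℂ | 0 < z.im ∧ deriv (hm p) z = 0})ᶜ ∈ codiscreteWithin {z : ℂ | 0 < z.im} := by
      filter_upwards [h] with x hx h' using hx h'.2
    have h2 := isDiscrete_of_codiscreteWithin h1
    refine ((HereditarilyLindelofSpace.isLindelof _).countable_of_isDiscrete h2).mono ?_
    exact fun z hz => ⟨hz, hz.1⟩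

theorem Bad_eq_empty [Lvl p] : Bad p = ∅ := by
  rw [Set.eq_empty_iff_forall_notMem]
  intro z₁ hz₁
  obtain ⟨T, hT0, hT⟩ := exists_high_not_Bad (p := p)
  have hc := (countable_crit (p := p)).image Complex.re
  have hd := hc.dense_compl ℝ
  have hopen : IsOpen {t : ℝ | (⟨t, z₁.im⟩ : ℂ) ∈ Bad p} :=
    isOpen_Bad.preimage (by
      have : (fun t : ℝ => (⟨t, z₁.im⟩ : ℂ)) = fun t : ℝ => (t : ℂ) + (z₁.im : ℂ) * I := by
        ext t; simpa using (Complex.mk_eq_add_mul_I t z₁.im)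
      rw [this]; fun_prop)
  obtain ⟨t, ht1, ht2⟩ := hd.inter_open_nonempty _ hopen ⟨z₁.re, hz₁⟩
  set s : Set ℂ := {t} ×ℂ Set.Ioi 0 with hs
  have hsconv : Convex ℝ s := ((convex_singleton t).linear_preimage Complex.reLm).inter
    ((convex_Ioi 0).linear_preimage Complex.imLm)
  have hsub : s ⊆ Bad p := by
    refine hsconv.isPreconnected.subset_of_closure_inter_subset isOpen_Bad
      ⟨⟨t, z₁.im⟩, ⟨rfl, hz₁.1⟩, ht1⟩ ?_
    rintro z ⟨hz, hzs⟩
    have hz0 : 0 < z.im := hzs.2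
    refine mem_Bad_of_mem_closure hz0 (fun h => ht2 ⟨z, ⟨hz0, h⟩, hzs.1⟩) hz
  exact hT ⟨t, T + 1⟩ (by simp) (hsub ⟨rfl, by simp; linarith⟩)

theorem Eqv_of_hm_eq [Lvl p] {z w : ℂ} (hz : 0 < z.im) (hw : 0 < w.im) (h : hm p z = hm p w) :
    Eqv p z w := by
  by_contra hn
  have : z ∈ Bad p := ⟨hz, w, hw, hn, h.symm⟩
  rw [Bad_eq_empty] at this
  exact this

end FrickeTrace
end

noncomputable section
namespace FrickeTrace
open Filter Topology Asymptotics

/-! ### Stabilizers and vanishing orders -/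

variable {p : ℕ}

/-- The derivative of the Möbius transformation of `M` at `z`. -/
def lam (M : M2) (z : ℂ) : ℂ := M.det / den M z ^ 2

theorem lam_mul {A B : M2} (hB : 0 < B.det) {z : ℂ} (hz : 0 < z.im)
    (hBz : mob B z = z) : lam (A * B) z = lam A z * lam B z := by
  rw [lam, lam, lam, den_mul hB hz, hBz, Matrix.det_mul]
  push_cast
  rw [mul_pow, mul_div_mul_comm]

theorem lam_one (z : ℂ) : lam 1 z = 1 := by simp [lam, den]

theorem lam_neg (M : M2) (z : ℂ) : lam (-M) z = lam M z := by
  have h : den (-M) z = - den M z := by simp only [den, Matrix.neg_apply]; push_cast; ring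
  rw [lam, lam, h, neg_sq, Matrix.det_neg]; simp

theorem eq_smul_one_of_lam_eq_one {L : M2} (hL : 0 < L.det) {z : ℂ} (hz : 0 < z.im)
    (hf : mob L z = z) (h1 : lam L z = 1) : L = (L 1 1) • (1 : M2) := by
  have hd := den_ne_zero hL hz
  rw [lam, div_eq_one_iff_eq (pow_ne_zero _ hd)] at h1
  have hdet : (0 : ℝ) < L.det := by exact_mod_cast hL
  have hre := congrArg Complex.re h1
  have him := congrArg Complex.im h1
  simp only [sq, mul_re, mul_im, intCast_re, intCast_im] at hre him
  have h0 : (den L z).im = 0 := by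
    by_contra hne
    have : (den L z).re = 0 := by
      have : (den L z).re * (den L z).im = 0 := by linarith
      exact (mul_eq_zero.1 this).resolve_right hne
    rw [this] at hre
    nlinarith [mul_self_nonneg (den L z).im]
  have hc : L 1 0 = 0 := by
    simp only [den, add_im, mul_im, intCast_re, intCast_im, zero_mul, add_zero] at h0
    exact_mod_cast (mul_eq_zero.1 h0).resolve_right hz.ne'
  have hden : den L z = L 1 1 := by simp [den, hc]
  rw [hden] at h1 hd
  have h2 : L.det = L 1 1 ^ 2 := by exact_mod_cast h1
  have hd' : L 1 1 ≠ 0 := by exact_mod_cast hd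
  have ha : L 0 0 = L 1 1 := by
    rw [Matrix.det_fin_two, hc, mul_zero, sub_zero, sq] at h2
    exact mul_right_cancel₀ hd' h2
  have hb : L 0 1 = 0 := by
    rw [mob, hden, div_eq_iff hd, ha, mul_comm z] at hf
    exact_mod_cast (add_eq_left.1 hf)
  ext i j
  fin_cases i <;> fin_cases j <;> simp [ha, hb, hc]

/-- `Γ₀(p)`-elements fixing `z`. -/
def Stab (p : ℕ) (z : ℂ) : Set M2 := {M | IsG p M ∧ mob M z = z}

theorem Stab.adj {M : M2} {z : ℂ} (hz : 0 < z.im) (h : M ∈ Stab p z) : M.adjugate ∈ Stab p z :=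
  ⟨h.1.adj, by conv_lhs => rw [← h.2]
               exact h.1.mob_adj_mob hz⟩

theorem eq_smul_of_lam_eq {N γ : M2} (hN : 0 < N.det) {z : ℂ} (hz : 0 < z.im)
    (hf : mob N z = z) (hγ : γ ∈ Stab p z) (h : lam N z = lam γ z) : ∃ k : ℤ, N = k • γ := by
  have ha := Stab.adj hz hγ
  have h1 : lam γ z * lam γ.adjugate z = 1 := by
    rw [← lam_mul ha.1.det_pos hz ha.2, hγ.1.mul_adj, lam_one]
  have h2 := eq_smul_one_of_lam_eq_one (L := N * γ.adjugate) (by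
    rw [Matrix.det_mul, ha.1.det, mul_one]; exact hN) hz
    (by rw [mob_mul hN ha.1.det_pos hz, ha.2, hf])
    (by rw [lam_mul ha.1.det_pos hz ha.2, h, h1])
  refine ⟨(N * γ.adjugate) 1 1, ?_⟩
  calc N = N * γ.adjugate * γ := by rw [mul_assoc, hγ.1.adj_mul, mul_one]
    _ = ((N * γ.adjugate) 1 1 • (1 : M2)) * γ := by rw [← h2]
    _ = _ := by rw [smul_mul_assoc, one_mul]

/-- The ramification index of the Hauptmodul. -/
def ram (p : ℕ) (z₀ : ℂ) : ℕ := analyticOrderNatAt (fun z => hm p z - hm p z₀) z₀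

theorem analyticAt_hm_sub [Lvl p] {z : ℂ} (hz : 0 < z.im) (x : ℂ) :
    AnalyticAt ℂ (fun z => hm p z - x) z := (analyticAt_hm hz).sub analyticAt_const

theorem ram_eq [Lvl p] {z₀ : ℂ} (hz : 0 < z₀.im) :
    analyticOrderAt (fun z => hm p z - hm p z₀) z₀ = ram p z₀ := by
  refine (Nat.cast_analyticOrderNatAt ?_).symm
  intro h
  rw [analyticOrderAt_eq_top] at h
  exact hm_not_locally_const hz (h.mono fun x hx => sub_eq_zero.1 hx)

theorem ram_pos [Lvl p] {z₀ : ℂ} (hz : 0 < z₀.im) : 0 < ram p z₀ := by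
  have h := ram_eq (p := p) hz
  rw [Nat.pos_iff_ne_zero]
  intro h0
  rw [h0, Nat.cast_zero, (analyticAt_hm_sub hz _).analyticOrderAt_eq_zero] at h
  exact h (sub_self _)

theorem exists_factor [Lvl p] {z₀ : ℂ} (hz : 0 < z₀.im) : ∃ g : ℂ → ℂ, AnalyticAt ℂ g z₀ ∧
    g z₀ ≠ 0 ∧ ∀ᶠ z in 𝓝 z₀, hm p z - hm p z₀ = (z - z₀) ^ ram p z₀ * g z :=
  ((analyticAt_hm_sub hz _).analyticOrderAt_eq_natCast).1 (ram_eq hz)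

theorem mob_sub_mob {N : M2} (hN : 0 < N.det) {z w : ℂ} (hz : 0 < z.im) (hw : 0 < w.im) :
    mob N z - mob N w = N.det / (den N z * den N w) * (z - w) := by
  have h1 := den_ne_zero hN hz
  have h2 := den_ne_zero hN hw
  rw [mob, mob, div_sub_div _ _ h1 h2, div_mul_eq_mul_div]
  congr 1
  rw [Matrix.det_fin_two, den, den]; push_cast; ring

theorem analyticAt_mob {N : M2} (hN : 0 < N.det) {z : ℂ} (hz : 0 < z.im) :
    AnalyticAt ℂ (mob N) z :=
  analyticOnNhd_of_Hol (fun _ hz => differentiableAt_mob hN hz) z hz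

/-- The local form of `h - h ∘ N` at a fixed point of `N`. -/
theorem exists_factor_sub [Lvl p] {z₀ : ℂ} (hz : 0 < z₀.im) {N : M2} (hN : 0 < N.det)
    (hf : mob N z₀ = z₀) : ∃ g k : ℂ → ℂ, AnalyticAt ℂ k z₀ ∧ g z₀ ≠ 0 ∧
      k z₀ = g z₀ * (1 - lam N z₀ ^ ram p z₀) ∧
      ∀ᶠ z in 𝓝 z₀, hm p z - hm p (mob N z) = (z - z₀) ^ ram p z₀ * k z := by
  obtain ⟨g, hg, hg0, he⟩ := exists_factor (p := p) hz
  have hd := den_ne_zero hN hz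
  have hmob := analyticAt_mob hN hz
  refine ⟨g, fun z => g z - (N.det / (den N z * den N z₀)) ^ ram p z₀ * g (mob N z), ?_, hg0, ?_, ?_⟩
  · have hden : AnalyticAt ℂ (den N) z₀ := by unfold den; fun_prop
    have h1 : AnalyticAt ℂ (fun z => g (mob N z)) z₀ := AnalyticAt.comp (by rwa [hf]) hmob
    exact hg.sub (((analyticAt_const.div (hden.mul analyticAt_const)
      (mul_ne_zero hd hd)).pow _).mul h1)
  · simp only [hf, lam, sq]; ring
  · have ht : Tendsto (mob N) (𝓝 z₀) (𝓝 z₀) := by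
      have := hmob.continuousAt.tendsto; rwa [hf] at this
    filter_upwards [he, ht.eventually he, isOpen_uhp.mem_nhds hz] with z h1 h2 h3
    have h4 := mob_sub_mob hN h3 hz
    rw [hf] at h4
    rw [h4, mul_pow] at h2
    have : hm p z - hm p (mob N z) = (hm p z - hm p z₀) - (hm p (mob N z) - hm p z₀) := by ring
    rw [this, h1, h2]; ring

theorem lam_pow_ram [Lvl p] {z₀ : ℂ} (hz : 0 < z₀.im) {γ : M2} (hγ : γ ∈ Stab p z₀) :
    lam γ z₀ ^ ram p z₀ = 1 := by
  obtain ⟨g, k, hk, hg0, hk0, he⟩ := exists_factor_sub (p := p) hz hγ.1.det_pos hγ.2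
  have h0 : k z₀ = 0 := by
    have h1 : ∀ᶠ z in 𝓝[≠] z₀, k z = 0 := by
      filter_upwards [he.filter_mono nhdsWithin_le_nhds, self_mem_nhdsWithin,
        mem_nhdsWithin_of_mem_nhds (isOpen_uhp.mem_nhds hz)] with z h1 h2 h3
      rw [hm_mob hγ.1 h3, sub_self, eq_comm, mul_eq_zero] at h1
      exact h1.resolve_left (pow_ne_zero _ (sub_ne_zero.2 h2))
    exact tendsto_nhds_unique ((hk.continuousAt.tendsto.mono_left nhdsWithin_le_nhds).congr' h1)
      tendsto_const_nhds
  rw [h0, eq_comm, mul_eq_zero] at hk0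
  exact (sub_eq_zero.1 (hk0.resolve_left hg0)).symm

theorem exists_root [Lvl p] {z₀ : ℂ} (hz : 0 < z₀.im) : ∃ ψ : ℂ → ℂ, AnalyticAt ℂ ψ z₀ ∧
    deriv ψ z₀ ≠ 0 ∧ ψ z₀ = 0 ∧ ∀ᶠ z in 𝓝 z₀, hm p z - hm p z₀ = ψ z ^ ram p z₀ := by
  obtain ⟨g, hg, hg0, he⟩ := exists_factor (p := p) hz
  have hm0 : ram p z₀ ≠ 0 := (ram_pos hz).ne'
  obtain ⟨c, hc⟩ := IsAlgClosed.exists_pow_nat_eq (g z₀) (ram_pos (p := p) hz)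
  have hc0 : c ≠ 0 := by rintro rfl; rw [zero_pow hm0] at hc; exact hg0 hc.symm
  have hq : AnalyticAt ℂ (fun z => g z / g z₀) z₀ := hg.div analyticAt_const hg0
  have hone : g z₀ / g z₀ = 1 := div_self hg0
  have hs : (fun z => g z / g z₀) z₀ ∈ Complex.slitPlane := by simp only [hone]; simp
  have hlog := hq.clog hs
  set ρ : ℂ → ℂ := fun z => c * Complex.exp (Complex.log (g z / g z₀) / ram p z₀) with hρ
  have hρa : AnalyticAt ℂ ρ z₀ :=
    analyticAt_const.mul ((hlog.div analyticAt_const (by exact_mod_cast hm0)).cexp)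
  have hρ0 : ρ z₀ = c := by simp [hρ, hone]
  refine ⟨fun z => (z - z₀) * ρ z, (analyticAt_id.sub analyticAt_const).mul hρa, ?_, by simp, ?_⟩
  · have : HasDerivAt (fun z => (z - z₀) * ρ z) (ρ z₀) z₀ := by
      have h := ((hasDerivAt_id z₀).sub_const z₀).mul hρa.differentiableAt.hasDerivAt
      simp only [id, sub_self, zero_mul, add_zero, one_mul] at h
      exact h
    rw [this.deriv, hρ0]; exact hc0
  · filter_upwards [he, hg.continuousAt.eventually_ne hg0] with z h1 h2
    rw [h1, mul_pow]
    congr 1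
    simp only [hρ]
    rw [mul_pow, ← Complex.exp_nat_mul, mul_div_cancel₀ _ (by exact_mod_cast hm0),
      Complex.exp_log (div_ne_zero h2 hg0), hc, mul_div_cancel₀ _ hg0]

theorem exists_stab_lam [Lvl p] {z₀ : ℂ} (hz : 0 < z₀.im) {ζ : ℂ} (hζ : ζ ^ ram p z₀ = 1) :
    ∃ γ ∈ Stab p z₀, lam γ z₀ = ζ := by
  obtain ⟨ψ, hψ, hd, h0, he⟩ := exists_root (p := p) hz
  have h1 := (hψ.hasStrictDerivAt).hasStrictFDerivAt_equiv hd
  set e := h1.toOpenPartialHomeomorph ψ with hedef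
  have hcoe : ∀ x, e x = ψ x := fun x => by rw [hedef]; rfl
  have hmem : z₀ ∈ e.source := h1.mem_toOpenPartialHomeomorph_source
  have hmt : (0 : ℂ) ∈ e.target := by
    have := e.map_source hmem; rwa [hcoe, h0] at this
  have hsymm : e.symm 0 = z₀ := by rw [← h0, ← hcoe, e.left_inv hmem]
  have hpre : Tendsto (fun x => ζ * ψ x) (𝓝 z₀) (𝓝 0) := by
    have := hψ.continuousAt.tendsto.const_mul ζ
    rwa [h0, mul_zero] at this
  set s : ℂ → ℂ := fun x => e.symm (ζ * ψ x) with hs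
  have hst : Tendsto s (𝓝 z₀) (𝓝 z₀) := by
    have := (e.continuousAt_symm hmt).tendsto.comp hpre
    rwa [hsymm] at this
  have hψs : ∀ᶠ x in 𝓝 z₀, ψ (s x) = ζ * ψ x := by
    filter_upwards [hpre.eventually (e.open_target.mem_nhds hmt)] with x hx
    rw [← hcoe, hs]; exact e.right_inv hx
  obtain ⟨S, hS, hS'⟩ := finite_near 1 one_pos hz hz
  have hev : ∀ᶠ x in 𝓝 z₀, ∃ γ ∈ S, IsG p γ ∧ mob γ x = s x := by
    filter_upwards [hψs, he, hst.eventually he, isOpen_uhp.mem_nhds hz,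
      hst.eventually (isOpen_uhp.mem_nhds hz), (tendsto_id.prodMk hst).eventually hS']
      with x e1 e2 e3 e4 e5 e6
    have : hm p x = hm p (s x) := by
      rw [e1, mul_pow, hζ, one_mul, ← e2] at e3
      exact (sub_left_inj.1 e3).symm
    obtain ⟨M, hM, hMx⟩ := Eqv_of_hm_eq e4 e5 this
    exact ⟨M, e6 M hM.det hMx, hM, hMx⟩
  have hfr : ∃ γ ∈ S, IsG p γ ∧ ∃ᶠ x in 𝓝[≠] z₀, mob γ x = s x := by
    by_contra hcon
    push Not at hcon
    have : ∀ᶠ x in 𝓝[≠] z₀, ∀ γ ∈ S, IsG p γ → mob γ x ≠ s x := by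
      rw [Filter.eventually_all_finite hS]
      intro γ hγ
      by_cases hG : IsG p γ
      · filter_upwards [hcon γ hγ hG] with x hx _ using hx
      · exact Eventually.of_forall fun _ h => absurd h hG
    obtain ⟨x, ⟨γ, h1, h2, h3⟩, h4⟩ := ((hev.filter_mono nhdsWithin_le_nhds).and this).exists
    exact h4 γ h1 h2 h3
  obtain ⟨γ, -, hG, hf⟩ := hfr
  have hmobt : Tendsto (mob γ) (𝓝[≠] z₀) (𝓝 (mob γ z₀)) :=
    (differentiableAt_mob hG.det_pos hz).continuousAt.tendsto.mono_left nhdsWithin_le_nhds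
  have hfix : mob γ z₀ = z₀ :=
    tendsto_nhds_unique_of_frequently_eq hmobt (hst.mono_left nhdsWithin_le_nhds) hf
  refine ⟨γ, ⟨hG, hfix⟩, ?_⟩
  have hD1 : HasDerivAt (fun x => ψ (mob γ x)) (deriv ψ z₀ * lam γ z₀) z₀ := by
    refine HasDerivAt.comp z₀ (h₂ := ψ) ?_ (hasDerivAt_mob hG.det_pos hz)
    rw [hfix]; exact hψ.differentiableAt.hasDerivAt
  have hD2 : HasDerivAt (fun x => ζ * ψ x) (ζ * deriv ψ z₀) z₀ :=
    hψ.differentiableAt.hasDerivAt.const_mul ζ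
  have hfeq : ∃ᶠ x in 𝓝[≠] z₀, slope (fun x => ψ (mob γ x)) z₀ x = slope (fun x => ζ * ψ x) z₀ x := by
    refine (hf.and_eventually (hψs.filter_mono nhdsWithin_le_nhds)).mono fun x hx => ?_
    simp only [slope_def_field, hfix, h0, hx.1, hx.2, mul_zero]
  have := tendsto_nhds_unique_of_frequently_eq hD1.tendsto_slope hD2.tendsto_slope hfeq
  rw [mul_comm] at this
  exact mul_right_cancel₀ hd this

theorem order_sub_comp [Lvl p] {z₀ : ℂ} (hz : 0 < z₀.im) {N : M2} (hN : 0 < N.det)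
    (hf : mob N z₀ = z₀) (hns : ¬ ∃ (k : ℤ) (γ : M2), IsG p γ ∧ N = k • γ) :
    analyticOrderAt (fun z => hm p z - hm p (mob N z)) z₀ = ram p z₀ := by
  obtain ⟨g, k, hk, hg0, hk0, he⟩ := exists_factor_sub (p := p) hz hN hf
  have ha : AnalyticAt ℂ (fun z => hm p z - hm p (mob N z)) z₀ :=
    (analyticAt_hm hz).sub ((analyticAt_hm (by rwa [hf])).comp (analyticAt_mob hN hz))
  refine ha.analyticOrderAt_eq_natCast.2 ⟨k, hk, ?_, he⟩
  rw [hk0]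
  refine mul_ne_zero hg0 (sub_ne_zero.2 fun h => hns ?_)
  obtain ⟨γ, hγ, hl⟩ := exists_stab_lam (p := p) hz h.symm
  obtain ⟨k, hk⟩ := eq_smul_of_lam_eq hN hz hf hγ hl.symm
  exact ⟨k, γ, hγ.1, hk⟩

theorem card_stab [Lvl p] {z₀ : ℂ} (hz : 0 < z₀.im) : Nat.card (Stab p z₀) = 2 * ram p z₀ := by
  have hm0 := ram_pos (p := p) hz
  have hm1 : NeZero (ram p z₀) := ⟨hm0.ne'⟩
  choose! γ hγ hγl using fun (ζ : ℂ) (h : ζ ^ ram p z₀ = 1) => exists_stab_lam (p := p) hz h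
  let F : Bool × rootsOfUnity (ram p z₀) ℂ → Stab p z₀ := fun x =>
    have h : ((x.2 : ℂˣ) : ℂ) ^ ram p z₀ = 1 := by
      have := (_root_.mem_rootsOfUnity _ _).1 x.2.2
      have h := congrArg Units.val this
      rwa [Units.val_pow_eq_pow_val, Units.val_one] at h
    ⟨if x.1 then γ (x.2 : ℂˣ) else -γ (x.2 : ℂˣ), by
      split_ifs
      · exact hγ _ h
      · exact ⟨(hγ _ h).1.neg, by rw [mob_neg]; exact (hγ _ h).2⟩⟩
  have hFl : ∀ x, lam (F x).1 z₀ = ((x.2 : ℂˣ) : ℂ) := fun x => by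
    have h : ((x.2 : ℂˣ) : ℂ) ^ ram p z₀ = 1 := by
      have := (_root_.mem_rootsOfUnity _ _).1 x.2.2
      have h := congrArg Units.val this
      rwa [Units.val_pow_eq_pow_val, Units.val_one] at h
    simp only [F]
    split_ifs
    · exact hγl _ h
    · rw [lam_neg]; exact hγl _ h
  have hne : ∀ M ∈ Stab p z₀, M ≠ -M := fun M hM h => by
    have h2 : M = 0 := by
      ext i j
      have := congrFun (congrFun h i) j
      simp only [Matrix.neg_apply] at this
      simp only [Matrix.zero_apply]; omega
    have := hM.1.det
    rw [h2] at this; simp at this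
  have hbij : Function.Bijective F := by
    constructor
    · rintro ⟨b, x⟩ ⟨b', x'⟩ h
      have h1 : x = x' := by
        have := hFl ⟨b, x⟩
        rw [h, hFl] at this
        exact Subtype.ext (Units.ext this.symm)
      subst h1
      have h2 := congrArg Subtype.val h
      have h3 := (F (true, x)).2
      have h4 : (F (true, x)).1 = γ (x : ℂˣ) := rfl
      rw [h4] at h3
      have := hne _ h3
      cases b <;> cases b' <;> simp only [F, Bool.false_eq_true, if_true, if_false] at h2
      · rfl
      · exact absurd h2.symm this
      · exact absurd h2 this
      · rfl
    · rintro ⟨M, hM⟩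
      have hl := lam_pow_ram hz hM
      let x : rootsOfUnity (ram p z₀) ℂ := rootsOfUnity.mkOfPowEq (lam M z₀) hl
      have hx : ((x : ℂˣ) : ℂ) = lam M z₀ := rootsOfUnity.coe_mkOfPowEq hl
      obtain ⟨k, hk⟩ := eq_smul_of_lam_eq hM.1.det_pos hz hM.2 (hγ _ hl) (hγl _ hl).symm
      have hk2 : k ^ 2 = 1 := by
        have := congrArg Matrix.det hk
        rw [Matrix.det_smul, hM.1.det, (hγ _ hl).1.det] at this
        simpa using this.symm
      rcases (sq_eq_sq_iff_eq_or_eq_neg.1 (hk2.trans (one_pow 2).symm)) with rfl | rfl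
      · exact ⟨(true, x), Subtype.ext (by simpa [F, hx] using hk.symm)⟩
      · exact ⟨(false, x), Subtype.ext (by simpa [F, hx] using hk.symm)⟩
  rw [← Nat.card_congr (Equiv.ofBijective F hbij), Nat.card_prod, Nat.card_eq_fintype_card,
    Fintype.card_bool, Complex.card_rootsOfUnity]

end FrickeTrace
end

noncomputable section
namespace FrickeTrace
open Filter Topology Asymptotics

/-! ### Representatives of `Γ₀(p)`-cosets of integral matrices of determinant `n` -/

variable {p : ℕ}

/-- Integral matrices of determinant `n` that are upper triangular modulo `p`. -/
def MM (p n : ℕ) : Set M2 := {M | M.det = n ∧ (p : ℤ) ∣ M 1 0}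

theorem MM.det_pos {n : ℕ} (hn : 0 < n) {M : M2} (h : M ∈ MM p n) : 0 < M.det := by
  rw [h.1]; exact_mod_cast hn

/-- Left equivalence under `Γ₀(p)`. -/
def LEq (p : ℕ) (M N : M2) : Prop := ∃ γ, IsG p γ ∧ N = γ * M

theorem LEq.symm {M N : M2} (h : LEq p M N) : LEq p N M := by
  obtain ⟨γ, hγ, rfl⟩ := h
  exact ⟨γ.adjugate, hγ.adj, by rw [← mul_assoc, hγ.adj_mul, one_mul]⟩

theorem LEq.trans {M N L : M2} (h : LEq p M N) (h' : LEq p N L) : LEq p M L := by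
  obtain ⟨γ, hγ, rfl⟩ := h
  obtain ⟨δ, hδ, rfl⟩ := h'
  exact ⟨δ * γ, hδ.mul hγ, by rw [mul_assoc]⟩

theorem LEq.mem {n : ℕ} {M N : M2} (h : LEq p M N) (hM : M ∈ MM p n) : N ∈ MM p n := by
  obtain ⟨γ, hγ, rfl⟩ := h
  refine ⟨by rw [Matrix.det_mul, hγ.det, one_mul, hM.1], ?_⟩
  simp only [Matrix.mul_apply, Fin.sum_univ_two]
  exact dvd_add (hγ.dvd.mul_right _) (hM.2.mul_left _)

/-- Indices for the coset representatives. -/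
abbrev Ix := (Σ _ : ℕ × ℕ, ℕ) ⊕ (Σ _ : ℕ × ℕ, ℕ)

/-- The coset representatives. -/
def rep (p : ℕ) : Ix → M2
  | Sum.inl x => !![(x.1.1 : ℤ), (x.2 : ℤ); 0, (x.1.2 : ℤ)]
  | Sum.inr x => !![0, -(x.1.2 : ℤ); (p : ℤ) * x.1.1, (x.2 : ℤ)]

/-- Factorizations `n = p a d`. -/
def pDiv (p n : ℕ) : Finset (ℕ × ℕ) := if p ∣ n then (n / p).divisorsAntidiagonal else ∅

theorem mem_pDiv {n : ℕ} (hn : 0 < n) {x : ℕ × ℕ} : x ∈ pDiv p n ↔ p * (x.1 * x.2) = n := by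
  rw [pDiv]
  split_ifs with h
  · obtain ⟨m, rfl⟩ := h
    have hp : 0 < p := Nat.pos_of_mul_pos_right hn
    have hm : 0 < m := Nat.pos_of_mul_pos_left hn
    rw [Nat.mul_div_cancel_left _ hp, Nat.mem_divisorsAntidiagonal]
    exact ⟨fun h => by rw [h.1], fun h => ⟨Nat.eq_of_mul_eq_mul_left hp h, hm.ne'⟩⟩
  · simp only [Finset.notMem_empty, false_iff]
    exact fun hne => h ⟨_, hne.symm⟩

/-- The index set of the coset representatives. -/
def ixs (p n : ℕ) : Finset Ix :=
  (n.divisorsAntidiagonal.sigma fun x => Finset.range x.2).disjSum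
    ((pDiv p n).sigma fun x => Finset.range (p * x.2))

theorem rep_mem {n : ℕ} (hn : 0 < n) {i : Ix} (hi : i ∈ ixs p n) : rep p i ∈ MM p n := by
  rw [ixs, Finset.mem_disjSum] at hi
  rcases hi with ⟨⟨⟨a, d⟩, b⟩, h, rfl⟩ | ⟨⟨⟨a, d⟩, b⟩, h, rfl⟩
  · simp only [Finset.mem_sigma, Nat.mem_divisorsAntidiagonal] at h
    refine ⟨?_, by simp [rep]⟩
    simp only [rep, Matrix.det_fin_two_of]
    rw [← h.1.1]; push_cast; ring
  · simp only [Finset.mem_sigma, mem_pDiv hn] at h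
    refine ⟨?_, by simp [rep]⟩
    simp only [rep, Matrix.det_fin_two_of]
    rw [← h.1]; push_cast; ring

theorem eq_of_emod {d b b' : ℕ} (hb : b < d) (hb' : b' < d) {y : ℤ} (h : (b : ℤ) = b' + y * d) :
    b = b' := by
  have h1 : ((b : ℤ) % d) = b' % d := by rw [h, Int.add_mul_emod_self_right]
  have h2 : b % d = b' % d := by exact_mod_cast h1
  rwa [Nat.mod_eq_of_lt hb, Nat.mod_eq_of_lt hb'] at h2

theorem not_LEq_inl_inr [Lvl p] {n : ℕ} (hn : 0 < n) {x y} (hx : Sum.inl x ∈ ixs p n)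
    (hy : Sum.inr y ∈ ixs p n) : ¬ LEq p (rep p (Sum.inr y)) (rep p (Sum.inl x)) := by
  rintro ⟨γ, hγ, h⟩
  obtain ⟨⟨a, d⟩, b⟩ := x
  obtain ⟨⟨a', d'⟩, b'⟩ := y
  simp only [ixs, Finset.inl_mem_disjSum, Finset.inr_mem_disjSum, Finset.mem_sigma, mem_pDiv hn] at hx hy
  have h10 := congrFun (congrFun h 1) 0
  simp only [rep, Matrix.mul_apply, Fin.sum_univ_two] at h10
  simp at h10
  have ha' : a' ≠ 0 := by rintro rfl; simp at hy; omega
  have hw : γ 1 1 = 0 := by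
    rcases h10 with h | h | h
    · exact h
    · exact absurd h (Lvl.pos p).ne'
    · exact absurd h ha'
  obtain ⟨c, hc⟩ := hγ.dvd
  have hd := hγ.det
  rw [Matrix.det_fin_two, hw, hc, mul_zero, zero_sub] at hd
  have h1 : (p : ℤ) ∣ 1 := ⟨-(γ 0 1 * c), by rw [← hd]; ring⟩
  have h2 := Int.le_of_dvd one_pos h1
  have := Lvl.two_le p
  omega

theorem rep_injective [Lvl p] {n : ℕ} (hn : 0 < n) {i j : Ix} (hi : i ∈ ixs p n)
    (hj : j ∈ ixs p n) (h : LEq p (rep p j) (rep p i)) : i = j := by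
  have hp0 : (p : ℤ) ≠ 0 := by exact_mod_cast (Lvl.pos p).ne'
  rcases i with x | x <;> rcases j with y | y
  · obtain ⟨γ, hγ, h⟩ := h
    obtain ⟨⟨a, d⟩, b⟩ := x
    obtain ⟨⟨a', d'⟩, b'⟩ := y
    simp only [ixs, Finset.inl_mem_disjSum, Finset.mem_sigma, Nat.mem_divisorsAntidiagonal,
      Finset.mem_range] at hi hj
    have h00 := congrFun (congrFun h 0) 0
    have h01 := congrFun (congrFun h 0) 1
    have h10 := congrFun (congrFun h 1) 0
    have h11 := congrFun (congrFun h 1) 1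
    simp only [rep, Matrix.mul_apply, Fin.sum_univ_two, Matrix.of_apply, Matrix.cons_val',
      Matrix.cons_val_zero, Matrix.cons_val_one, Matrix.cons_val_fin_one, mul_zero,
      add_zero] at h00 h01 h10 h11
    have ha' : 0 < a' := Nat.pos_of_ne_zero (by rintro rfl; simp at hj; omega)
    have ha : 0 < a := Nat.pos_of_ne_zero (by rintro rfl; simp at hi; omega)
    have hc : γ 1 0 = 0 := by
      rcases mul_eq_zero.1 h10.symm with h | h
      · exact h
      · omega
    have hd := hγ.det
    rw [Matrix.det_fin_two, hc, mul_zero, sub_zero] at hd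
    have hx : γ 0 0 = 1 := by
      rcases Int.eq_one_or_neg_one_of_mul_eq_one hd with h | h
      · exact h
      · rw [h] at h00; omega
    rw [hx, one_mul] at hd h00 h01
    rw [hc, zero_mul, hd, one_mul, zero_add] at h11
    have e1 : a = a' := by exact_mod_cast h00
    have e2 : d = d' := by exact_mod_cast h11
    subst e1 e2
    have := eq_of_emod hi.2 hj.2 h01
    subst this; rfl
  · exact absurd h (not_LEq_inl_inr hn hi hj)
  · exact absurd h.symm (not_LEq_inl_inr hn hj hi)
  · obtain ⟨γ, hγ, h⟩ := h
    obtain ⟨⟨a, d⟩, b⟩ := x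
    obtain ⟨⟨a', d'⟩, b'⟩ := y
    simp only [ixs, Finset.inr_mem_disjSum, Finset.mem_sigma, mem_pDiv hn,
      Finset.mem_range] at hi hj
    have h00 := congrFun (congrFun h 0) 0
    have h01 := congrFun (congrFun h 0) 1
    have h10 := congrFun (congrFun h 1) 0
    have h11 := congrFun (congrFun h 1) 1
    simp only [rep, Matrix.mul_apply, Fin.sum_univ_two, Matrix.of_apply, Matrix.cons_val',
      Matrix.cons_val_zero, Matrix.cons_val_one, Matrix.cons_val_fin_one, mul_zero,
      zero_add] at h00 h01 h10 h11
    have ha' : 0 < a' := Nat.pos_of_ne_zero (by rintro rfl; simp at hj; omega)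
    have ha : 0 < a := Nat.pos_of_ne_zero (by rintro rfl; simp at hi; omega)
    have hy : γ 0 1 = 0 := by
      rcases mul_eq_zero.1 h00.symm with h | h
      · exact h
      · rcases mul_eq_zero.1 h with h | h
        · exact absurd h hp0
        · omega
    have hd := hγ.det
    rw [Matrix.det_fin_two, hy, zero_mul, sub_zero, mul_comm] at hd
    have h10' : (a : ℤ) = γ 1 1 * a' := mul_left_cancel₀ hp0 (by rw [h10]; ring)
    have hw : γ 1 1 = 1 := by
      rcases Int.eq_one_or_neg_one_of_mul_eq_one hd with h | h
      · exact h
      · rw [h] at h10'; omega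
    rw [hw, one_mul] at hd h10' h11
    rw [hd, hy, zero_mul, one_mul, add_zero] at h01
    have e1 : a = a' := by exact_mod_cast h10'
    have e2 : d = d' := by exact_mod_cast neg_injective h01
    subst e1 e2
    obtain ⟨c, hc⟩ := hγ.dvd
    have := eq_of_emod (y := -c) hi.2 hj.2 (by rw [h11, hc]; push_cast; ring)
    subst this; rfl

theorem exists_rep [Lvl p] {n : ℕ} (hn : 0 < n) {M : M2} (hM : M ∈ MM p n) :
    ∃ i ∈ ixs p n, LEq p M (rep p i) := by
  have hp0 : (p : ℤ) ≠ 0 := by exact_mod_cast (Lvl.pos p).ne'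
  have hpp := Nat.prime_iff_prime_int.1 (Lvl.prime p)
  obtain ⟨hdet, hdvd⟩ := hM
  rw [Matrix.det_fin_two] at hdet
  have hg : 0 < Int.gcd (M 0 0) (M 1 0) := by
    rw [Int.gcd_pos_iff]
    by_contra hcon
    push Not at hcon
    rw [hcon.1, hcon.2] at hdet
    simp at hdet; omega
  obtain ⟨α, c, hcop, hα, hc⟩ := Int.exists_gcd_one hg
  set g := Int.gcd (M 0 0) (M 1 0) with hgdef
  have hgZ : (0 : ℤ) < g := by exact_mod_cast hg
  have hcop' : IsCoprime α c := Int.isCoprime_iff_gcd_eq_one.2 hcop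
  -- the complementary divisor
  obtain ⟨d, hd⟩ : ∃ d : ℕ, (d : ℤ) = α * M 1 1 - c * M 0 1 := by
    refine ⟨(α * M 1 1 - c * M 0 1).toNat, Int.toNat_of_nonneg ?_⟩
    have : (g : ℤ) * (α * M 1 1 - c * M 0 1) = n := by rw [← hdet, hα, hc]; ring
    by_contra hneg
    push Not at hneg
    have := mul_neg_of_pos_of_neg hgZ hneg
    omega
  have hgd : g * d = n := by
    have : (g : ℤ) * d = n := by rw [hd, ← hdet, hα, hc]; ring
    exact_mod_cast this
  have hd0 : 0 < d := Nat.pos_of_ne_zero (by rintro rfl; simp at hgd; omega)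
  by_cases hpc : (p : ℤ) ∣ c
  · obtain ⟨x, y, hxy⟩ := hcop'
    set b₀ : ℤ := x * M 0 1 + y * M 1 1 with hb₀
    have hdz : (0 : ℤ) < d := by exact_mod_cast hd0
    refine ⟨Sum.inl ⟨(g, d), (b₀ % d).toNat⟩, ?_, !![1, -(b₀ / d); 0, 1] * !![x, y; -c, α], ?_, ?_⟩
    · simp only [ixs, Finset.inl_mem_disjSum, Finset.mem_sigma, Nat.mem_divisorsAntidiagonal,
        Finset.mem_range]
      refine ⟨⟨hgd, hn.ne'⟩, ?_⟩
      have := Int.emod_lt_of_pos b₀ hdz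
      have := Int.emod_nonneg b₀ hdz.ne'
      omega
    · refine IsG.mul ⟨by simp, by simp⟩ ⟨?_, by simpa using hpc⟩
      rw [Matrix.det_fin_two_of, ← hxy]; ring
    · have hmod := Int.emod_add_mul_ediv b₀ d
      have htn : ((b₀ % d).toNat : ℤ) = b₀ % d := Int.toNat_of_nonneg (Int.emod_nonneg b₀ hdz.ne')
      rw [mul_assoc, Matrix.eta_fin_two M]
      simp only [rep, Matrix.mul_fin_two, htn, hα, hc]
      congr 1
      ext i j
      fin_cases i <;> fin_cases j
      · simp; linear_combination (-(g : ℤ)) * hxy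
      · simp; linear_combination hmod - (b₀ / d) * hd - hb₀
      · simp; ring
      · simp; linear_combination hd
  · have hcp : IsCoprime ((p : ℤ) * α) c :=
      IsCoprime.mul_left ((Prime.coprime_iff_not_dvd hpp).2 hpc) hcop'
    obtain ⟨s, y, hsy⟩ := hcp
    have hpg : p ∣ g := by
      rw [hc] at hdvd
      have := (hpp.dvd_or_dvd hdvd).resolve_left hpc
      exact_mod_cast this
    obtain ⟨a, ha⟩ := hpg
    have hpd : (0 : ℤ) < ((p * d : ℕ) : ℤ) := by
      exact_mod_cast Nat.mul_pos (Lvl.pos p) hd0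
    set b₀ : ℤ := p * s * M 0 1 + y * M 1 1 with hb₀
    refine ⟨Sum.inr ⟨(a, d), (b₀ % (p * d : ℕ)).toNat⟩, ?_,
      !![1, 0; p * (b₀ / (p * d : ℕ)), 1] * !![c, -α; p * s, y], ?_, ?_⟩
    · simp only [ixs, Finset.inr_mem_disjSum, Finset.mem_sigma, mem_pDiv hn, Finset.mem_range]
      refine ⟨by rw [← hgd, ha]; ring, ?_⟩
      have := Int.emod_lt_of_pos b₀ hpd
      have := Int.emod_nonneg b₀ hpd.ne'
      omega
    · refine IsG.mul ⟨by simp, by simp⟩ ⟨?_, by simp⟩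
      rw [Matrix.det_fin_two_of, ← hsy]; ring
    · have hmod := Int.emod_add_mul_ediv b₀ (p * d : ℕ)
      have htn : ((b₀ % (p * d : ℕ)).toNat : ℤ) = b₀ % (p * d : ℕ) :=
        Int.toNat_of_nonneg (Int.emod_nonneg b₀ hpd.ne')
      have haz : (g : ℤ) = p * a := by exact_mod_cast ha
      push_cast at hmod htn
      rw [mul_assoc, Matrix.eta_fin_two M]
      simp only [rep, Matrix.mul_fin_two, hα, hc]
      push_cast
      rw [htn]
      congr 1
      ext i j
      fin_cases i <;> fin_cases j
      · simp; ring
      · simp; linear_combination -hd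
      · simp; linear_combination (-(g : ℤ)) * hsy - haz
      · simp; linear_combination hmod - hb₀ - (p * (b₀ / (p * d))) * hd

end FrickeTrace
end

noncomputable section
namespace FrickeTrace
open Filter Topology Asymptotics

/-! ### The modular polynomial on the diagonal -/

variable {p : ℕ}

/-- Integral multiples of elements of `Γ₀(p)`. -/
def Sc (p : ℕ) (M : M2) : Prop := ∃ (k : ℤ) (γ : M2), IsG p γ ∧ M = k • γ

theorem Sc.mul_left {M γ : M2} (hγ : IsG p γ) (h : Sc p M) : Sc p (γ * M) := by
  obtain ⟨k, δ, hδ, rfl⟩ := h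
  exact ⟨k, γ * δ, hγ.mul hδ, by rw [Matrix.mul_smul]⟩

theorem Sc.mul_right {M γ : M2} (hγ : IsG p γ) (h : Sc p M) : Sc p (M * γ) := by
  obtain ⟨k, δ, hδ, rfl⟩ := h
  exact ⟨k, δ * γ, hδ.mul hγ, by rw [Matrix.smul_mul]⟩

theorem LEq.sc_iff {M N : M2} (h : LEq p M N) : Sc p M ↔ Sc p N := by
  constructor
  · obtain ⟨γ, hγ, rfl⟩ := h; exact fun h => h.mul_left hγ
  · obtain ⟨γ, hγ, rfl⟩ := h.symm; exact fun h => h.mul_left hγ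

theorem sc_mul_right_iff {M γ : M2} (hγ : IsG p γ) : Sc p (M * γ) ↔ Sc p M := by
  refine ⟨fun h => ?_, fun h => h.mul_right hγ⟩
  have := h.mul_right hγ.adj
  rwa [mul_assoc, hγ.mul_adj, mul_one] at this

theorem prod_perm [Lvl p] {n : ℕ} (hn : 0 < n) {T : M2 → M2} (hT : ∀ M ∈ MM p n, T M ∈ MM p n)
    (hi : ∀ M ∈ MM p n, ∀ N ∈ MM p n, LEq p (T M) (T N) → LEq p M N) {f : M2 → ℂ}
    (hf : ∀ M ∈ MM p n, ∀ N, LEq p M N → f M = f N) :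
    ∏ i ∈ ixs p n, f (T (rep p i)) = ∏ i ∈ ixs p n, f (rep p i) := by
  classical
  choose! σ hσ hσ' using fun (i : Ix) (h : i ∈ ixs p n) => exists_rep hn (hT _ (rep_mem hn h))
  have hinj : Set.InjOn σ (ixs p n) := by
    intro i hi' j hj h
    refine rep_injective hn hi' hj (hi _ (rep_mem hn hj) _ (rep_mem hn hi') ?_)
    refine (hσ' j hj).trans ?_
    rw [← h]
    exact (hσ' i hi').symm
  have himg : (ixs p n).image σ = ixs p n := by
    refine Finset.eq_of_subset_of_card_le (Finset.image_subset_iff.2 hσ) ?_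
    rw [Finset.card_image_of_injOn hinj]
  calc ∏ i ∈ ixs p n, f (T (rep p i)) = ∏ i ∈ ixs p n, f (rep p (σ i)) :=
        Finset.prod_congr rfl fun i h => hf _ (hT _ (rep_mem hn h)) _ (hσ' i h)
    _ = ∏ i ∈ (ixs p n).image σ, f (rep p i) := by
        rw [Finset.prod_image hinj]
    _ = _ := by rw [himg]

open Classical in
/-- The factor of the modular polynomial attached to `M`, with multiples of `Γ₀(p)` omitted. -/
def fac (p : ℕ) (z : ℂ) (M : M2) : ℂ := if Sc p M then 1 else hm p z - hm p (mob M z)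

/-- The modular polynomial of level `n` on the diagonal. -/
def Fn (p n : ℕ) (z : ℂ) : ℂ := ∏ i ∈ ixs p n, fac p z (rep p i)

theorem LEq.Eqv_mob {n : ℕ} (hn : 0 < n) {M N : M2} (h : LEq p M N) (hM : M ∈ MM p n) {z : ℂ}
    (hz : 0 < z.im) : Eqv p (mob M z) (mob N z) := by
  obtain ⟨γ, hγ, rfl⟩ := h
  exact ⟨γ, hγ, (mob_mul hγ.det_pos (MM.det_pos hn hM) hz).symm⟩

theorem LEq.hm_mob_eq [Lvl p] {n : ℕ} (hn : 0 < n) {M N : M2} (h : LEq p M N) (hM : M ∈ MM p n)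
    {z : ℂ} (hz : 0 < z.im) : hm p (mob N z) = hm p (mob M z) :=
  (h.Eqv_mob hn hM hz).hm_eq (mob_im_pos (MM.det_pos hn hM) hz)

theorem fac_congr [Lvl p] {n : ℕ} (hn : 0 < n) {z : ℂ} (hz : 0 < z.im) (M : M2) (hM : M ∈ MM p n)
    (N : M2) (h : LEq p M N) : fac p z M = fac p z N := by
  by_cases h' : Sc p M
  · simp only [fac, h', h.sc_iff.1 h', if_true]
  · simp only [fac, h', mt h.sc_iff.2 h', if_false, h.hm_mob_eq hn hM hz]

theorem MM.mul_right {n : ℕ} {M γ : M2} (hγ : IsG p γ) (hM : M ∈ MM p n) : M * γ ∈ MM p n := by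
  refine ⟨by rw [Matrix.det_mul, hγ.det, mul_one, hM.1], ?_⟩
  simp only [Matrix.mul_apply, Fin.sum_univ_two]
  exact dvd_add (hM.2.mul_right _) (hγ.dvd.mul_left _)

theorem Inv_Fn [Lvl p] {n : ℕ} (hn : 0 < n) : Inv p (Fn p n) := by
  intro γ hγ z hz
  rw [Fn, Fn, ← prod_perm hn (T := fun M => M * γ) (fun M hM => MM.mul_right hγ hM) ?_
    (fac_congr hn hz)]
  · refine Finset.prod_congr rfl fun i hi => ?_
    have hM := MM.det_pos hn (rep_mem hn hi)
    by_cases h : Sc p (rep p i)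
    · simp only [fac, h, (sc_mul_right_iff hγ).2 h, if_true]
    · simp only [fac, h, mt (sc_mul_right_iff hγ).1 h, if_false, mob_mul hM hγ.det_pos hz,
        hm_mob hγ hz]
  · rintro M - N - ⟨δ, hδ, h⟩
    refine ⟨δ, hδ, ?_⟩
    have := congrArg (· * γ.adjugate) h
    simpa only [mul_assoc, hγ.mul_adj, mul_one] using this

theorem Hol_fac [Lvl p] {M : M2} (hM : 0 < M.det) : Hol (fun z => fac p z M) := by
  intro z hz
  by_cases h : Sc p M
  · simp only [fac, h, if_true]; fun_prop
  · simp only [fac, h, if_false]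
    exact (differentiableAt_hm p hz).sub
      ((differentiableAt_hm p (mob_im_pos hM hz)).comp z (differentiableAt_mob hM hz))

theorem Hol_Fn [Lvl p] {n : ℕ} (hn : 0 < n) : Hol (Fn p n) := by
  intro z hz
  have := DifferentiableAt.fun_finsetProd (x := z) (u := ixs p n) (f := fun i z => fac p z (rep p i))
    fun i hi => Hol_fac (p := p) (MM.det_pos hn (rep_mem hn hi)) z hz
  exact this

/-- Conjugation by the Fricke involution. -/
def wc (p : ℕ) (M : M2) : M2 := !![M 1 1, -(M 1 0 / p); -p * M 0 1, M 0 0]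

theorem wc_mem [Lvl p] {n : ℕ} {M : M2} (hM : M ∈ MM p n) : wc p M ∈ MM p n := by
  have hp : (p : ℤ) ≠ 0 := by exact_mod_cast (Lvl.pos p).ne'
  obtain ⟨h1, c, hc⟩ := hM
  refine ⟨?_, by simp [wc]⟩
  rw [Matrix.det_fin_two] at h1
  simp only [wc, Matrix.det_fin_two_of]
  rw [hc, Int.mul_ediv_cancel_left _ hp, ← h1, hc]; ring

theorem wc_wc [Lvl p] {M : M2} (hM : (p : ℤ) ∣ M 1 0) : wc p (wc p M) = M := by
  have hp : (p : ℤ) ≠ 0 := by exact_mod_cast (Lvl.pos p).ne'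
  obtain ⟨c, hc⟩ := hM
  ext i j
  fin_cases i <;> fin_cases j
  · simp [wc]
  · simp [wc, Int.neg_ediv_of_dvd, Int.mul_ediv_cancel_left _ hp]
  · simp [wc, hc, Int.mul_ediv_cancel_left _ hp]
  · simp [wc]

theorem wc_mul [Lvl p] {M N : M2} (hM : (p : ℤ) ∣ M 1 0) (hN : (p : ℤ) ∣ N 1 0) :
    wc p (M * N) = wc p M * wc p N := by
  have hp : (p : ℤ) ≠ 0 := by exact_mod_cast (Lvl.pos p).ne'
  obtain ⟨c, hc⟩ := hM
  obtain ⟨d, hd⟩ := hN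
  have h1 : (M * N) 1 0 = p * (c * N 0 0 + M 1 1 * d) := by
    simp only [Matrix.mul_apply, Fin.sum_univ_two]; rw [hc, hd]; ring
  rw [wc, wc, wc, h1, hc, hd, Int.mul_ediv_cancel_left _ hp, Int.mul_ediv_cancel_left _ hp,
    Int.mul_ediv_cancel_left _ hp, Matrix.mul_fin_two]
  simp only [Matrix.mul_apply, Fin.sum_univ_two, hc, hd]
  ext i j
  fin_cases i <;> fin_cases j <;> simp <;> ring

theorem IsG.wc [Lvl p] {γ : M2} (hγ : IsG p γ) : IsG p (wc p γ) := by
  have := wc_mem (p := p) (n := 1) (M := γ) ⟨by simpa using hγ.det, hγ.dvd⟩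
  exact ⟨by simpa using this.1, this.2⟩

theorem LEq.wc [Lvl p] {M N : M2} (hM : (p : ℤ) ∣ M 1 0) (h : LEq p M N) :
    LEq p (wc p M) (wc p N) := by
  obtain ⟨γ, hγ, rfl⟩ := h
  exact ⟨_, hγ.wc, wc_mul hγ.dvd hM⟩

theorem wc_smul [Lvl p] (k : ℤ) {γ : M2} (hγ : (p : ℤ) ∣ γ 1 0) :
    wc p (k • γ) = k • wc p γ := by
  ext i j
  fin_cases i <;> fin_cases j
  · simp [wc]
  · simp [wc, Int.mul_ediv_assoc _ hγ]
  · simp [wc]; ring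
  · simp [wc]

theorem Sc.wc [Lvl p] {M : M2} (h : Sc p M) : Sc p (wc p M) := by
  obtain ⟨k, γ, hγ, rfl⟩ := h
  exact ⟨k, _, hγ.wc, wc_smul k hγ.dvd⟩

theorem sc_wc_iff [Lvl p] {M : M2} (hM : (p : ℤ) ∣ M 1 0) : Sc p (wc p M) ↔ Sc p M :=
  ⟨fun h => by simpa only [wc_wc hM] using h.wc, fun h => h.wc⟩

theorem mob_Wf [Lvl p] {n : ℕ} (hn : 0 < n) {M : M2} (hM : M ∈ MM p n) {z : ℂ} (hz : 0 < z.im) :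
    mob M (Wf p z) = Wf p (mob (wc p M) z) := by
  have hp : (p : ℤ) ≠ 0 := by exact_mod_cast (Lvl.pos p).ne'
  have hpC : (p : ℂ) ≠ 0 := Lvl.cast_ne p
  have hz0 : z ≠ 0 := ne_zero_of_im_pos hz
  have h1 := den_ne_zero (MM.det_pos hn hM) (Wf_im_pos p hz)
  have h2 := den_ne_zero (MM.det_pos hn (wc_mem hM)) hz
  have h3 := ne_zero_of_im_pos (mob_im_pos (MM.det_pos hn (wc_mem hM)) hz)
  obtain ⟨-, c, hc⟩ := hM
  rw [mob] at h3
  have h4 := (div_ne_zero_iff.1 h3).1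
  simp only [mob, Wf] at h1 ⊢
  simp only [den, wc, hc, Int.mul_ediv_cancel_left _ hp] at *
  simp at *
  field_simp at *
  have h5 : (z : ℂ) * M 1 1 - c ≠ 0 := by rwa [sub_eq_add_neg]
  have h7 : (M 0 0 : ℂ) - p * z * M 0 1 ≠ 0 := by
    intro h; apply h2; rw [← h]; ring
  have h8 : (z * M 1 1 - c) * (z * M 1 1 - c : ℂ)⁻¹ = 1 := mul_inv_cancel₀ h5
  field_simp
  linear_combination (-(M 0 0 : ℂ) + p * z * M 0 1) * h8

theorem Fn_Wf [Lvl p] {n : ℕ} (hn : 0 < n) {z : ℂ} (hz : 0 < z.im) :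
    Fn p n (Wf p z) = ∏ i ∈ ixs p n, (fac p z (rep p i) *
      open Classical in if Sc p (rep p i) then 1 else
        -kap p * (up p z)⁻¹ * (up p (mob (rep p i) z))⁻¹) := by
  classical
  let f : M2 → ℂ := fun M => fac p z M * if Sc p M then 1 else
        -kap p * (up p z)⁻¹ * (up p (mob M z))⁻¹
  have hup : ∀ x : ℂ, up p x = hm p x - sx p := fun x => by rw [hm]; ring
  have hf : ∀ M ∈ MM p n, ∀ N, LEq p M N → f M = f N := by
    intro M hM N h
    simp only [f, fac_congr hn hz M hM N h, h.sc_iff, hup, h.hm_mob_eq hn hM hz]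
  have hp := prod_perm hn (T := wc p) (fun M hM => wc_mem hM) (fun M hM N hN h => by
    simpa only [wc_wc hM.2, wc_wc hN.2] using h.wc (wc_mem hM).2) hf
  rw [← hp, Fn]
  refine Finset.prod_congr rfl fun i hi => ?_
  have hM := rep_mem hn hi
  simp only [f, fac, sc_wc_iff hM.2]
  split_ifs with h
  · simp
  · have hz' := mob_im_pos (MM.det_pos hn (wc_mem hM)) hz
    rw [mob_Wf hn hM hz, hm_Wf hz, hm_Wf hz']
    have h1 := up_ne_zero p hz
    have h2 := up_ne_zero p hz'
    rw [hm, hm]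
    field_simp
    ring

end FrickeTrace
end

noncomputable section
namespace FrickeTrace
open Filter Topology Asymptotics

/-! ### Expansions at the cusp of products over upper triangular representatives -/

variable {p : ℕ}

/-- The point `(A z + b) / N`. -/
def wp (A N b : ℕ) (z : ℂ) : ℂ := (A * z + b) / N

/-- The nome at `(A z + b) / N`. -/
def yb (A N b : ℕ) (z : ℂ) : ℂ := qc (wp A N b z)

/-- The standard primitive root of unity. -/
def zt (N : ℕ) : ℂ := qc (1 / N)

theorem zt_prim {N : ℕ} (hN : 0 < N) : IsPrimitiveRoot (zt N) N := by
  have h := Complex.isPrimitiveRoot_exp N hN.ne'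
  have e : zt N = Complex.exp (2 * Real.pi * I / N) := by
    rw [zt, qc]; congr 1; ring
  rwa [e]

theorem zt_ne_zero (N : ℕ) : zt N ≠ 0 := qc_ne_zero _

theorem yb_ne_zero (A N b : ℕ) (z : ℂ) : yb A N b z ≠ 0 := qc_ne_zero _

theorem yb_eq (A N b : ℕ) (z : ℂ) : yb A N b z = zt N ^ b * yb A N 0 z := by
  rw [yb, yb, zt, ← qc_nat_mul, ← qc_add]
  congr 1
  simp only [wp]; push_cast; ring

theorem yb_zero_pow {N : ℕ} (hN : 0 < N) (A : ℕ) (z : ℂ) : yb A N 0 z ^ N = qc z ^ A := by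
  have hN' : (N : ℂ) ≠ 0 := by exact_mod_cast hN.ne'
  rw [yb, ← qc_nat_mul, ← qc_nat_mul]
  congr 1
  simp only [wp]; push_cast; field_simp; ring

theorem yb_pow {N : ℕ} (hN : 0 < N) (A b : ℕ) (z : ℂ) : yb A N b z ^ N = qc z ^ A := by
  rw [yb_eq, mul_pow, ← pow_mul, mul_comm b N, pow_mul, (zt_prim hN).pow_eq_one, one_pow, one_mul,
    yb_zero_pow hN]

theorem wp_im (A N b : ℕ) (z : ℂ) : (wp A N b z).im = A * z.im / N := by
  have : wp A N b z = ((A : ℝ) * z + (b : ℝ)) / (N : ℝ) := by simp [wp]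
  rw [this, Complex.div_ofReal_im]; simp

theorem wp_im_pos {A N : ℕ} (hA : 0 < A) (hN : 0 < N) (b : ℕ) {z : ℂ} (hz : 0 < z.im) :
    0 < (wp A N b z).im := by
  rw [wp_im]; positivity

theorem tendsto_wp {A N : ℕ} (hA : 0 < A) (hN : 0 < N) (b : ℕ) :
    Tendsto (wp A N b) cusp cusp := by
  rw [cusp, tendsto_comap_iff]
  have h1 : Tendsto (fun z : ℂ => (A : ℝ) * z.im / N) cusp atTop :=
    (Tendsto.const_mul_atTop (by positivity) tendsto_comap).atTop_div_const (by positivity)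
  exact h1.congr fun z => (wp_im A N b z).symm

theorem tendsto_yb {A N : ℕ} (hA : 0 < A) (hN : 0 < N) (b : ℕ) :
    Tendsto (yb A N b) cusp (𝓝 0) := tendsto_qc_cusp.comp (tendsto_wp hA hN b)

theorem sum_yb_pow {N : ℕ} (hN : 0 < N) (A k : ℕ) (z : ℂ) :
    ∑ b ∈ Finset.range N, yb A N b z ^ k = if N ∣ k then N * yb A N 0 z ^ k else 0 := by
  have h1 : ∀ b, yb A N b z ^ k = (zt N ^ k) ^ b * yb A N 0 z ^ k := fun b => by
    rw [yb_eq, mul_pow, ← pow_mul, ← pow_mul, mul_comm b k]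
  rw [Finset.sum_congr rfl fun b _ => h1 b, ← Finset.sum_mul]
  have hp := zt_prim hN
  split_ifs with h
  · rw [(hp.pow_eq_one_iff_dvd k).2 h]; simp
  · have h2 : zt N ^ k ≠ 1 := mt (hp.pow_eq_one_iff_dvd k).1 h
    rw [geom_sum_eq h2, ← pow_mul, mul_comm k, pow_mul, hp.pow_eq_one]; simp

theorem sum_roots {V : ℂ → ℂ} (hV : AnalyticAt ℂ V 0) (h0 : V 0 = 0) {A N : ℕ} (hA : 0 < A)
    (hN : 0 < N) : (fun z => ∑ b ∈ Finset.range N, V (yb A N b z) - N * tcoef V N * qc z ^ A)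
      =o[cusp] fun z => qc z ^ A := by
  have h1 : ∀ b ∈ Finset.range N, (fun z => V (yb A N b z) -
      ∑ k ∈ Finset.range (N + 1), tcoef V k * yb A N b z ^ k) =o[cusp] fun z => qc z ^ A := by
    intro b _
    have h := (taylor_isBigO hV (N + 1)).comp_tendsto (tendsto_yb hA hN b)
    refine h.trans_isLittleO ?_
    have h2 := ((isLittleO_one_iff ℂ).2 (tendsto_yb hA hN b)).mul_isBigO
      (isBigO_refl (fun z => qc z ^ A) cusp)
    refine h2.congr (fun z => ?_) (fun z => by ring)
    simp only [Function.comp]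
    rw [pow_succ, yb_pow hN, mul_comm]
  have h2 := IsLittleO.sum h1
  refine h2.congr_left fun z => ?_
  rw [Finset.sum_apply, Finset.sum_sub_distrib, Finset.sum_comm]
  congr 1
  simp only [← Finset.mul_sum, sum_yb_pow hN]
  rw [Finset.sum_range_succ, Finset.sum_eq_zero]
  · simp only [dvd_refl, if_true, yb_zero_pow hN]; ring
  · intro k hk
    rw [Finset.mem_range] at hk
    split_ifs with h
    · have : k = 0 := Nat.eq_zero_of_dvd_of_lt h hk
      rw [this, tcoef_zero, h0, zero_mul]
    · rw [mul_zero]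

theorem Ex_prod_one_sub {ι : Type*} (s : Finset ι) {t : ι → ℂ → ℂ} {β : ℂ}
    (ht : ∀ b ∈ s, t b =o[cusp] qc)
    (hs : (fun z => ∑ b ∈ s, t b z - β * qc z ^ 2) =o[cusp] fun z => qc z ^ 2) :
    Ex (fun z => ∏ b ∈ s, (1 - t b z)) 0 (2 * β) := by
  have key : (fun z => ∏ b ∈ s, (1 - t b z) - (1 - ∑ b ∈ s, t b z)) =o[cusp]
      fun z => qc z ^ 2 := by
    clear hs
    classical
    induction s using Finset.induction_on with
    | empty => simp
    | insert a s ha ih =>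
      have h1 := ih fun b hb => ht b (Finset.mem_insert_of_mem hb)
      have h2 := IsLittleO.sum fun b hb => ht b (Finset.mem_insert_of_mem hb)
      have h3 := ht a (Finset.mem_insert_self _ _)
      have h4 : (fun z => 1 - t a z) =O[cusp] fun _ => (1 : ℂ) := by
        have := h3.isBigO.trans_tendsto tendsto_qc_cusp
        exact isBigO_one_of_tendsto (l := 1) (by simpa using this.const_sub 1)
      have h5 := (h3.mul h2).add ((h4.mul_isLittleO h1).congr_right (g₂ := fun z => qc z * qc z)
        fun z => by ring)
      refine h5.congr (fun z => ?_) (fun z => by ring)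
      rw [Finset.prod_insert ha, Finset.sum_insert ha, Finset.sum_apply]; ring
  refine (key.sub hs).congr_left fun z => ?_
  ring

theorem isBigO_div_sub {g : ℂ → ℂ} (hg : AnalyticAt ℂ g 0) {x y : ℂ → ℂ}
    (hx : Tendsto x cusp (𝓝 0)) (hy : Tendsto y cusp (𝓝 0)) :
    (fun z => (g (x z) - g (y z)) / (x z - y z)) =O[cusp] fun _ => (1 : ℂ) := by
  have h := hg.hasStrictDerivAt.hasStrictFDerivAt.isBigO_sub
  obtain ⟨C, hC⟩ := (h.comp_tendsto (nhds_prod_eq (x := (0 : ℂ)) (y := (0 : ℂ)) ▸ hx.prodMk hy)).bound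
  refine IsBigO.of_bound |C| ?_
  filter_upwards [hC] with z hz
  simp only [Function.comp] at hz
  rw [norm_div, norm_one, mul_one]
  exact div_le_of_le_mul₀ (norm_nonneg _) (abs_nonneg _) (hz.trans (by gcongr; exact le_abs_self C))

/-- The relative correction term of `h(z) - h((A z + b)/N)`. -/
def tI (p A N b : ℕ) (z : ℂ) : ℂ := qc z * G0 p (yb A N b z) +
  qc z ^ 2 * (yb A N b z * ((g1 p (qc z) - g1 p (yb A N b z)) / (qc z - yb A N b z)))

theorem hm_sub_hm_wp [Lvl p] (A N b : ℕ) (z : ℂ) : hm p z - hm p (wp A N b z) =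
    (1 / qc z - 1 / yb A N b z) * (1 - tI p A N b z) := by
  rw [hm_eq, hm_eq, tI, G0_eq p (qc z), G0_eq p (yb A N b z), G0_eq p (qc (wp A N b z))]
  change 1 / qc z + _ - (1 / yb A N b z + yb A N b z * g1 p (yb A N b z)) = _
  have h1 := qc_ne_zero z
  have h2 := yb_ne_zero A N b z
  generalize yb A N b z = y at *
  generalize qc z = x at *
  rcases eq_or_ne x y with rfl | h
  · simp
  · have h3 := sub_ne_zero.2 h
    field_simp
    ring

theorem tI_tail [Lvl p] {A N : ℕ} (hA : 0 < A) (hN : 0 < N) (b : ℕ) :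
    (fun z => tI p A N b z - qc z * G0 p (yb A N b z)) =o[cusp] fun z => qc z ^ 2 := by
  have h1 := ((isLittleO_one_iff ℂ).2 (tendsto_yb hA hN b)).mul_isBigO
    (isBigO_div_sub (analyticAt_of_ball (differentiableOn_g1 p)) tendsto_qc_cusp
      (tendsto_yb hA hN b))
  refine ((isBigO_refl (fun z => qc z ^ 2) cusp).mul_isLittleO h1).congr
    (fun z => ?_) (fun z => by ring)
  rw [tI]; ring

theorem tendsto_G0_yb [Lvl p] {A N : ℕ} (hA : 0 < A) (hN : 0 < N) (b : ℕ) :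
    Tendsto (fun z => G0 p (yb A N b z)) cusp (𝓝 0) := by
  have := (analyticAt_of_ball (differentiableOn_G0 p)).continuousAt.tendsto.comp
    (tendsto_yb hA hN b)
  rwa [G0_zero] at this

theorem tI_isLittleO [Lvl p] {A N : ℕ} (hA : 0 < A) (hN : 0 < N) (b : ℕ) :
    tI p A N b =o[cusp] qc := by
  have h1 := (tI_tail (p := p) hA hN b).trans
    ((isLittleO_pow (m := 1) (n := 2) (by norm_num)).congr_right fun z => pow_one _)
  have h2 := (isBigO_refl qc cusp).mul_isLittleO ((isLittleO_one_iff ℂ).2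
    (tendsto_G0_yb (p := p) hA hN b))
  have h3 := h1.add (h2.congr_right (g₂ := qc) fun z => by simp)
  refine h3.congr_left fun z => ?_
  ring

/-- Expansion of the correction factors over a set of shifts. -/
theorem Ex_prod_tI [Lvl p] {A N : ℕ} (hA : 0 < A) (hN : 0 < N) (s : Finset ℕ) {β : ℂ}
    (hs : (fun z => ∑ b ∈ s, G0 p (yb A N b z) - β * qc z) =o[cusp] qc) :
    Ex (fun z => ∏ b ∈ s, (1 - tI p A N b z)) 0 (2 * β) := by
  refine Ex_prod_one_sub s (fun b _ => tI_isLittleO hA hN b) ?_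
  have h1 := IsLittleO.sum fun b (_ : b ∈ s) => tI_tail (p := p) hA hN b
  have h2 := ((isBigO_refl qc cusp).mul_isLittleO hs).congr_right (g₂ := fun z => qc z ^ 2)
    fun z => by ring
  refine (h1.add h2).congr_left fun z => ?_
  rw [Finset.sum_apply, Finset.sum_sub_distrib, ← Finset.mul_sum]; ring

theorem sum_G0 [Lvl p] {A N : ℕ} (hA : 0 < A) (hN : 0 < N) :
    (fun z => ∑ b ∈ Finset.range N, G0 p (yb A N b z) -
      (if A = 1 then N * cf p N else 0) * qc z) =o[cusp] qc := by
  have h := sum_roots (analyticAt_of_ball (differentiableOn_G0 p)) (G0_zero p) hA hN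
  split_ifs with h1
  · subst h1
    refine h.congr (fun z => ?_) (fun z => pow_one _)
    rw [cf, pow_one]
  · have h2 : (fun z => qc z ^ A) =o[cusp] qc :=
      (isLittleO_pow (m := 1) (by omega)).congr_right fun z => pow_one _
    refine ((h.trans h2).add (h2.const_mul_left (N * tcoef (G0 p) N))).congr_left fun z => ?_
    ring

theorem prod_inv_sub {N : ℕ} (hN : 0 < N) (A : ℕ) (z : ℂ) :
    ∏ b ∈ Finset.range N, (1 / qc z - 1 / yb A N b z) = qc z ^ (-(N : ℤ)) - qc z ^ (-(A : ℤ)) := by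
  have h := X_pow_sub_C_eq_prod (zt_prim hN).inv hN (α := (yb A N 0 z)⁻¹) (a := (qc z ^ A)⁻¹)
    (by rw [inv_pow, yb_zero_pow hN])
  have h2 := congrArg (Polynomial.eval (qc z)⁻¹) h
  rw [Polynomial.eval_prod] at h2
  simp only [Polynomial.eval_sub, Polynomial.eval_pow, Polynomial.eval_X, Polynomial.eval_C] at h2
  rw [_root_.zpow_neg, _root_.zpow_neg, zpow_natCast, zpow_natCast, ← inv_pow, h2]
  refine Finset.prod_congr rfl fun b _ => ?_
  rw [yb_eq, one_div, one_div, mul_inv, inv_pow]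

theorem Ex_one_sub_pow {k : ℕ} (hk : 0 < k) : Ex (fun z => 1 - qc z ^ k)
    (if k = 1 then -1 else 0) ((if k = 1 then 1 else 0) + if k = 2 then 2 else 0) := by
  rw [Ex]
  rcases eq_or_ne k 1 with rfl | h1
  · refine (isLittleO_zero _ _).congr_left fun z => ?_
    simp; ring
  rcases eq_or_ne k 2 with rfl | h2
  · refine (isLittleO_zero _ _).congr_left fun z => ?_
    simp; ring
  · refine (isLittleO_pow (m := 2) (n := k) (by omega)).neg_left.congr_left fun z => ?_
    simp [h1, h2]

theorem Asy_inv_pow_sub {A N : ℕ} (h : A < N) : Asy (fun z => qc z ^ (-(N : ℤ)) - qc z ^ (-(A : ℤ)))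
    N ((if N = A + 1 then 1 else 0) + if N = A + 2 then 2 else 0) := by
  have h1 := (Asy_qc_zpow N).mul (Ex_one_sub_pow (k := N - A) (by omega)).asy
  have e1 : (N - A = 1) = (N = A + 1) := by apply propext; omega
  have e2 : (N - A = 2) = (N = A + 2) := by apply propext; omega
  simp only [e1, e2] at h1
  rw [add_zero, zero_add] at h1
  refine h1.congr (Eventually.of_forall fun z => ?_)
  simp only
  have e : (-(A : ℤ)) = -(N : ℤ) + ((N - A : ℕ) : ℤ) := by omega
  rw [e, zpow_add₀ (qc_ne_zero z), zpow_natCast]; ring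

end FrickeTrace
end

noncomputable section
namespace FrickeTrace
open Filter Topology Asymptotics

/-! ### Expansion of the modular polynomial at the cusps -/

variable {p : ℕ}

theorem mob_rep_inl (x : ℕ × ℕ) (b : ℕ) (z : ℂ) :
    mob (rep p (Sum.inl ⟨x, b⟩)) z = wp x.1 x.2 b z := by
  simp [mob, den, rep, wp]

theorem mob_rep_inr [Lvl p] (x : ℕ × ℕ) (hx : x.2 ≠ 0) (b : ℕ) (z : ℂ) :
    mob (rep p (Sum.inr ⟨x, b⟩)) z = Wf p (wp (p * x.1) (p * x.2) b z) := by
  have h1 := Lvl.cast_ne p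
  have h2 : (x.2 : ℂ) ≠ 0 := by exact_mod_cast hx
  simp only [mob, den, rep, wp, Wf]
  simp
  field_simp

theorem sc_rep_inl [Lvl p] {x : ℕ × ℕ} {b : ℕ} (hb : b < x.2) :
    Sc p (rep p (Sum.inl ⟨x, b⟩)) ↔ x.1 = x.2 ∧ b = 0 := by
  constructor
  · rintro ⟨k, γ, hγ, h⟩
    have h00 := congrFun (congrFun h 0) 0
    have h01 := congrFun (congrFun h 0) 1
    have h10 := congrFun (congrFun h 1) 0
    have h11 := congrFun (congrFun h 1) 1
    simp [rep] at h00 h01 h10 h11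
    have hk : k ≠ 0 := by rintro rfl; simp at h00; omega
    have hc : γ 1 0 = 0 := h10.resolve_left hk
    have hd := hγ.det
    rw [Matrix.det_fin_two, hc, mul_zero, sub_zero] at hd
    rcases Int.mul_eq_one_iff_eq_one_or_neg_one.1 hd with ⟨h1, h2⟩ | ⟨h1, h2⟩
    · rw [h1] at h00; rw [h2] at h11
      refine ⟨by omega, Nat.eq_zero_of_dvd_of_lt ?_ hb⟩
      have : (x.2 : ℤ) ∣ b := by rw [h01, h11]; exact ⟨γ 0 1, by ring⟩
      exact_mod_cast this
    · rw [h1] at h00; rw [h2] at h11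
      refine ⟨by omega, Nat.eq_zero_of_dvd_of_lt ?_ hb⟩
      have : (x.2 : ℤ) ∣ b := by rw [h01, h11]; exact ⟨-γ 0 1, by ring⟩
      exact_mod_cast this
  · rintro ⟨h, rfl⟩
    refine ⟨x.1, 1, IsG.one p, ?_⟩
    ext i j
    fin_cases i <;> fin_cases j <;> simp [rep, h]

theorem not_sc_rep_inr [Lvl p] {x : ℕ × ℕ} (hx : x.2 ≠ 0) (b : ℕ) :
    ¬ Sc p (rep p (Sum.inr ⟨x, b⟩)) := by
  rintro ⟨k, γ, hγ, h⟩
  have h00 := congrFun (congrFun h 0) 0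
  have h01 := congrFun (congrFun h 0) 1
  simp [rep] at h00 h01
  have hk : k ≠ 0 := by rintro rfl; simp at h01; exact hx h01
  have hd := hγ.det
  obtain ⟨c, hc⟩ := hγ.dvd
  rw [Matrix.det_fin_two, h00.resolve_left hk, hc, zero_mul, zero_sub] at hd
  have h1 : (p : ℤ) ∣ 1 := ⟨-(γ 0 1 * c), by rw [← hd]; ring⟩
  have h2 := Int.le_of_dvd one_pos h1
  have := Lvl.two_le p
  omega

/-- Order of the pole at `i∞` of the block attached to `(a, d)`. -/
def DI (x : ℕ × ℕ) : ℤ := if x.1 = x.2 then (x.2 : ℤ) - 1 else max x.1 x.2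

/-- Second order term at `i∞` of the block attached to `(a, d)`. -/
def lI (p : ℕ) (x : ℕ × ℕ) : ℂ := (if x.1 = 1 then 2 * (x.2 * cf p x.2) else 0) +
  (if x.1 = x.2 then -2 * c1 p else 0) + ((if x.2 = x.1 + 1 ∨ x.1 = x.2 + 1 then 1 else 0) +
    if x.2 = x.1 + 2 ∨ x.1 = x.2 + 2 then 2 else 0)

theorem prod_block_eq [Lvl p] {x : ℕ × ℕ} (hx : 0 < x.1) {f : ℂ} {k : ℕ → ℂ} (hf : f = 1)
    (F : ℕ → ℂ) (hF : ∀ b < x.2, F b = if x.1 = x.2 ∧ b = 0 then f else k b) :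
    ∏ b ∈ Finset.range x.2, F b =
      ∏ b ∈ if x.1 = x.2 then (Finset.range x.2).erase 0 else Finset.range x.2, k b := by
  split_ifs with h
  · have h0 : 0 ∈ Finset.range x.2 := by simpa [← h] using hx
    rw [← Finset.mul_prod_erase _ _ h0, hF 0 (by omega), if_pos ⟨h, rfl⟩, hf, one_mul]
    refine Finset.prod_congr rfl fun b hb => ?_
    rw [Finset.mem_erase, Finset.mem_range] at hb
    rw [hF b hb.2, if_neg (by tauto)]
  · refine Finset.prod_congr rfl fun b hb => ?_
    rw [hF b (Finset.mem_range.1 hb), if_neg (by tauto)]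

/-- The shifts `b` for which `[a, b; 0, d]` is not scalar. -/
def bs (x : ℕ × ℕ) : Finset ℕ :=
  if x.1 = x.2 then (Finset.range x.2).erase 0 else Finset.range x.2

theorem prod_fac_inl [Lvl p] {x : ℕ × ℕ} (hx : 0 < x.1) (z : ℂ) :
    ∏ b ∈ Finset.range x.2, fac p z (rep p (Sum.inl ⟨x, b⟩)) =
      ∏ b ∈ bs x, (hm p z - hm p (wp x.1 x.2 b z)) := by
  classical
  refine prod_block_eq (p := p) hx rfl _ fun b hb => ?_
  simp only [fac, sc_rep_inl hb, mob_rep_inl]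

theorem Asy_block_inl [Lvl p] {x : ℕ × ℕ} (h1 : 0 < x.1) (h2 : 0 < x.2) :
    Asy (fun z => ∏ b ∈ Finset.range x.2, fac p z (rep p (Sum.inl ⟨x, b⟩))) (DI x) (lI p x) := by
  obtain ⟨a, d⟩ := x
  simp only at h1 h2
  have hs := sum_G0 (p := p) h1 h2
  have key : ∀ {D : ℤ} {l β : ℂ}, Asy (fun z => ∏ b ∈ bs (a, d), (1 / qc z - 1 / yb a d b z)) D l →
      (fun z => ∑ b ∈ bs (a, d), G0 p (yb a d b z) - β * qc z) =o[cusp] qc →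
      Asy (fun z => ∏ b ∈ Finset.range d, fac p z (rep p (Sum.inl ⟨(a, d), b⟩))) (D + 0)
        (l + 2 * β) := by
    intro D l β hA hβ
    refine (hA.mul (Ex_prod_tI h1 h2 _ hβ).asy).congr (Eventually.of_forall fun z => ?_)
    have e := prod_fac_inl (p := p) (x := (a, d)) h1 z
    simp only at e ⊢
    rw [e, ← Finset.prod_mul_distrib]
    exact Finset.prod_congr rfl fun b _ => (hm_sub_hm_wp a d b z).symm
  rcases eq_or_ne a d with rfl | hne
  · have hb : bs (a, a) = (Finset.range a).erase 0 := by simp [bs]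
    have h0 : 0 ∈ Finset.range a := by simpa using h1
    have hy : ∀ z, yb a a 0 z = qc z := fun z => by
      have : (a : ℂ) ≠ 0 := by exact_mod_cast h1.ne'
      rw [yb, wp]; congr 1; push_cast; field_simp; ring
    have hA : Asy (fun z => ∏ b ∈ bs (a, a), (1 / qc z - 1 / yb a a b z)) (a - 1) 0 := by
      have h := Asy.prod (bs (a, a)) (f := fun b z => (1 - (zt a ^ b)⁻¹) * qc z ^ (-1 : ℤ))
        (D := fun _ => 0 + 1) (l := fun _ => 0 + 0) fun b hb' => by
          refine (Asy.const (sub_ne_zero.2 ?_)).mul (Asy_qc_zpow 1)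
          rw [hb, Finset.mem_erase, Finset.mem_range] at hb'
          exact fun h => (zt_prim h1).pow_ne_one_of_pos_of_lt hb'.1 hb'.2 (inv_eq_one.1 h.symm)
      have e : ∑ _b ∈ bs (a, a), ((0 : ℤ) + 1) = a - 1 := by
        simp [hb, Finset.card_erase_of_mem h0]
        omega
      rw [e] at h
      simp only [add_zero, Finset.sum_const_zero] at h
      refine h.congr (Eventually.of_forall fun z => ?_)
      refine Finset.prod_congr rfl fun b _ => ?_
      rw [yb_eq, hy, _root_.zpow_neg_one, one_div, one_div, mul_inv]; ring
    have hβ : (fun z => ∑ b ∈ bs (a, a), G0 p (yb a a b z) -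
        ((if a = 1 then a * cf p a else 0) - c1 p) * qc z) =o[cusp] qc := by
      have h3 : (fun z => G0 p (qc z) - c1 p * qc z) =o[cusp] qc := by
        have hg : Tendsto (fun z => g1 p (qc z) - g1 p 0) cusp (𝓝 0) := by
          have h := (analyticAt_of_ball (differentiableOn_g1 p)).continuousAt.tendsto.comp
            tendsto_qc_cusp
          simpa using h.sub_const (g1 p 0)
        refine (((isLittleO_one_iff ℂ).2 hg).mul_isBigO (isBigO_refl qc cusp)).congr
          (fun z => ?_) (fun z => one_mul _)
        rw [G0_eq, g1_zero]; ring
      refine (hs.sub h3).congr_left fun z => ?_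
      rw [hb, ← Finset.add_sum_erase _ _ h0, hy]; ring
    have := key hA hβ
    have e1 : DI (a, a) = (a : ℤ) - 1 + 0 := by simp [DI]
    have e2 : lI p (a, a) = 0 + 2 * ((if a = 1 then a * cf p a else 0) - c1 p) := by
      have : ∀ k : ℕ, a = a + (k + 1) ↔ False := fun k => ⟨fun h => by omega, False.elim⟩
      have h3 := this 0
      have h4 := this 1
      simp only [zero_add, Nat.reduceAdd] at h3 h4
      simp only [lI, if_true, h3, h4, or_self, if_false]
      split_ifs <;> ring
    rw [e1, e2]; exact this
  · have hb : bs (a, d) = Finset.range d := by simp [bs, hne]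
    have hA : Asy (fun z => ∏ b ∈ bs (a, d), (1 / qc z - 1 / yb a d b z)) (max a d : ℕ)
        ((if d = a + 1 ∨ a = d + 1 then 1 else 0) + if d = a + 2 ∨ a = d + 2 then 2 else 0) := by
      simp only [hb, prod_inv_sub h2]
      rcases lt_or_gt_of_ne hne with h | h
      · have e1 : (d = a + 1 ∨ a = d + 1) = (d = a + 1) := by apply propext; omega
        have e2 : (d = a + 2 ∨ a = d + 2) = (d = a + 2) := by apply propext; omega
        simp only [e1, e2]
        rw [max_eq_right h.le]; exact Asy_inv_pow_sub h
      · have e1 : (d = a + 1 ∨ a = d + 1) = (a = d + 1) := by apply propext; omega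
        have e2 : (d = a + 2 ∨ a = d + 2) = (a = d + 2) := by apply propext; omega
        simp only [e1, e2]
        rw [max_eq_left h.le]
        have := (Asy.const (c := -1) (by norm_num)).mul (Asy_inv_pow_sub h)
        rw [zero_add, zero_add] at this
        exact this.congr (Eventually.of_forall fun z => by simp)
    have := key hA (by rw [hb]; exact hs)
    have e1 : DI (a, d) = (max a d : ℕ) + 0 := by simp [DI, hne]
    have e2 : lI p (a, d) = ((if d = a + 1 ∨ a = d + 1 then 1 else 0) +
        if d = a + 2 ∨ a = d + 2 then 2 else 0) + 2 * (if a = 1 then d * cf p d else 0) := by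
      simp only [lI, if_neg hne]
      split_ifs <;> ring
    rw [e1, e2]; exact this

theorem Asy_block_inr [Lvl p] {x : ℕ × ℕ} (h1 : 0 < x.1) (h2 : 0 < x.2) :
    Asy (fun z => ∏ b ∈ Finset.range (p * x.2), fac p z (rep p (Sum.inr ⟨x, b⟩)))
      (p * x.2 : ℕ) ((p * x.2 : ℕ) * cW p) := by
  have hp := Lvl.pos p
  set A := p * x.1 with hA
  set N := p * x.2 with hN
  have hA0 : 0 < A := by positivity
  have hN0 : 0 < N := by positivity
  have hA2 : 2 ≤ A := (Lvl.two_le p).trans (Nat.le_mul_of_pos_right _ h1)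
  let V : ℂ → ℂ := fun y => y / U0 p y
  have hU := analyticAt_of_ball (differentiableOn_U0 p)
  have hV : AnalyticAt ℂ V 0 := analyticAt_id.div hU (by rw [U0_zero]; exact one_ne_zero)
  have hV0 : V 0 = 0 := by simp [V]
  have hVup : ∀ z, (up p z)⁻¹ = V (qc z) := fun z => by rw [up_eq, inv_div]
  have hVq : (fun z => kap p * V (qc z)) =O[cusp] qc := by
    have h := (taylor_isBigO hV 1).comp_tendsto tendsto_qc_cusp
    refine (h.congr (fun z => ?_) (fun z => ?_)).const_mul_left _
    · simp [tcoef_zero, hV0]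
    · simp
  have hVy : ∀ b, Tendsto (fun z => V (yb A N b z)) cusp (𝓝 0) := fun b => by
    have := hV.continuousAt.tendsto.comp (tendsto_yb hA0 hN0 b)
    rwa [hV0] at this
  have hE := Ex_prod_one_sub (Finset.range N) (t := fun b z => kap p * V (qc z) * V (yb A N b z))
    (β := 0) (fun b _ => (hVq.mul_isLittleO ((isLittleO_one_iff ℂ).2 (hVy b))).congr_right
      fun z => mul_one _) (by
      have h := sum_roots hV hV0 hA0 hN0
      have h3 : (fun z => qc z ^ A) =o[cusp] qc :=
        (isLittleO_pow (m := 1) (by omega)).congr_right fun z => pow_one _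
      have h4 := (h.trans h3).add (h3.const_mul_left (N * tcoef V N))
      refine (hVq.mul_isLittleO h4).congr (fun z => ?_) (fun z => by ring)
      rw [← Finset.mul_sum]; ring)
  have := ((Asy_up (p := p)).pow N).mul hE.asy
  simp only [mul_one, mul_zero, add_zero] at this
  refine this.congr ?_
  filter_upwards [cusp_eventually_im 0] with z hz
  have hc : ∀ (u : ℂ), u ^ N = ∏ _b ∈ Finset.range N, u := fun u => by simp
  rw [hc, ← Finset.prod_mul_distrib]
  refine Finset.prod_congr rfl fun b _ => ?_
  have hw := wp_im_pos hA0 hN0 b hz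
  rw [fac, if_neg (not_sc_rep_inr h2.ne' b), mob_rep_inr x h2.ne', hm_Wf hw]
  have e : V (yb A N b z) = (up p (wp A N b z))⁻¹ := (hVup _).symm
  rw [e, ← hVup, hm]
  have h3 := up_ne_zero p hz
  have h4 := up_ne_zero p hw
  field_simp
  ring

/-- The order of the pole of `Fn` at `i∞`. -/
def DF (p n : ℕ) : ℤ := ∑ x ∈ n.divisorsAntidiagonal, DI x + ∑ x ∈ pDiv p n, ((p * x.2 : ℕ) : ℤ)

theorem pos_of_mem_div {n : ℕ} {x : ℕ × ℕ} (hx : x ∈ n.divisorsAntidiagonal) :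
    0 < x.1 ∧ 0 < x.2 := by
  rw [Nat.mem_divisorsAntidiagonal] at hx
  constructor <;> rw [Nat.pos_iff_ne_zero] <;> rintro h <;> rw [h] at hx <;> simp at hx <;> omega

theorem pos_of_mem_pDiv {n : ℕ} {x : ℕ × ℕ} (hx : x ∈ pDiv p n) : 0 < x.1 ∧ 0 < x.2 := by
  rw [pDiv] at hx
  split_ifs at hx with h
  · exact pos_of_mem_div hx
  · simp at hx

theorem Asy_Fn [Lvl p] (n : ℕ) : Asy (Fn p n) (DF p n)
    (∑ x ∈ n.divisorsAntidiagonal, lI p x + ∑ x ∈ pDiv p n, ((p * x.2 : ℕ) : ℂ) * cW p) := by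
  have h1 := Asy.prod n.divisorsAntidiagonal fun x hx =>
    Asy_block_inl (p := p) (pos_of_mem_div hx).1 (pos_of_mem_div hx).2
  have h2 := Asy.prod (pDiv p n) fun x hx =>
    Asy_block_inr (p := p) (pos_of_mem_pDiv hx).1 (pos_of_mem_pDiv hx).2
  refine (h1.mul h2).congr (Eventually.of_forall fun z => ?_)
  simp only [Fn, ixs, Finset.prod_disjSum, Finset.prod_sigma]

end FrickeTrace
end

noncomputable section
namespace FrickeTrace
open Filter Topology Asymptotics

/-! ### The modular polynomial at the cusp `0` -/

variable {p : ℕ}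

theorem Lead.prod_up [Lvl p] {A N : ℕ} (hA : 0 < A) (hN : 0 < N) :
    Lead (fun z => ∏ b ∈ Finset.range N, up p (wp A N b z)) A := by
  have hC : (∏ b ∈ Finset.range N, zt N ^ b) ≠ 0 :=
    Finset.prod_ne_zero_iff.2 fun b _ => pow_ne_zero _ (zt_ne_zero N)
  refine ⟨(∏ b ∈ Finset.range N, zt N ^ b)⁻¹, inv_ne_zero hC, ?_⟩
  have h1 : Tendsto (fun z => ∏ b ∈ Finset.range N, U0 p (yb A N b z)) cusp (𝓝 1) := by
    have := tendsto_finsetProd (Finset.range N) fun b _ =>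
      (analyticAt_of_ball (differentiableOn_U0 p)).continuousAt.tendsto.comp (tendsto_yb hA hN b)
    simpa [U0_zero] using this
  have h2 := h1.mul_const (∏ b ∈ Finset.range N, zt N ^ b)⁻¹
  rw [one_mul] at h2
  refine h2.congr fun z => ?_
  have h3 : ∏ b ∈ Finset.range N, up p (wp A N b z) =
      (∏ b ∈ Finset.range N, U0 p (yb A N b z)) / ∏ b ∈ Finset.range N, yb A N b z := by
    rw [← Finset.prod_div_distrib]
    exact Finset.prod_congr rfl fun b _ => up_eq p _
  have h4 : ∏ b ∈ Finset.range N, yb A N b z = (∏ b ∈ Finset.range N, zt N ^ b) * qc z ^ A := by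
    rw [Finset.prod_congr rfl fun b _ => yb_eq A N b z, Finset.prod_mul_distrib, Finset.prod_const,
      Finset.card_range, yb_zero_pow hN]
  simp only
  rw [h3, h4, zpow_natCast]
  have := pow_ne_zero A (qc_ne_zero z)
  field_simp

theorem Lead_up [Lvl p] : Lead (up p) 1 := Asy_up.lead

/-- The exponent of the automorphy factor of the block attached to `(a, d)`. -/
def EI (x : ℕ × ℕ) : ℤ := if x.1 = x.2 then 2 * ((x.2 : ℤ) - 1) else x.1 + x.2

open Classical in
/-- The automorphy factor relating `Fn ∘ W` and `Fn`. -/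
def wfac (p : ℕ) (z : ℂ) (M : M2) : ℂ := if Sc p M then 1 else
  -kap p * (up p z)⁻¹ * (up p (mob M z))⁻¹

theorem Lead_wfac_inl [Lvl p] {x : ℕ × ℕ} (h1 : 0 < x.1) (h2 : 0 < x.2) :
    Lead (fun z => ∏ b ∈ Finset.range x.2, wfac p z (rep p (Sum.inl ⟨x, b⟩))) (-EI x) := by
  have hk : -kap p ≠ 0 := neg_ne_zero.2 (kap_ne p)
  have e1 : ∀ z, ∏ b ∈ Finset.range x.2, wfac p z (rep p (Sum.inl ⟨x, b⟩)) =
      ∏ b ∈ bs x, -kap p * (up p z)⁻¹ * (up p (wp x.1 x.2 b z))⁻¹ := fun z => by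
    classical
    refine prod_block_eq (p := p) h1 rfl _ fun b hb => ?_
    simp only [wfac, sc_rep_inl hb, mob_rep_inl]
  have hL : ∀ {e : ℤ}, Lead (fun z => ∏ b ∈ bs x, up p (wp x.1 x.2 b z)) e →
      Lead (fun z => ∏ b ∈ Finset.range x.2, wfac p z (rep p (Sum.inl ⟨x, b⟩)))
        (((bs x).card : ℤ) * (0 + -1) + -e) := by
    intro e he
    refine ((((Lead.const hk).mul (Lead_up (p := p)).inv).pow (bs x).card).mul he.inv).congr
      (Eventually.of_forall fun z => ?_)
    simp only
    rw [e1, Finset.prod_mul_distrib, Finset.prod_const, Finset.prod_inv_distrib]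
  have h := Lead.prod_up (p := p) h1 h2
  by_cases hx : x.1 = x.2
  · have h0 : 0 ∈ Finset.range x.2 := by simpa using h2
    have hb : bs x = (Finset.range x.2).erase 0 := by simp [bs, hx]
    have hy : ∀ z, wp x.1 x.2 0 z = z := fun z => by
      have : (x.2 : ℂ) ≠ 0 := by exact_mod_cast h2.ne'
      rw [wp, hx]; push_cast; field_simp; ring
    have h3 : Lead (fun z => ∏ b ∈ bs x, up p (wp x.1 x.2 b z)) (x.1 + -1) := by
      refine (h.mul (Lead_up (p := p)).inv).congr ?_
      filter_upwards [cusp_eventually_im 0] with z hz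
      rw [hb, ← Finset.mul_prod_erase _ _ h0, hy]
      have := up_ne_zero p hz
      field_simp
    have h4 := hL h3
    have e2 : -EI x = ((bs x).card : ℤ) * (0 + -1) + -(x.1 + -1) := by
      rw [EI, if_pos hx, hb, Finset.card_erase_of_mem h0, Finset.card_range, hx]
      push_cast [h2]; ring
    rwa [e2]
  · have hb : bs x = Finset.range x.2 := by simp [bs, hx]
    rw [← hb] at h
    have h4 := hL h
    have e2 : -EI x = ((bs x).card : ℤ) * (0 + -1) + -x.1 := by
      rw [EI, if_neg hx, hb, Finset.card_range]; ring
    rwa [e2]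

theorem Lead_wfac_inr [Lvl p] {x : ℕ × ℕ} (h1 : 0 < x.1) (h2 : 0 < x.2) :
    Lead (fun z => ∏ b ∈ Finset.range (p * x.2), wfac p z (rep p (Sum.inr ⟨x, b⟩)))
      ((p * x.1 : ℕ) - (p * x.2 : ℕ)) := by
  have hp := Lvl.pos p
  have hA0 : 0 < p * x.1 := by positivity
  have hN0 : 0 < p * x.2 := by positivity
  have h := (((Lead.const (c := -1) (by norm_num)).mul (Lead_up (p := p)).inv).pow (p * x.2)).mul
    (Lead.prod_up (p := p) hA0 hN0)
  have e : ((p * x.1 : ℕ) : ℤ) - (p * x.2 : ℕ) = ((p * x.2 : ℕ) : ℤ) * (0 + -1) + (p * x.1 : ℕ) := by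
    ring
  rw [e]
  refine h.congr ?_
  filter_upwards [cusp_eventually_im 0] with z hz
  have hc : ∀ (u : ℂ), u ^ (p * x.2) = ∏ _b ∈ Finset.range (p * x.2), u := fun u => by simp
  rw [hc, ← Finset.prod_mul_distrib]
  refine Finset.prod_congr rfl fun b _ => ?_
  have hw := wp_im_pos hA0 hN0 b hz
  rw [wfac, if_neg (not_sc_rep_inr h2.ne' b), mob_rep_inr x h2.ne', up_Wf p hw]
  have h3 := up_ne_zero p hz
  have h4 := up_ne_zero p hw
  have h5 := kap_ne p
  field_simp

/-- The sum of the exponents of `Fn` at the two cusps. -/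
def EF (p n : ℕ) : ℤ := ∑ x ∈ n.divisorsAntidiagonal, EI x +
  ∑ x ∈ pDiv p n, (((p * x.2 : ℕ) : ℤ) - (p * x.1 : ℕ))

theorem Lead_Fn_Wf [Lvl p] {n : ℕ} (hn : 0 < n) :
    Lead (fun z => Fn p n (Wf p z)) (-(EF p n - DF p n)) := by
  have h1 := Lead.prod n.divisorsAntidiagonal fun x hx =>
    Lead_wfac_inl (p := p) (pos_of_mem_div hx).1 (pos_of_mem_div hx).2
  have h2 := Lead.prod (pDiv p n) fun x hx =>
    Lead_wfac_inr (p := p) (pos_of_mem_pDiv hx).1 (pos_of_mem_pDiv hx).2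
  have e : -(EF p n - DF p n) = DF p n + (∑ x ∈ n.divisorsAntidiagonal, -EI x +
      ∑ x ∈ pDiv p n, (((p * x.1 : ℕ) : ℤ) - (p * x.2 : ℕ))) := by
    rw [EF, Finset.sum_neg_distrib, Finset.sum_sub_distrib, Finset.sum_sub_distrib]; ring
  rw [e]
  refine ((Asy_Fn (p := p) n).lead.mul (h1.mul h2)).congr ?_
  filter_upwards [cusp_eventually_im 0] with z hz
  rw [Fn_Wf hn hz, Finset.prod_mul_distrib]
  congr 1
  simp only [ixs, Finset.prod_disjSum, Finset.prod_sigma]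
  rfl

theorem sum_swap_div (n : ℕ) (f : ℕ × ℕ → ℤ) :
    ∑ x ∈ n.divisorsAntidiagonal, f x.swap = ∑ x ∈ n.divisorsAntidiagonal, f x := by
  conv_rhs => rw [← Nat.map_swap_divisorsAntidiagonal]
  rw [Finset.sum_map]; rfl

theorem sum_snd_div (n : ℕ) : ∑ x ∈ n.divisorsAntidiagonal, (x.2 : ℤ) = ∑ d ∈ n.divisors, (d : ℤ) :=
  Nat.sum_divisorsAntidiagonal' (f := fun _ d => (d : ℤ))

theorem EF_eq [Lvl p] (n : ℕ) : EF p n = 2 * ∑ d ∈ n.divisors, (d : ℤ) -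
    2 * ∑ x ∈ n.divisorsAntidiagonal, if x.1 = x.2 then 1 else 0 := by
  have h1 : ∑ x ∈ pDiv p n, (((p * x.2 : ℕ) : ℤ) - (p * x.1 : ℕ)) = 0 := by
    rw [Finset.sum_sub_distrib, sub_eq_zero, pDiv]
    split_ifs
    · exact sum_swap_div _ fun x => ((p * x.1 : ℕ) : ℤ)
    · simp
  have h2 : ∀ x : ℕ × ℕ, EI x = x.1 + x.2 - 2 * if x.1 = x.2 then 1 else 0 := fun x => by
    rw [EI]; split_ifs with h
    · rw [h]; ring
    · ring
  rw [EF, h1, add_zero, Finset.sum_congr rfl fun x _ => h2 x, Finset.sum_sub_distrib,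
    Finset.sum_add_distrib, ← Finset.mul_sum]
  have h3 := sum_swap_div n fun x => (x.2 : ℤ)
  simp only [Prod.snd_swap] at h3
  rw [h3, sum_snd_div]; ring

end FrickeTrace
end

noncomputable section
namespace FrickeTrace
open Filter Topology Asymptotics
variable {p : ℕ}

/-- The discriminant form. -/
def dl (z : ℂ) : ℂ := dedekindEta z ^ 24

theorem dl_ne_zero {z : ℂ} (hz : 0 < z.im) : dl z ≠ 0 := pow_ne_zero _ (dedekindEta_ne_zero hz)

theorem dl_eq (z : ℂ) : dl z = qc z * eul (qc z) ^ 24 := by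
  rw [dl, dedekindEta_eq, mul_pow, ← Complex.exp_nat_mul, qc]
  congr 2; push_cast; ring

theorem dl_neg_inv {z : ℂ} (hz : 0 < z.im) : dl (-1 / z) = z ^ 12 * dl z := by
  have h := delta_mob (M := !![0, -1; 1, 0]) (by simp) hz
  simp only [mob, den] at h
  simpa [dl] using h

theorem differentiableAt_dl {z : ℂ} (hz : 0 < z.im) : DifferentiableAt ℂ dl z := by
  have : dl = fun z => qc z * eul (qc z) ^ 24 := funext dl_eq
  rw [this]
  refine (differentiable_qc z).mul (DifferentiableAt.pow ?_ _)
  refine DifferentiableAt.comp (g := eul) z ?_ (differentiable_qc z)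
  exact differentiableOn_eul.differentiableAt
    (Metric.isOpen_ball.mem_nhds (by simpa using norm_qc_lt_one hz))

theorem hm_deriv_mob [Lvl p] {M : M2} (hM : IsG p M) {z : ℂ} (hz : 0 < z.im) :
    deriv (hm p) (mob M z) = den M z ^ 2 * deriv (hm p) z := by
  have hd := den_ne_zero hM.det_pos hz
  have h1 := ((differentiableAt_hm p (mob_im_pos hM.det_pos hz)).hasDerivAt.comp z
    (hasDerivAt_mob hM.det_pos hz))
  have h2 : (hm p ∘ mob M) =ᶠ[𝓝 z] hm p := by
    filter_upwards [isOpen_uhp.mem_nhds hz] with w hw using hm_mob hM hw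
  have h3 := h1.unique ((differentiableAt_hm p hz).hasDerivAt.congr_of_eventuallyEq h2)
  rw [← h3, hM.det]; field_simp; simp

theorem hm_deriv_Wf [Lvl p] {z : ℂ} (hz : 0 < z.im) :
    deriv (hm p) (Wf p z) = -kap p * p * z ^ 2 * deriv (hm p) z / up p z ^ 2 := by
  have hp0 := Lvl.cast_ne p
  have hz0 := ne_zero_of_im_pos hz
  have hu := up_ne_zero p hz
  have hW : HasDerivAt (Wf p) (1 / (p * z ^ 2)) z := by
    have h := (((hasDerivAt_id z).const_mul (p : ℂ)).inv (mul_ne_zero hp0 hz0)).const_mul (-1)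
    have e : (1 / (p * z ^ 2) : ℂ) = -1 * (-(p * 1) / (p * id z) ^ 2) := by
      simp only [id]; field_simp
    rw [e]
    exact h.congr_of_eventuallyEq (Eventually.of_forall fun w => by simp [Wf, div_eq_mul_inv])
  have h1 := ((differentiableAt_hm p (Wf_im_pos p hz)).hasDerivAt.comp z hW)
  have hup : HasDerivAt (up p) (deriv (hm p) z) z := by
    have h := (differentiableAt_hm p hz).hasDerivAt.sub_const (sx p : ℂ)
    exact h.congr_of_eventuallyEq (Eventually.of_forall fun w => by simp [hm])
  have h2 := ((hup.inv hu).const_mul (kap p)).const_add (sx p : ℂ)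
  have h3 : (hm p ∘ Wf p) =ᶠ[𝓝 z] fun w => (sx p : ℂ) + kap p * (up p w)⁻¹ := by
    filter_upwards [isOpen_uhp.mem_nhds hz] with w hw
    rw [Function.comp, hm_Wf hw, div_eq_mul_inv]
  have h4 := h1.unique (h2.congr_of_eventuallyEq h3)
  field_simp at h4 ⊢
  linear_combination h4

/-- The modular function `h'^12 / (Δ(z) Δ(pz))`, whose zeros are the elliptic points. -/
def gell (p : ℕ) (z : ℂ) : ℂ := deriv (hm p) z ^ 12 / (dl z * dl (p * z))

theorem Hol_gell [Lvl p] : Hol (gell p) := fun z hz => by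
  refine DifferentiableAt.div (DifferentiableAt.pow ?_ _) ?_
    (mul_ne_zero (dl_ne_zero hz) (dl_ne_zero (im_mul_pos p hz)))
  · exact (analyticAt_hm hz).deriv.differentiableAt
  · exact (differentiableAt_dl hz).mul (DifferentiableAt.comp (g := dl) z
      (differentiableAt_dl (im_mul_pos p hz)) (by fun_prop))

theorem Inv_gell [Lvl p] : Inv p (gell p) := fun M hM z hz => by
  obtain ⟨c, hc⟩ := hM.dvd
  obtain ⟨h1, h2⟩ := mul_mob p hc z
  have hd : Matrix.det !![M 0 0, p * M 0 1; c, M 1 1] = 1 := by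
    have := hM.det
    rw [Matrix.det_fin_two, hc] at this
    rw [Matrix.det_fin_two_of]; linear_combination this
  have h3 := den_ne_zero hM.det_pos hz
  rw [gell, gell, hm_deriv_mob hM hz, h1, dl, dl, delta_mob hM.det hz,
    delta_mob hd (im_mul_pos p hz), h2, dl, dl]
  have h4 := dedekindEta_ne_zero hz
  have h5 := dedekindEta_ne_zero (im_mul_pos p hz)
  field_simp

theorem gell_Wf [Lvl p] {z : ℂ} (hz : 0 < z.im) :
    gell p (Wf p z) = kap p ^ 12 * (gell p z * (up p z ^ 24)⁻¹) := by
  have hp0 := Lvl.cast_ne p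
  have hz0 := ne_zero_of_im_pos hz
  have hu := up_ne_zero p hz
  have e2 : (p : ℂ) * Wf p z = -1 / z := by rw [Wf]; field_simp
  have h1 := dl_ne_zero hz
  have h2 := dl_ne_zero (im_mul_pos p hz)
  rw [gell, hm_deriv_Wf hz, e2, dl_neg_inv hz, Wf, dl_neg_inv (im_mul_pos p hz), gell]
  field_simp

theorem hm_deriv_eq [Lvl p] {z : ℂ} (hz : 0 < z.im) :
    deriv (hm p) z = 2 * Real.pi * I * (-(qc z)⁻¹ + qc z * deriv (G0 p) (qc z)) := by
  have hq := qc_ne_zero z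
  have hG : DifferentiableAt ℂ (G0 p) (qc z) := (differentiableOn_G0 p).differentiableAt
    (Metric.isOpen_ball.mem_nhds (by simpa using norm_qc_lt_one hz))
  have h := ((hasDerivAt_qc z).inv hq).add (hG.hasDerivAt.comp z (hasDerivAt_qc z))
  have h2 := h.congr_of_eventuallyEq (f₁ := hm p) (Eventually.of_forall fun w => by
    rw [hm_eq]; simp)
  rw [h2.deriv]; field_simp

theorem Asy_hm_deriv [Lvl p] : Asy (deriv (hm p)) 1 (2 * c1 p) := by
  have hA := analyticAt_of_ball (differentiableOn_G0 p)
  have h0 : deriv (G0 p) 0 = c1 p := by rw [← tcoef_one, ← cf_one]; rfl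
  have ht : Tendsto (fun z => deriv (G0 p) (qc z) - c1 p) cusp (𝓝 0) := by
    have h := hA.deriv.continuousAt.tendsto.comp tendsto_qc_cusp
    rw [h0] at h
    simpa using h.sub_const (c1 p)
  refine ⟨-(2 * Real.pi * I), neg_ne_zero.2 Complex.two_pi_I_ne_zero, 0, ?_⟩
  have h1 := ((isLittleO_one_iff ℂ).2 ht).mul_isBigO (isBigO_refl (fun z => qc z ^ 2) cusp)
  refine IsLittleO.congr' h1.neg_left ?_ (Eventually.of_forall fun z => by simp)
  filter_upwards [cusp_eventually_im 0] with z hz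
  have hq := qc_ne_zero z
  have hpi := Complex.two_pi_I_ne_zero
  rw [hm_deriv_eq hz, zpow_one, mul_assoc, neg_mul_eq_neg_mul, div_neg, mul_div_cancel_left₀ _ hpi]
  field_simp; ring

theorem Asy_gell [Lvl p] : Asy (gell p) (13 + p) (24 * c1 p - 72 - if p = 2 then 48 else 0) := by
  have h := ((Asy_hm_deriv (p := p)).pow 12).mul
    (((Asy_qc_zpow (1 + p)).mul (((Ex_eul.pow 24).mul ((Ex_eul_pow (p := p)).pow 24)).inv.asy)))
  have h2 := h.congr (g := gell p) (Eventually.of_forall fun z => ?_)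
  · convert h2 using 1
    · push_cast; ring
    · split_ifs <;> push_cast <;> ring
  · simp only [gell, dl_eq, qc_nat_mul]
    rw [_root_.zpow_neg, zpow_add₀ (qc_ne_zero z), zpow_one, zpow_natCast, div_eq_mul_inv,
      ← mul_inv]
    congr 2; ring

theorem Lead_gell_Wf [Lvl p] : Lead (fun z => gell p (Wf p z)) (-(11 - p)) := by
  have h := (Lead.const (pow_ne_zero 12 (kap_ne p))).mul
    ((Asy_gell (p := p)).lead.mul ((Lead_up (p := p)).pow 24).inv)
  have h2 := h.congr (g := fun z => gell p (Wf p z)) ?_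
  · convert h2 using 1; push_cast; ring
  · filter_upwards [cusp_eventually_im 0] with z hz
    rw [gell_Wf hz]

theorem order_gell [Lvl p] {z₀ : ℂ} (hz : 0 < z₀.im) :
    analyticOrderAt (gell p) z₀ + 12 = 12 * ram p z₀ := by
  have h1 := (analyticAt_hm (p := p) hz).analyticOrderAt_deriv_add_one
  rw [ram_eq hz] at h1
  have hA := (analyticAt_hm (p := p) hz).deriv
  have hdl : AnalyticAt ℂ (fun z => dl z * dl (p * z)) z₀ := by
    refine DifferentiableOn.analyticAt (s := {z : ℂ | 0 < z.im}) (fun z hz => ?_)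
      (isOpen_uhp.mem_nhds hz)
    exact ((differentiableAt_dl hz).mul (DifferentiableAt.comp (g := dl) z
      (differentiableAt_dl (im_mul_pos p hz)) (by fun_prop))).differentiableWithinAt
  have hne : dl z₀ * dl (p * z₀) ≠ 0 :=
    mul_ne_zero (dl_ne_zero hz) (dl_ne_zero (im_mul_pos p hz))
  have h2 : gell p = deriv (hm p) ^ 12 * (fun z => dl z * dl (p * z))⁻¹ := by
    ext z; simp [gell, div_eq_mul_inv]
  rw [h2, analyticOrderAt_mul (hA.pow 12) (hdl.inv hne), analyticOrderAt_pow hA,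
    (hdl.inv hne).analyticOrderAt_eq_zero.2 (inv_ne_zero hne), add_zero, ← h1, nsmul_eq_mul,
    mul_add, mul_one]
  rfl

end FrickeTrace
end

noncomputable section
namespace FrickeTrace
open Filter Topology Asymptotics
variable {p : ℕ}

/-- The number of factorizations `n = a d` with `a = d`. -/
def sq (n : ℕ) : ℤ := ∑ x ∈ n.divisorsAntidiagonal, if x.1 = x.2 then 1 else 0

/-- The contribution of the factorizations `n = a d` with `|a - d| ∈ {1, 2}`. -/
def bt (n : ℕ) : ℂ := ∑ x ∈ n.divisorsAntidiagonal,
  ((if x.2 = x.1 + 1 ∨ x.1 = x.2 + 1 then 1 else 0) + if x.2 = x.1 + 2 ∨ x.1 = x.2 + 2 then 2 else 0)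

theorem sq_eq {n : ℕ} (hn : 0 < n) : sq n = if IsSquare n then 1 else 0 := by
  split_ifs with h
  · obtain ⟨k, rfl⟩ := h
    rw [sq, Finset.sum_eq_single (k, k)]
    · simp
    · rintro ⟨a, b⟩ hx hne
      rw [Nat.mem_divisorsAntidiagonal] at hx
      refine if_neg fun h => hne ?_
      have h : a = b := h
      subst h
      have : a = k := Nat.mul_self_inj.1 hx.1
      rw [this]
    · intro h; simp [Nat.mem_divisorsAntidiagonal] at h; simp [h] at hn
  · refine Finset.sum_eq_zero fun x hx => if_neg fun hx' => h ⟨x.1, ?_⟩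
    rw [Nat.mem_divisorsAntidiagonal] at hx
    rw [← hx.1]
    exact congrArg _ hx'.symm

theorem sum_lI [Lvl p] {n : ℕ} (hn : 0 < n) : ∑ x ∈ n.divisorsAntidiagonal, lI p x =
    2 * (n * cf p n) - 2 * c1 p * sq n + bt n := by
  simp only [lI, Finset.sum_add_distrib, sq, bt]
  push_cast
  have h1 : ∑ x ∈ n.divisorsAntidiagonal, (if x.1 = 1 then 2 * ((x.2 : ℂ) * cf p x.2) else 0) =
      2 * (n * cf p n) := by
    rw [Finset.sum_eq_single (1, n)]
    · simp
    · rintro ⟨a, b⟩ hx hne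
      rw [Nat.mem_divisorsAntidiagonal] at hx
      refine if_neg fun h => hne ?_
      have h : a = 1 := h
      subst h
      simp at hx; simp [hx]
    · intro h; simp [Nat.mem_divisorsAntidiagonal] at h; omega
  have h2 : ∑ x ∈ n.divisorsAntidiagonal, (if x.1 = x.2 then -2 * c1 p else 0) =
      - 2 * c1 p * ∑ x ∈ n.divisorsAntidiagonal, (if x.1 = x.2 then (1 : ℂ) else 0) := by
    rw [Finset.mul_sum]
    exact Finset.sum_congr rfl fun x _ => by split_ifs <;> simp
  rw [h1, h2]; ring

/-- The modular function whose zeros are the CM points of discriminants `r² - 4n`. -/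
def gn (p n : ℕ) (z : ℂ) : ℂ := Fn p n z ^ 12 * if IsSquare n then gell p z else 1

theorem exists_poly_gn [Lvl p] {n : ℕ} (hn : 0 < n) :
    ∃ (R : Polynomial ℂ) (e : ℤ), R ≠ 0 ∧ R.eval (sx p : ℂ) ≠ 0 ∧
      (∀ z : ℂ, 0 < z.im → gn p n z = R.eval (hm p z) * up p z ^ e) ∧
      (R.roots.map fun x => F2 p x - cW p / 2).sum = 12 * (2 * (n * cf p n) -
        cW p * (∑ d ∈ n.divisors, (d : ℂ) - ∑ x ∈ pDiv p n, ((p * x.2 : ℕ) : ℂ)) + bt n -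
        sq n * (6 + if p = 2 then 4 else 0)) := by
  have hEF := EF_eq (p := p) n
  rw [show (∑ x ∈ n.divisorsAntidiagonal, if x.1 = x.2 then (1 : ℤ) else 0) = sq n from rfl] at hEF
  have hA := (Asy_Fn (p := p) n).pow 12
  have hL := (Lead_Fn_Wf (p := p) hn).pow 12
  have hH : Hol (fun z => Fn p n z ^ 12) := fun z hz => (Hol_Fn hn z hz).pow 12
  have hI : Inv p (fun z => Fn p n z ^ 12) := fun M hM z hz => by
    simp only; rw [Inv_Fn hn M hM z hz]
  rw [sum_lI hn] at hA
  have hEc : (EF p n : ℂ) = 2 * ∑ d ∈ n.divisors, (d : ℂ) - 2 * sq n := by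
    rw [hEF]; push_cast; ring
  have hs := sq_eq hn
  have hcW : ∑ x ∈ pDiv p n, ((p * x.2 : ℕ) : ℂ) * cW p =
    cW p * ∑ x ∈ pDiv p n, ((p * x.2 : ℕ) : ℂ) := by rw [← Finset.sum_mul, mul_comm]
  rw [hcW] at hA
  by_cases hsq : IsSquare n
  · rw [if_pos hsq] at hs
    have e1 : (fun z => Fn p n z ^ 12 * gell p z) = gn p n := by
      ext z; rw [gn, if_pos hsq]
    have hl := hL.mul (Lead_gell_Wf (p := p))
    have hl' : Lead (fun z => gn p n (Wf p z)) (-(12 * (EF p n - DF p n) + (11 - p))) := by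
      rw [← e1]; convert hl using 1; push_cast; ring
    have ha := hA.mul (Asy_gell (p := p))
    rw [e1] at ha
    have hh : Hol (gn p n) := by rw [← e1]; exact fun z hz => (hH z hz).mul (Hol_gell z hz)
    have hi : Inv p (gn p n) := by
      rw [← e1]; intro M hM z hz
      have := hI M hM z hz; simp only at this ⊢; rw [this, Inv_gell M hM z hz]
    obtain ⟨R, h1, h2, h3, h4⟩ := exists_poly_of_asy hh hi ha hl'
    refine ⟨R, _, h1, h2, h3, h4.trans ?_⟩
    push_cast
    rw [hEc, hs]; push_cast; split_ifs <;> ring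
  · rw [if_neg hsq] at hs
    have e1 : (fun z => Fn p n z ^ 12) = gn p n := by
      ext z; rw [gn, if_neg hsq, mul_one]
    have hl' : Lead (fun z => gn p n (Wf p z)) (-(12 * (EF p n - DF p n))) := by
      rw [← e1]; convert hL using 1; push_cast; ring
    rw [e1] at hA hH hI
    obtain ⟨R, h1, h2, h3, h4⟩ := exists_poly_of_asy hH hI hA hl'
    refine ⟨R, _, h1, h2, h3, h4.trans ?_⟩
    push_cast
    rw [hEc, hs]; push_cast; ring

theorem exists_hm_eq [Lvl p] {x : ℂ} (hx : x ≠ sx p) : ∃ z : ℂ, 0 < z.im ∧ hm p z = x := by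
  by_contra! hne
  have hne' : ∀ z : ℂ, 0 < z.im → hm p z - x ≠ 0 := fun z hz => sub_ne_zero.2 (hne z hz)
  have ht1 : Tendsto (fun z => (hm p z - x)⁻¹) cusp (𝓝 0) := by
    obtain ⟨C, hC, h⟩ := (Asy_hm_sub (p := p) x).lead.inv
    have h2 := h.mul tendsto_qc_cusp
    rw [mul_zero] at h2
    refine h2.congr fun z => ?_
    have := qc_ne_zero z
    simp only [_root_.zpow_neg, zpow_one]; field_simp
  have ht2 : Tendsto (fun z => (hm p (Wf p z) - x)⁻¹) cusp (𝓝 (sx p - x)⁻¹) :=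
    (tendsto_hm_Wf.sub_const x).inv₀ (sub_ne_zero.2 hx.symm)
  obtain ⟨c, hc⟩ := liouville (p := p) (f := fun z => (hm p z - x)⁻¹)
    (fun z hz => ((differentiableAt_hm p hz).sub_const x).inv (hne' z hz))
    (fun M hM z hz => by simp only; rw [hm_mob hM hz]) (BddC.of_tendsto ht1) (BddC.of_tendsto ht2)
  have h0 : c = 0 := tendsto_nhds_unique
    ((tendsto_const_nhds (x := c)).congr' (by
      filter_upwards [cusp_eventually_im 0] with z hz; rw [← hc z hz])) ht1
  have := hc I (by simp)
  rw [h0] at this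
  exact inv_ne_zero (hne' I (by simp)) this

theorem order_eval_hm [Lvl p] {R : Polynomial ℂ} (hR : R ≠ 0) {z₀ : ℂ} (hz : 0 < z₀.im) :
    analyticOrderAt (fun z => R.eval (hm p z)) z₀ = (R.rootMultiplicity (hm p z₀) * ram p z₀ : ℕ) := by
  obtain ⟨S, hS, hS0⟩ := Polynomial.exists_eq_pow_rootMultiplicity_mul_and_not_dvd R hR (hm p z₀)
  rw [Polynomial.dvd_iff_isRoot, Polynomial.IsRoot.def] at hS0
  have hA := analyticAt_hm (p := p) hz
  have hSA : AnalyticAt ℂ (fun z => S.eval (hm p z)) z₀ := by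
    have := hA.aeval_polynomial S
    simpa using this
  have e : (fun z => R.eval (hm p z)) = (fun z => hm p z - hm p z₀) ^
      (R.rootMultiplicity (hm p z₀)) * fun z => S.eval (hm p z) := by
    ext z
    conv_lhs => rw [hS]
    simp
  rw [e, analyticOrderAt_mul ((analyticAt_hm_sub hz _).pow _) hSA,
    analyticOrderAt_pow (analyticAt_hm_sub hz _), ram_eq hz,
    hSA.analyticOrderAt_eq_zero.2 hS0, add_zero, nsmul_eq_mul]
  push_cast; rfl

theorem order_gn [Lvl p] {n : ℕ} {R : Polynomial ℂ} {e : ℤ} (hR : R ≠ 0)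
    (h : ∀ z : ℂ, 0 < z.im → gn p n z = R.eval (hm p z) * up p z ^ e) {z₀ : ℂ} (hz : 0 < z₀.im) :
    analyticOrderAt (gn p n) z₀ = (R.rootMultiplicity (hm p z₀) * ram p z₀ : ℕ) := by
  have h1 : gn p n =ᶠ[𝓝 z₀] (fun z => R.eval (hm p z)) * fun z => up p z ^ e := by
    filter_upwards [isOpen_uhp.mem_nhds hz] with z hz using h z hz
  have hu : AnalyticAt ℂ (up p) z₀ := DifferentiableOn.analyticAt (s := {z : ℂ | 0 < z.im})
    (fun z hz => (differentiableAt_up p hz).differentiableWithinAt) (isOpen_uhp.mem_nhds hz)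
  have hue := hu.fun_zpow (n := e) (up_ne_zero p hz)
  have hA : AnalyticAt ℂ (fun z => R.eval (hm p z)) z₀ := by
    have := (analyticAt_hm (p := p) hz).aeval_polynomial R
    simpa using this
  rw [analyticOrderAt_congr h1, analyticOrderAt_mul hA hue, order_eval_hm hR hz,
    hue.analyticOrderAt_eq_zero.2 (zpow_ne_zero _ (up_ne_zero p hz)), add_zero]

end FrickeTrace
end

noncomputable section
namespace FrickeTrace
open Filter Topology Asymptotics
variable {p : ℕ}

/-- The matrices of determinant `n` fixing a point. -/
def Fx (p n : ℕ) (z : ℂ) : Set M2 := {N | N ∈ MM p n ∧ mob N z = z}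

/-- The number of matrices of determinant `n` fixing a point, up to sign and up to scalars. -/
def nu (p n : ℕ) (z : ℂ) : ℕ := Set.ncard {N | N ∈ Fx p n z ∧ 0 < N 1 0}

theorem finite_Fx {n : ℕ} (hn : 0 < n) {z : ℂ} (hz : 0 < z.im) : (Fx p n z).Finite := by
  obtain ⟨S, hS, h⟩ := finite_near (n : ℤ) (by exact_mod_cast hn) hz hz
  rw [← nhds_prod_eq] at h
  exact hS.subset fun N hN => h.self_of_nhds N hN.1.1 hN.2

theorem mul_right_cancel_of_det {A B N : M2} (hN : N.det ≠ 0) (h : A * N = B * N) : A = B := by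
  have h1 := congrArg (· * N.adjugate) h
  simp only [mul_assoc, Matrix.mul_adjugate, Matrix.mul_smul, mul_one] at h1
  exact smul_right_injective _ hN h1

open Classical in
/-- The classes of determinant `n` with a representative fixing `z`. -/
def fixIx (p n : ℕ) (z : ℂ) : Finset Ix :=
  (ixs p n).filter fun i => ¬ Sc p (rep p i) ∧ Eqv p (mob (rep p i) z) z

theorem analyticAt_of_Hol {f : ℂ → ℂ} (hf : Hol f) {z : ℂ} (hz : 0 < z.im) : AnalyticAt ℂ f z :=
  DifferentiableOn.analyticAt (s := {z : ℂ | 0 < z.im})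
    (fun w hw => (hf w hw).differentiableWithinAt) (isOpen_uhp.mem_nhds hz)

theorem order_fac [Lvl p] {n : ℕ} (hn : 0 < n) {z₀ : ℂ} (hz : 0 < z₀.im) {M : M2}
    (hM : M ∈ MM p n) (hs : ¬ Sc p M) (he : Eqv p (mob M z₀) z₀) :
    analyticOrderAt (fun z => fac p z M) z₀ = ram p z₀ := by
  obtain ⟨γ, hγ, hγz⟩ := he
  have hl : LEq p M (γ * M) := ⟨γ, hγ, rfl⟩
  have hs' : ¬ Sc p (γ * M) := mt hl.sc_iff.2 hs
  rw [← order_sub_comp hz (MM.det_pos hn (hl.mem hM)) (by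
    rw [mob_mul hγ.det_pos (MM.det_pos hn hM) hz, hγz]) hs']
  refine analyticOrderAt_congr ?_
  filter_upwards [isOpen_uhp.mem_nhds hz] with z hz
  rw [fac_congr hn hz M hM _ hl, fac, if_neg hs']

theorem order_fac_eq_zero [Lvl p] {n : ℕ} (hn : 0 < n) {z₀ : ℂ} (hz : 0 < z₀.im) {M : M2}
    (hM : M ∈ MM p n) (h : ¬ (¬ Sc p M ∧ Eqv p (mob M z₀) z₀)) :
    analyticOrderAt (fun z => fac p z M) z₀ = 0 := by
  rw [(analyticAt_of_Hol (Hol_fac (MM.det_pos hn hM)) hz).analyticOrderAt_eq_zero]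
  by_cases hs : Sc p M
  · simp [fac, hs]
  · rw [fac, if_neg hs, sub_ne_zero]
    exact fun he => h ⟨hs, Eqv_of_hm_eq (mob_im_pos (MM.det_pos hn hM) hz) hz he.symm⟩

theorem order_Fn [Lvl p] {n : ℕ} (hn : 0 < n) {z₀ : ℂ} (hz : 0 < z₀.im) :
    analyticOrderAt (Fn p n) z₀ = ((fixIx p n z₀).card * ram p z₀ : ℕ) := by
  classical
  have h1 : ∀ s : Finset Ix, s ⊆ ixs p n →
      analyticOrderAt (fun z => ∏ i ∈ s, fac p z (rep p i)) z₀ =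
      ∑ i ∈ s, if ¬ Sc p (rep p i) ∧ Eqv p (mob (rep p i) z₀) z₀ then (ram p z₀ : ℕ∞) else 0 := by
    intro s
    induction s using Finset.induction_on with
    | empty =>
      intro _
      simp only [Finset.prod_empty, Finset.sum_empty]
      exact analyticAt_const.analyticOrderAt_eq_zero.2 one_ne_zero
    | insert i s hi ih =>
      intro hs
      have hr := rep_mem hn (hs (Finset.mem_insert_self i s))
      have ha : ∀ j ∈ insert i s, AnalyticAt ℂ (fun z => fac p z (rep p j)) z₀ := fun j hj =>
        analyticAt_of_Hol (Hol_fac (MM.det_pos hn (rep_mem hn (hs hj)))) hz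
      have e : (fun z => ∏ j ∈ insert i s, fac p z (rep p j)) =
          (fun z => fac p z (rep p i)) * fun z => ∏ j ∈ s, fac p z (rep p j) := by
        ext z; simp [Finset.prod_insert hi]
      rw [e, analyticOrderAt_mul (ha i (Finset.mem_insert_self i s))
        (Finset.analyticAt_fun_prod s fun j hj => ha j (Finset.mem_insert_of_mem hj)),
        Finset.sum_insert hi, ih ((Finset.subset_insert i s).trans hs)]
      congr 1
      split_ifs with h
      · exact order_fac hn hz hr h.1 h.2
      · exact order_fac_eq_zero hn hz hr h
  refine (h1 _ subset_rfl).trans ?_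
  rw [← Finset.sum_filter, Finset.sum_const, fixIx, nsmul_eq_mul]
  push_cast; congr

theorem card_fixIx [Lvl p] {n : ℕ} (hn : 0 < n) {z₀ : ℂ} (hz : 0 < z₀.im) :
    Set.ncard {N | N ∈ Fx p n z₀ ∧ ¬ Sc p N} = 2 * ((fixIx p n z₀).card * ram p z₀) := by
  classical
  have hmem : ∀ i : fixIx p n z₀, i.1 ∈ ixs p n ∧ ¬ Sc p (rep p i) ∧
      ∃ γ, IsG p γ ∧ mob γ (mob (rep p i) z₀) = z₀ := fun i => by
    have := Finset.mem_filter.1 i.2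
    exact ⟨this.1, this.2.1, this.2.2⟩
  choose hi hs γ hγ hγz using hmem
  have hdet : ∀ i : fixIx p n z₀, 0 < (rep p i).det := fun i => MM.det_pos hn (rep_mem hn (hi i))
  have hfix : ∀ i : fixIx p n z₀, mob (γ i * rep p i) z₀ = z₀ := fun i => by
    rw [mob_mul (hγ i).det_pos (hdet i) hz, hγz]
  have hdet' : ∀ i : fixIx p n z₀, 0 < (γ i * rep p i).det := fun i => by
    rw [Matrix.det_mul, (hγ i).det, one_mul]; exact hdet i
  let F : fixIx p n z₀ × Stab p z₀ → {N | N ∈ Fx p n z₀ ∧ ¬ Sc p N} := fun x =>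
    have hl : LEq p (rep p x.1) (x.2.1 * (γ x.1 * rep p x.1)) :=
      ⟨x.2.1 * γ x.1, x.2.2.1.mul (hγ x.1), by rw [mul_assoc]⟩
    ⟨x.2.1 * (γ x.1 * rep p x.1), ⟨hl.mem (rep_mem hn (hi x.1)), by
      rw [mob_mul x.2.2.1.det_pos (hdet' _) hz, hfix, x.2.2.2]⟩, mt hl.sc_iff.2 (hs x.1)⟩
  have hF : Function.Bijective F := by
    constructor
    · rintro ⟨i, σ⟩ ⟨j, τ⟩ h
      have h : σ.1 * (γ i * rep p i) = τ.1 * (γ j * rep p j) := congrArg Subtype.val h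
      have h1 : LEq p (rep p i) (σ.1 * (γ i * rep p i)) :=
        ⟨σ.1 * γ i, σ.2.1.mul (hγ i), by rw [mul_assoc]⟩
      have h2 : LEq p (rep p j) (σ.1 * (γ i * rep p i)) :=
        ⟨τ.1 * γ j, τ.2.1.mul (hγ j), by rw [h, mul_assoc]⟩
      have hij : i = j := Subtype.ext (rep_injective hn (hi i) (hi j) (h2.trans h1.symm))
      subst hij
      have := mul_right_cancel_of_det (hdet' i).ne' h
      rw [Subtype.ext this]
    · rintro ⟨N, hN, hNs⟩
      obtain ⟨i, hi', hl⟩ := exists_rep hn hN.1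
      have hE := hl.Eqv_mob hn hN.1 hz
      rw [hN.2] at hE
      let i' : fixIx p n z₀ := ⟨i, Finset.mem_filter.2 ⟨hi', mt hl.sc_iff.2 hNs, hE.symm hz⟩⟩
      obtain ⟨δ, hδ, hδN⟩ := hl.symm
      have e : N = δ * (γ i').adjugate * (γ i' * rep p i') := by
        rw [mul_assoc, ← mul_assoc _ (γ i'), (hγ i').adj_mul, one_mul, hδN]
      have hG := hδ.mul (hγ i').adj
      refine ⟨⟨i', ⟨δ * (γ i').adjugate, hG, ?_⟩⟩, Subtype.ext e.symm⟩
      have h3 := hN.2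
      rw [e, mob_mul hG.det_pos (hdet' i') hz, hfix] at h3
      exact h3
  have := Nat.card_eq_of_bijective F hF
  rw [Nat.card_coe_set_eq, Nat.card_prod, card_stab hz, Nat.card_eq_fintype_card,
    Fintype.card_coe] at this
  rw [← this]; ring

theorem mob_fix_iff {N : M2} (hN : 0 < N.det) {z : ℂ} (hz : 0 < z.im) (h : N 1 0 = 0) :
    mob N z = z ↔ N = N 0 0 • (1 : M2) := by
  have hd := den_ne_zero hN hz
  have e1 : N = N 0 0 • (1 : M2) ↔ N 1 1 = N 0 0 ∧ N 0 1 = 0 := by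
    constructor
    · intro h; constructor <;> · rw [h]; simp
    · rintro ⟨h1, h2⟩; ext i j; fin_cases i <;> fin_cases j <;> simp [*]
  rw [e1, mob, div_eq_iff hd, den, h]
  constructor
  · intro h1
    have hi := congrArg Complex.im h1
    simp at hi
    have h2 : N 1 1 = N 0 0 := by
      have : (N 0 0 : ℝ) * z.im = N 1 1 * z.im := by rw [hi]; ring
      have := mul_right_cancel₀ hz.ne' this
      exact_mod_cast this.symm
    refine ⟨h2, ?_⟩
    rw [h2] at h1
    have : (N 0 1 : ℂ) = 0 := by push_cast at h1; linear_combination h1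
    exact_mod_cast this
  · rintro ⟨h1, h2⟩; rw [h1, h2]; push_cast; ring

theorem neg_mem_Fx {n : ℕ} {z : ℂ} {N : M2} (h : N ∈ Fx p n z) : -N ∈ Fx p n z := by
  refine ⟨⟨?_, ?_⟩, by rw [mob_neg]; exact h.2⟩
  · rw [← h.1.1]; simp [Matrix.det_fin_two]
  · rw [Matrix.neg_apply]; exact (dvd_neg).2 h.1.2

theorem ncard_Fx {n : ℕ} (hn : 0 < n) {z : ℂ} (hz : 0 < z.im) :
    (Fx p n z).ncard = 2 * nu p n z + Set.ncard {N | N ∈ Fx p n z ∧ N 1 0 = 0} := by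
  have hf := finite_Fx (p := p) hn hz
  set A := {N | N ∈ Fx p n z ∧ 0 < N 1 0} with hA
  set B := {N | N ∈ Fx p n z ∧ N 1 0 < 0} with hB
  set Z := {N | N ∈ Fx p n z ∧ N 1 0 = 0} with hZ
  have hAf : A.Finite := hf.subset fun N h => h.1
  have hBf : B.Finite := hf.subset fun N h => h.1
  have hZf : Z.Finite := hf.subset fun N h => h.1
  have e : Fx p n z = (A ∪ B) ∪ Z := by
    ext N; simp only [hA, hB, hZ, Set.mem_union, Set.mem_ofPred_eq]
    have := lt_trichotomy (N 1 0) 0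
    tauto
  have hAB : B.ncard = A.ncard := by
    have : B = (fun N : M2 => -N) '' A := by
      ext N
      simp only [Set.mem_image, hA, hB, Set.mem_ofPred_eq]
      constructor
      · rintro ⟨h1, h2⟩; exact ⟨-N, ⟨neg_mem_Fx h1, by simpa using h2⟩, neg_neg N⟩
      · rintro ⟨M, ⟨h1, h2⟩, rfl⟩; exact ⟨neg_mem_Fx h1, by simpa using h2⟩
    rw [this, Set.ncard_image_of_injective _ neg_injective]
  have d1 : Disjoint A B := Set.disjoint_left.2 fun N h1 h2 => lt_asymm h1.2 h2.2
  have d2 : Disjoint (A ∪ B) Z := Set.disjoint_left.2 fun N h1 h2 => by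
    rcases h1 with h1 | h1
    · exact h1.2.ne' h2.2
    · exact h1.2.ne h2.2
  rw [e, Set.ncard_union_eq d2 (hAf.union hBf) hZf, Set.ncard_union_eq d1 hAf hBf, hAB, nu]
  ring

theorem det_smul_two (k : ℤ) (γ : M2) : (k • γ).det = k ^ 2 * γ.det := by
  rw [Matrix.det_smul]; simp

theorem ncard_Fx_scalar {n : ℕ} (hn : 0 < n) {z : ℂ} (hz : 0 < z.im) :
    Set.ncard {N | N ∈ Fx p n z ∧ N 1 0 = 0} = if IsSquare n then 2 else 0 := by
  have hsub : ∀ N : M2, N ∈ Fx p n z ∧ N 1 0 = 0 ↔ ∃ k : ℤ, k ^ 2 = n ∧ N = k • (1 : M2) := by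
    intro N
    constructor
    · rintro ⟨h1, h2⟩
      have h3 := (mob_fix_iff (MM.det_pos hn h1.1) hz h2).1 h1.2
      refine ⟨N 0 0, ?_, h3⟩
      have h4 := h1.1.1
      rw [h3, det_smul_two] at h4
      simpa using h4
    · rintro ⟨k, hk, rfl⟩
      have hk0 : k ≠ 0 := by rintro rfl; simp at hk; omega
      exact ⟨⟨⟨by rw [det_smul_two, Matrix.det_one, mul_one, hk], by simp⟩, by
        rw [mob_smul hk0, mob_one]⟩, by simp⟩
  split_ifs with h
  · obtain ⟨k, rfl⟩ := h
    have hk : (k : ℤ) ≠ 0 := by rintro h; simp at h; simp [h] at hn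
    have : {N | N ∈ Fx p (k * k) z ∧ N 1 0 = 0} = {(k : ℤ) • (1 : M2), -(k : ℤ) • (1 : M2)} := by
      ext N
      rw [Set.mem_ofPred_eq, hsub]
      constructor
      · rintro ⟨j, hj, rfl⟩
        have : j ^ 2 = (k : ℤ) ^ 2 := by rw [hj]; push_cast; ring
        rcases sq_eq_sq_iff_eq_or_eq_neg.1 this with h | h <;> simp [h]
      · rintro (rfl | rfl)
        · exact ⟨k, by push_cast; ring, rfl⟩
        · exact ⟨-k, by push_cast; ring, rfl⟩
    rw [this, Set.ncard_pair]
    intro h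
    have := congrFun (congrFun h 0) 0
    simp at this; omega
  · have : {N | N ∈ Fx p n z ∧ N 1 0 = 0} = ∅ := by
      ext N
      rw [Set.mem_ofPred_eq, hsub]
      simp only [Set.mem_empty_iff_false, iff_false]
      rintro ⟨k, hk, -⟩
      exact h ⟨k.natAbs, by zify; rw [← hk, ← pow_two, sq_abs]⟩
    rw [this, Set.ncard_empty]

theorem ncard_Fx_sc [Lvl p] {n : ℕ} (hn : 0 < n) {z : ℂ} (hz : 0 < z.im) :
    Set.ncard {N | N ∈ Fx p n z ∧ Sc p N} = if IsSquare n then 2 * ram p z else 0 := by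
  split_ifs with h
  · obtain ⟨k, rfl⟩ := h
    have hk : (k : ℤ) ≠ 0 := by rintro h; simp at h; simp [h] at hn
    have : {N | N ∈ Fx p (k * k) z ∧ Sc p N} = (fun γ : M2 => (k : ℤ) • γ) '' Stab p z := by
      ext N
      simp only [Set.mem_image, Set.mem_ofPred_eq]
      constructor
      · rintro ⟨h1, j, γ, hγ, rfl⟩
        have h2 := h1.1.1
        rw [det_smul_two, hγ.det, mul_one] at h2
        have : j ^ 2 = (k : ℤ) ^ 2 := by rw [h2]; push_cast; ring
        have hj : j ≠ 0 := by rintro rfl; simp at this; omega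
        have hf := h1.2
        rw [mob_smul hj] at hf
        rcases sq_eq_sq_iff_eq_or_eq_neg.1 this with h | h
        · exact ⟨γ, ⟨hγ, hf⟩, by rw [h]⟩
        · exact ⟨-γ, ⟨hγ.neg, by rwa [mob_neg]⟩, by rw [h]; simp⟩
      · rintro ⟨γ, hγ, rfl⟩
        exact ⟨⟨⟨by rw [det_smul_two, hγ.1.det]; push_cast; ring,
          by simpa using hγ.1.dvd.mul_left _⟩, by rw [mob_smul hk]; exact hγ.2⟩, k, γ, hγ.1, rfl⟩
    rw [this, Set.ncard_image_of_injective _ (smul_right_injective _ hk), ← Nat.card_coe_set_eq,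
      card_stab hz]
  · have : {N | N ∈ Fx p n z ∧ Sc p N} = ∅ := by
      ext N
      simp only [Set.mem_ofPred_eq, Set.mem_empty_iff_false, iff_false]
      rintro ⟨h1, k, γ, hγ, rfl⟩
      have h2 := h1.1.1
      rw [det_smul_two, hγ.det, mul_one] at h2
      exact h ⟨k.natAbs, by zify; rw [← h2, ← pow_two, sq_abs]⟩
    rw [this, Set.ncard_empty]

theorem order_gn_eq [Lvl p] {n : ℕ} (hn : 0 < n) {z₀ : ℂ} (hz : 0 < z₀.im) :
    analyticOrderAt (gn p n) z₀ = (12 * nu p n z₀ : ℕ) := by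
  have hf := finite_Fx (p := p) hn hz
  have h1 : (Fx p n z₀).ncard = Set.ncard {N | N ∈ Fx p n z₀ ∧ ¬ Sc p N} +
      Set.ncard {N | N ∈ Fx p n z₀ ∧ Sc p N} := by
    rw [← Set.ncard_union_eq (Set.disjoint_left.2 fun N h h' => h.2 h'.2)
      (hf.subset fun N h => h.1) (hf.subset fun N h => h.1)]
    congr 1; ext N; simp only [Set.mem_union, Set.mem_ofPred_eq]; tauto
  rw [card_fixIx hn hz, ncard_Fx hn hz, ncard_Fx_scalar hn hz, ncard_Fx_sc hn hz] at h1
  have hA := analyticAt_of_Hol (Hol_Fn (p := p) hn) hz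
  by_cases hs : IsSquare n
  · simp only [hs, if_true] at h1
    have e : gn p n = Fn p n ^ 12 * gell p := by ext z; simp [gn, hs]
    have h2 := order_gell (p := p) hz
    rw [e, analyticOrderAt_mul (hA.pow 12) (analyticAt_of_Hol Hol_gell hz), analyticOrderAt_pow hA,
      order_Fn hn hz]
    generalize analyticOrderAt (gell p) z₀ = m at h2 ⊢
    cases m with
    | top => exact absurd h2 (by
        rw [top_add, ← Nat.cast_ofNat (R := ℕ∞), ← Nat.cast_mul]; exact ENat.top_ne_natCast _)
    | coe m =>
      have h2 : m + 12 = 12 * ram p z₀ := by exact_mod_cast h2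
      have : 12 * ((fixIx p n z₀).card * ram p z₀) + m = 12 * nu p n z₀ := by omega
      rw [← this]; push_cast; rw [nsmul_eq_mul]; rfl
  · simp only [hs, if_false] at h1
    have e : gn p n = Fn p n ^ 12 := by ext z; simp [gn, hs]
    rw [e, analyticOrderAt_pow hA, order_Fn hn hz]
    have : (fixIx p n z₀).card * ram p z₀ = nu p n z₀ := by omega
    rw [this, nsmul_eq_mul]; push_cast; rfl

theorem rootMultiplicity_mul_ram [Lvl p] {n : ℕ} (hn : 0 < n) {R : Polynomial ℂ} {e : ℤ}
    (hR : R ≠ 0) (h : ∀ z : ℂ, 0 < z.im → gn p n z = R.eval (hm p z) * up p z ^ e) {z₀ : ℂ}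
    (hz : 0 < z₀.im) : R.rootMultiplicity (hm p z₀) * ram p z₀ = 12 * nu p n z₀ := by
  have := (order_gn hR h hz).symm.trans (order_gn_eq hn hz)
  exact_mod_cast this

end FrickeTrace
end

noncomputable section
namespace FrickeTrace
open Filter Topology Asymptotics
variable {p : ℕ}

/-- Real positive definite symmetric matrices. -/
structure PD (M : Matrix (Fin 2) (Fin 2) ℝ) : Prop where
  pos : 0 < M 0 0
  symm : M 1 0 = M 0 1
  det_pos : 0 < M.det

theorem cmPointC_im {M : Matrix (Fin 2) (Fin 2) ℝ} : (cmPointC M).im = √M.det / M 0 0 := by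
  rw [cmPointC, Complex.div_ofReal_im]; simp

theorem cmPointC_re {M : Matrix (Fin 2) (Fin 2) ℝ} : (cmPointC M).re = -M 0 1 / M 0 0 := by
  rw [cmPointC, Complex.div_ofReal_re]; simp

theorem PD.im_pos {M : Matrix (Fin 2) (Fin 2) ℝ} (h : PD M) : 0 < (cmPointC M).im := by
  rw [cmPointC_im]; exact div_pos (Real.sqrt_pos.2 h.det_pos) h.pos

theorem PD.eq_cmPointC_iff {M : Matrix (Fin 2) (Fin 2) ℝ} (h : PD M) {z : ℂ} (hz : 0 < z.im) :
    z = cmPointC M ↔ (M 0 0 : ℂ) * z ^ 2 + 2 * M 0 1 * z + M 1 1 = 0 := by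
  have h0 : (M 0 0 : ℂ) ≠ 0 := by exact_mod_cast h.pos.ne'
  have hs : ((√M.det : ℝ) : ℂ) ^ 2 = M 0 0 * M 1 1 - M 0 1 * M 0 1 := by
    rw [← Complex.ofReal_pow, Real.sq_sqrt h.det_pos.le, Matrix.det_fin_two, h.symm]; push_cast; rfl
  have hI := Complex.I_sq
  constructor
  · rintro rfl
    rw [cmPointC]; field_simp; push_cast
    linear_combination hs * I ^ 2 + (M 0 0 * M 1 1 - M 0 1 * M 0 1 : ℂ) * hI
  · intro he
    have h1 : ((M 0 0 : ℂ) * z + M 0 1 - I * (√M.det : ℝ)) *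
        ((M 0 0 : ℂ) * z + M 0 1 + I * (√M.det : ℝ)) = 0 := by
      linear_combination (M 0 0 : ℂ) * he - hs * I ^ 2 - (M 0 0 * M 1 1 - M 0 1 * M 0 1 : ℂ) * hI
    rcases mul_eq_zero.1 h1 with h2 | h2
    · rw [cmPointC, eq_div_iff h0]; push_cast; linear_combination h2
    · exfalso
      have := congrArg Complex.im h2
      simp at this
      have h3 := mul_pos h.pos hz
      have h4 := Real.sqrt_pos.2 h.det_pos
      linarith

theorem PD.ext {M N : Matrix (Fin 2) (Fin 2) ℝ} (hM : PD M) (hN : PD N)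
    (hc : cmPointC M = cmPointC N) (hd : M.det = N.det) : M = N := by
  have h1 := congrArg Complex.im hc
  have h2 := congrArg Complex.re hc
  rw [cmPointC_im, cmPointC_im, hd] at h1
  rw [cmPointC_re, cmPointC_re] at h2
  have hs := Real.sqrt_pos.2 hN.det_pos
  have hM0 := hM.pos
  have hN0 := hN.pos
  have e0 : M 0 0 = N 0 0 := by
    rw [div_eq_div_iff hM0.ne' hN0.ne'] at h1
    exact (mul_left_cancel₀ hs.ne' h1).symm
  have e1 : M 0 1 = N 0 1 := by
    rw [e0, div_left_inj' hN0.ne'] at h2; linarith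
  have e2 : M 1 1 = N 1 1 := by
    rw [Matrix.det_fin_two, Matrix.det_fin_two, hM.symm, hN.symm, e0, e1] at hd
    exact mul_left_cancel₀ hN0.ne' (by linarith)
  ext i j
  fin_cases i <;> fin_cases j <;> simp [e0, e1, e2, hM.symm, hN.symm]

/-- The quadratic form of a matrix evaluated at a vector. -/
theorem PD.act {M : Matrix (Fin 2) (Fin 2) ℝ} (h : PD M) (g : SL2R) : PD ((g.1)ᵀ * M * g.1) := by
  have hg := g.2
  rw [Matrix.det_fin_two] at hg
  have hd := h.det_pos
  rw [Matrix.det_fin_two, h.symm] at hd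
  refine ⟨?_, ?_, ?_⟩
  · have e : ((g.1)ᵀ * M * g.1) 0 0 =
        M 0 0 * g.1 0 0 ^ 2 + 2 * M 0 1 * g.1 0 0 * g.1 1 0 + M 1 1 * g.1 1 0 ^ 2 := by
      simp [Matrix.mul_apply, Fin.sum_univ_two, h.symm]; ring
    rw [e]
    have e2 : M 0 0 * (M 0 0 * g.1 0 0 ^ 2 + 2 * M 0 1 * g.1 0 0 * g.1 1 0 + M 1 1 * g.1 1 0 ^ 2) =
      (M 0 0 * g.1 0 0 + M 0 1 * g.1 1 0) ^ 2 + (M 0 0 * M 1 1 - M 0 1 * M 0 1) * g.1 1 0 ^ 2 := by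
      ring
    refine pos_of_mul_pos_right (a := M 0 0) ?_ h.pos.le
    rw [e2]
    by_cases hc : g.1 1 0 = 0
    · have ha : g.1 0 0 ≠ 0 := by intro h'; rw [hc, h'] at hg; simp at hg
      have := mul_ne_zero h.pos.ne' ha
      rw [hc, mul_zero, add_zero]; positivity
    · positivity
  · simp [Matrix.mul_apply, Fin.sum_univ_two, h.symm]; ring
  · rw [Matrix.det_mul, Matrix.det_mul, Matrix.det_transpose, g.2]; simpa using h.det_pos

theorem moebius_den_ne_zero (g : SL2R) {z : ℂ} (hz : 0 < z.im) :
    ((g.1 1 0 : ℝ) : ℂ) * z + ((g.1 1 1 : ℝ) : ℂ) ≠ 0 := by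
  intro h
  have hg := g.2
  rw [Matrix.det_fin_two] at hg
  have h1 := congrArg Complex.im h
  have h2 := congrArg Complex.re h
  simp at h1 h2
  rcases h1 with h1 | h1
  · rw [h1] at h2 hg; simp at h2; rw [h2] at hg; simp at hg
  · exact hz.ne' h1

theorem moebius_im_pos (g : SL2R) {z : ℂ} (hz : 0 < z.im) : 0 < (moebius g z).im := by
  have hg := g.2
  rw [Matrix.det_fin_two] at hg
  have h := Complex.normSq_pos.2 (moebius_den_ne_zero g hz)
  rw [moebius, Complex.div_im, ← sub_div]
  refine div_pos ?_ h
  simp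
  have : (g.1 0 0 * z.im * (g.1 1 0 * z.re + g.1 1 1) - (g.1 0 0 * z.re + g.1 0 1) * (g.1 1 0 * z.im))
    = (g.1 0 0 * g.1 1 1 - g.1 0 1 * g.1 1 0) * z.im := by ring
  nlinarith

theorem moebius_injective (g : SL2R) {z w : ℂ} (hz : 0 < z.im) (hw : 0 < w.im)
    (h : moebius g z = moebius g w) : z = w := by
  have hg := g.2
  rw [Matrix.det_fin_two] at hg
  have hg' : (g.1 0 0 : ℂ) * g.1 1 1 - g.1 0 1 * g.1 1 0 = 1 := by exact_mod_cast hg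
  rw [moebius, moebius, div_eq_div_iff (moebius_den_ne_zero g hz) (moebius_den_ne_zero g hw)] at h
  linear_combination h - (z - w) * hg'

theorem PD.moebius_act {M : Matrix (Fin 2) (Fin 2) ℝ} (h : PD M) (g : SL2R) :
    moebius g (cmPointC ((g.1)ᵀ * M * g.1)) = cmPointC M := by
  have h' := h.act g
  have hd := moebius_den_ne_zero g h'.im_pos
  rw [h.eq_cmPointC_iff (moebius_im_pos g h'.im_pos), moebius]
  have h1 := (h'.eq_cmPointC_iff h'.im_pos).1 rfl
  generalize cmPointC ((g.1)ᵀ * M * g.1) = w at h1 hd ⊢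
  simp only [Matrix.mul_apply, Fin.sum_univ_two, Matrix.transpose_apply, h.symm] at h1
  push_cast at h1
  generalize hD : ((g.1 1 0 : ℝ) : ℂ) * w + ((g.1 1 1 : ℝ) : ℂ) = D at hd ⊢
  rw [div_pow]
  field_simp
  rw [← hD]
  linear_combination h1

theorem PD.act_eq_iff {M : Matrix (Fin 2) (Fin 2) ℝ} {N : Matrix (Fin 2) (Fin 2) ℝ} (h : PD M)
    (hN : PD N) (hd : M.det = N.det) (g : SL2R) :
    N = (g.1)ᵀ * M * g.1 ↔ moebius g (cmPointC N) = cmPointC M := by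
  constructor
  · rintro rfl; exact h.moebius_act g
  · intro h1
    refine hN.ext (h.act g) ?_ ?_
    · exact moebius_injective g hN.im_pos (h.act g).im_pos (by rw [h1, h.moebius_act])
    · rw [Matrix.det_mul, Matrix.det_mul, Matrix.det_transpose, g.2, hd]; simp

/-- Integral multiples by `√p` of the Atkin–Lehner matrices. -/
structure IsA (p : ℕ) (M : M2) : Prop where
  det : M.det = p
  dvd₀ : (p : ℤ) ∣ M 0 0
  dvd : (p : ℤ) ∣ M 1 0
  dvd₁ : (p : ℤ) ∣ M 1 1

/-- The elements of `SL(2, ℝ)` coming from `Γ₀(p)`. -/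
def TG (p : ℕ) (g : SL2R) : Prop := ∃ M, IsG p M ∧ g.1 = M.map ((↑) : ℤ → ℝ)

/-- The Atkin–Lehner elements of `SL(2, ℝ)`. -/
def TA (p : ℕ) (g : SL2R) : Prop := ∃ M, IsA p M ∧ g.1 = (√p)⁻¹ • M.map ((↑) : ℤ → ℝ)

theorem map_mul_cast (A B : M2) : (A * B).map ((↑) : ℤ → ℝ) = A.map (↑) * B.map (↑) :=
  Matrix.map_mul (f := Int.castRingHom ℝ)

theorem TG.one : TG p 1 := ⟨1, IsG.one p, by simp⟩

theorem TG.mul {g g' : SL2R} (h : TG p g) (h' : TG p g') : TG p (g * g') := by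
  obtain ⟨M, hM, e⟩ := h
  obtain ⟨N, hN, e'⟩ := h'
  exact ⟨M * N, hM.mul hN, by rw [map_mul_cast, ← e, ← e']; rfl⟩

theorem TG.mul_TA {g g' : SL2R} (h : TG p g) (h' : TA p g') : TA p (g * g') := by
  obtain ⟨M, hM, e⟩ := h
  obtain ⟨N, hN, e'⟩ := h'
  refine ⟨M * N, ⟨?_, ?_, ?_, ?_⟩, ?_⟩
  · rw [Matrix.det_mul, hM.det, hN.det, one_mul]
  · simp only [Matrix.mul_apply, Fin.sum_univ_two]
    exact dvd_add (hN.dvd₀.mul_left _) (hN.dvd.mul_left _)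
  · simp only [Matrix.mul_apply, Fin.sum_univ_two]
    exact dvd_add (hN.dvd₀.mul_left _) (hN.dvd.mul_left _)
  · simp only [Matrix.mul_apply, Fin.sum_univ_two]
    exact dvd_add (hM.dvd.mul_right _) (hN.dvd₁.mul_left _)
  · rw [map_mul_cast, ← Matrix.mul_smul, ← e, ← e']; rfl

theorem TA.mul_TG {g g' : SL2R} (h : TA p g) (h' : TG p g') : TA p (g * g') := by
  obtain ⟨N, hN, e⟩ := h
  obtain ⟨M, hM, e'⟩ := h'
  refine ⟨N * M, ⟨?_, ?_, ?_, ?_⟩, ?_⟩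
  · rw [Matrix.det_mul, hM.det, hN.det, mul_one]
  · simp only [Matrix.mul_apply, Fin.sum_univ_two]
    exact dvd_add (hN.dvd₀.mul_right _) (hM.dvd.mul_left _)
  · simp only [Matrix.mul_apply, Fin.sum_univ_two]
    exact dvd_add (hN.dvd.mul_right _) (hN.dvd₁.mul_right _)
  · simp only [Matrix.mul_apply, Fin.sum_univ_two]
    exact dvd_add (hN.dvd.mul_right _) (hN.dvd₁.mul_right _)
  · rw [map_mul_cast, ← Matrix.smul_mul, ← e, ← e']; rfl

theorem TA.mul [Lvl p] {g g' : SL2R} (h : TA p g) (h' : TA p g') : TG p (g * g') := by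
  obtain ⟨M, hM, e⟩ := h
  obtain ⟨N, hN, e'⟩ := h'
  have hp : (p : ℤ) ≠ 0 := by exact_mod_cast (Lvl.pos p).ne'
  have hpr : (p : ℝ) ≠ 0 := by exact_mod_cast (Lvl.pos p).ne'
  obtain ⟨a, ha⟩ := hM.dvd₀
  obtain ⟨c, hc⟩ := hM.dvd
  obtain ⟨d, hd⟩ := hM.dvd₁
  obtain ⟨a', ha'⟩ := hN.dvd₀
  obtain ⟨c', hc'⟩ := hN.dvd
  obtain ⟨d', hd'⟩ := hN.dvd₁
  have key : M * N = (p : ℤ) • !![p * a * a' + M 0 1 * c', a * N 0 1 + M 0 1 * d';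
      p * (c * a' + d * c'), c * N 0 1 + p * d * d'] := by
    ext i j
    fin_cases i <;> fin_cases j <;>
      simp [Matrix.mul_apply, Fin.sum_univ_two, ha, hc, hd, ha', hc', hd'] <;> ring
  refine ⟨!![p * a * a' + M 0 1 * c', a * N 0 1 + M 0 1 * d';
      p * (c * a' + d * c'), c * N 0 1 + p * d * d'], ⟨?_, by simp⟩, ?_⟩
  · have h1 := congrArg Matrix.det key
    rw [Matrix.det_mul, hM.det, hN.det, det_smul_two] at h1
    have : ((p : ℤ) ^ 2) ≠ 0 := pow_ne_zero _ hp
    exact mul_left_cancel₀ this (by rw [← h1]; ring)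
  · have h1 : (g * g').1 = ((√(p : ℝ))⁻¹ * (√(p : ℝ))⁻¹) • (M * N).map ((↑) : ℤ → ℝ) := by
      have h2 : (g * g').1 = g.1 * g'.1 := rfl
      rw [map_mul_cast, h2, e, e', Matrix.smul_mul, Matrix.mul_smul, smul_smul]
    rw [h1, key, ← mul_inv, Real.mul_self_sqrt (Nat.cast_nonneg p)]
    ext i j
    rw [Matrix.smul_apply, Matrix.map_apply, Matrix.map_apply, Matrix.smul_apply, smul_eq_mul,
      smul_eq_mul, Int.cast_mul, Int.cast_natCast, inv_mul_cancel_left₀ hpr]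

theorem map_adjugate_cast (M : M2) :
    (M.adjugate).map ((↑) : ℤ → ℝ) = (M.map ((↑) : ℤ → ℝ)).adjugate :=
  (Int.castRingHom ℝ).map_adjugate M

theorem TG.inv {g : SL2R} (h : TG p g) : TG p g⁻¹ := by
  obtain ⟨M, hM, e⟩ := h
  exact ⟨M.adjugate, hM.adj, by rw [map_adjugate_cast, ← e]; rfl⟩

theorem TA.inv {g : SL2R} (h : TA p g) : TA p g⁻¹ := by
  obtain ⟨M, hM, e⟩ := h
  refine ⟨M.adjugate, ⟨by simp [Matrix.det_adjugate, hM.det], ?_, ?_, ?_⟩, ?_⟩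
  · simpa [Matrix.adjugate_fin_two] using hM.dvd₁
  · simpa [Matrix.adjugate_fin_two] using hM.dvd
  · simpa [Matrix.adjugate_fin_two] using hM.dvd₀
  · have h2 : (g⁻¹).1 = g.1.adjugate := rfl
    rw [h2, e, Matrix.adjugate_smul, map_adjugate_cast]; simp

theorem not_TG_of_TA [Lvl p] {g : SL2R} (h : TA p g) : ¬ TG p g := by
  rintro ⟨M, hM, e⟩
  obtain ⟨N, hN, e'⟩ := h
  have hi : Irrational √p := (Lvl.prime p).irrational_sqrt
  have hs : √(p : ℝ) ≠ 0 := hi.ne_zero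
  have h1 : ∀ i j, M i j = 0 := fun i j => by
    by_contra h0
    have h2 : (M i j : ℝ) = (√p)⁻¹ * N i j := by
      have := congrFun (congrFun (e.symm.trans e') i) j
      simpa using this
    refine hi ⟨(N i j : ℚ) / M i j, ?_⟩
    have h0' : (M i j : ℝ) ≠ 0 := by exact_mod_cast h0
    push_cast
    rw [div_eq_iff h0', h2]; field_simp
  have := hM.det
  rw [Matrix.det_fin_two, h1 0 0, h1 0 1] at this
  simp at this

theorem mem_Fricke_iff [Lvl p] {g : SL2R} : g ∈ FrickeGroup p ↔ TG p g ∨ TA p g := by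
  have hp1 : 0 < p := Lvl.pos p
  have hs : √(p : ℝ) ≠ 0 := (Real.sqrt_pos.2 (by exact_mod_cast hp1)).ne'
  have hG : ∀ g : SL2R, g ∈ Gamma0SL2R p ↔ TG p g := by
    intro g
    rw [Gamma0SL2R, Subgroup.mem_map]
    constructor
    · rintro ⟨γ, hγ, rfl⟩
      refine ⟨γ.1, ⟨γ.2, ?_⟩, rfl⟩
      exact (ZMod.intCast_zmod_eq_zero_iff_dvd _ p).1 (CongruenceSubgroup.Gamma0_mem.1 hγ)
    · rintro ⟨M, hM, e⟩
      refine ⟨⟨M, hM.det⟩, ?_, Subtype.ext e.symm⟩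
      exact CongruenceSubgroup.Gamma0_mem.2 ((ZMod.intCast_zmod_eq_zero_iff_dvd _ p).2 hM.dvd)
  constructor
  · intro hg
    refine Subgroup.closure_induction (p := fun g _ => TG p g ∨ TA p g) ?_ (Or.inl TG.one)
      ?_ ?_ hg
    · rintro g (h | h)
      · exact Or.inl ((hG g).1 h)
      · simp only [Set.mem_iUnion] at h
        obtain ⟨e, ⟨he, -⟩, x, y, z, w, h⟩ := h
        have hdet := g.2
        rw [h] at hdet
        rcases (Nat.dvd_prime (Lvl.prime p)).1 he with rfl | rfl
        · left
          refine ⟨!![x, y; z * p, w], ⟨?_, by simp⟩, ?_⟩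
          · simp [Matrix.det_fin_two_of] at hdet ⊢
            exact_mod_cast hdet
          · rw [h]; ext i j; fin_cases i <;> fin_cases j <;> simp
        · right
          refine ⟨!![x * e, y; z * e, w * e], ⟨?_, by simp, by simp, by simp⟩, ?_⟩
          · rw [Matrix.det_smul, Matrix.det_fin_two_of] at hdet
            simp only [Fintype.card_fin, inv_pow, Real.sq_sqrt (Nat.cast_nonneg e)] at hdet
            have he0 : (e : ℝ) ≠ 0 := by exact_mod_cast hp1.ne'
            rw [inv_mul_eq_iff_eq_mul₀ he0, mul_one] at hdet
            rw [Matrix.det_fin_two_of]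
            exact_mod_cast hdet
          · rw [h]; ext i j; fin_cases i <;> fin_cases j <;> simp
    · rintro g g' - - (h | h) (h' | h')
      · exact Or.inl (h.mul h')
      · exact Or.inr (h.mul_TA h')
      · exact Or.inr (h.mul_TG h')
      · exact Or.inl (h.mul h')
    · rintro g - (h | h)
      · exact Or.inl h.inv
      · exact Or.inr h.inv
  · rintro (h | ⟨M, hM, e⟩)
    · exact Subgroup.subset_closure (Or.inl ((hG g).2 h))
    · refine Subgroup.subset_closure (Or.inr ?_)
      simp only [Set.mem_iUnion]
      obtain ⟨a, ha⟩ := hM.dvd₀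
      obtain ⟨c, hc⟩ := hM.dvd
      obtain ⟨d, hd⟩ := hM.dvd₁
      refine ⟨p, ⟨dvd_rfl, by simp [Nat.div_self hp1]⟩, a, M 0 1, c, d, ?_⟩
      rw [e]; ext i j; fin_cases i <;> fin_cases j <;> simp [ha, hc, hd, mul_comm]

theorem moebius_of_TG {g : SL2R} {M : M2} (e : g.1 = M.map ((↑) : ℤ → ℝ)) (z : ℂ) :
    moebius g z = mob M z := by
  simp [moebius, mob, den, e]

theorem moebius_of_TA [Lvl p] {g : SL2R} {M : M2} (e : g.1 = (√p)⁻¹ • M.map ((↑) : ℤ → ℝ)) (z : ℂ) :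
    moebius g z = mob M z := by
  have hs : ((√(p : ℝ) : ℝ) : ℂ)⁻¹ ≠ 0 :=
    inv_ne_zero (by exact_mod_cast (Real.sqrt_pos.2 (by exact_mod_cast Lvl.pos p)).ne')
  simp only [moebius, mob, den, e, Matrix.smul_apply, Matrix.map_apply, smul_eq_mul]
  push_cast
  rw [mul_assoc, mul_assoc, ← mul_add, ← mul_add, mul_div_mul_left _ _ hs]

theorem IsA.exists_mob [Lvl p] {M : M2} (hM : IsA p M) {z : ℂ} (hz : 0 < z.im) :
    ∃ γ, IsG p γ ∧ mob M z = mob γ (Wf p z) := by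
  obtain ⟨a, ha⟩ := hM.dvd₀
  obtain ⟨c, hc⟩ := hM.dvd
  obtain ⟨d, hd⟩ := hM.dvd₁
  have hp : (p : ℤ) ≠ 0 := by exact_mod_cast (Lvl.pos p).ne'
  have hpc := Lvl.cast_ne p
  have hz0 := ne_zero_of_im_pos hz
  have hg : IsG p !![-M 0 1, a; -(p * d), c] := by
    refine ⟨?_, by simp⟩
    have h := hM.det
    rw [Matrix.det_fin_two, ha, hc, hd] at h
    rw [Matrix.det_fin_two_of]
    exact mul_left_cancel₀ hp (by linear_combination h)
  refine ⟨_, hg, ?_⟩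
  have h1 := den_ne_zero (M := M) (by rw [hM.det]; exact_mod_cast Lvl.pos p) hz
  have h2 := den_ne_zero hg.det_pos (Wf_im_pos p hz)
  rw [mob, mob, div_eq_div_iff h1 h2, den, den, ha, hc, hd, Wf]
  simp
  field_simp
  ring

theorem exists_IsA_mob [Lvl p] {γ : M2} (hγ : IsG p γ) {z : ℂ} (hz : 0 < z.im) :
    ∃ g : SL2R, TA p g ∧ moebius g z = mob γ (Wf p z) := by
  have hp : 0 < p := Lvl.pos p
  have hpc := Lvl.cast_ne p
  have hz0 := ne_zero_of_im_pos hz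
  obtain ⟨c, hc⟩ := hγ.dvd
  have hdet := hγ.det
  rw [Matrix.det_fin_two, hc] at hdet
  have hA : IsA p !![γ 0 1 * p, -γ 0 0; γ 1 1 * p, -(p * c)] := by
    refine ⟨?_, by simp, by simp, by simp⟩
    rw [Matrix.det_fin_two_of]; linear_combination (p : ℤ) * hdet
  let g : SL2R := ⟨(√p)⁻¹ • Matrix.map !![γ 0 1 * p, -γ 0 0; γ 1 1 * p, -(p * c)] ((↑) : ℤ → ℝ), by
    have h1 : (Matrix.map !![γ 0 1 * p, -γ 0 0; γ 1 1 * p, -(p * c)] ((↑) : ℤ → ℝ)).det = p := by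
      have := (Int.castRingHom ℝ).map_det !![γ 0 1 * p, -γ 0 0; γ 1 1 * p, -(p * c)]
      rw [hA.det] at this
      simpa using this.symm
    rw [Matrix.det_smul, h1]
    simp only [Fintype.card_fin, inv_pow, Real.sq_sqrt (Nat.cast_nonneg p)]
    exact inv_mul_cancel₀ (by exact_mod_cast hp.ne')⟩
  refine ⟨g, ⟨_, hA, rfl⟩, ?_⟩
  rw [moebius_of_TA (p := p) (g := g) rfl z]
  have h1 := den_ne_zero (M := !![γ 0 1 * p, -γ 0 0; γ 1 1 * p, -(p * c)])
    (by rw [hA.det]; exact_mod_cast Lvl.pos p) hz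
  have h2 := den_ne_zero hγ.det_pos (Wf_im_pos p hz)
  rw [mob, mob, div_eq_div_iff h1 h2, den, den, hc, Wf]
  simp
  field_simp
  ring

theorem exists_TG_moebius {γ : M2} (hγ : IsG p γ) (z : ℂ) :
    ∃ g : SL2R, TG p g ∧ moebius g z = mob γ z := by
  let g : SL2R := ⟨Matrix.map γ ((↑) : ℤ → ℝ), by
    have := (Int.castRingHom ℝ).map_det γ
    rw [hγ.det] at this
    simpa using this.symm⟩
  exact ⟨g, ⟨γ, hγ, rfl⟩, moebius_of_TG rfl z⟩

end FrickeTrace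
end

noncomputable section
namespace FrickeTrace
open Filter Topology Asymptotics
variable {p : ℕ}

theorem moebius_mul (g g' : SL2R) {z : ℂ} (hz : 0 < z.im) :
    moebius (g * g') z = moebius g (moebius g' z) := by
  have h1 := moebius_den_ne_zero g' hz
  have h2 := moebius_den_ne_zero g (moebius_im_pos g' hz)
  have h3 := moebius_den_ne_zero (g * g') hz
  have e : (g * g').1 = g.1 * g'.1 := rfl
  rw [moebius, div_eq_iff h3, moebius, div_mul_eq_mul_div, eq_div_iff h2, moebius, e]
  simp only [Matrix.mul_apply, Fin.sum_univ_two]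
  push_cast
  field_simp
  ring

theorem moebius_one (z : ℂ) : moebius 1 z = z := by simp [moebius]

theorem moebius_inv_moebius (g : SL2R) {z : ℂ} (hz : 0 < z.im) : moebius g⁻¹ (moebius g z) = z := by
  rw [← moebius_mul _ _ hz, inv_mul_cancel, moebius_one]

/-- The stabilizer of a point in `Γ₀(p)`, inside `SL(2, ℝ)`. -/
def SK (p : ℕ) (z : ℂ) : Set SL2R := {g | TG p g ∧ moebius g z = z}

theorem ncard_SK [Lvl p] {z : ℂ} (hz : 0 < z.im) : (SK p z).ncard = 2 * ram p z := by
  rw [← card_stab hz, ← Nat.card_coe_set_eq]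
  have hinj : Function.Injective fun M : M2 => M.map ((↑) : ℤ → ℝ) :=
    Matrix.map_injective Int.cast_injective
  have hM : ∀ g : SK p z, ∃ M, M ∈ Stab p z ∧ g.1.1 = M.map ((↑) : ℤ → ℝ) := by
    rintro ⟨g, ⟨M, hM, e⟩, hg⟩
    exact ⟨M, ⟨hM, by rw [← moebius_of_TG e, hg]⟩, e⟩
  choose F hF hFe using hM
  refine Nat.card_congr (Equiv.ofBijective (fun g => (⟨F g, hF g⟩ : Stab p z)) ⟨?_, ?_⟩)
  · intro g g' h
    have h' : F g = F g' := congrArg Subtype.val h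
    apply Subtype.ext; apply Subtype.ext
    rw [hFe, hFe, h']
  · rintro ⟨M, hM⟩
    let g : SL2R := ⟨Matrix.map M ((↑) : ℤ → ℝ), by
      have := (Int.castRingHom ℝ).map_det M
      rw [hM.1.det] at this
      simpa using this.symm⟩
    refine ⟨⟨g, ⟨M, hM.1, rfl⟩, by rw [moebius_of_TG (M := M) rfl]; exact hM.2⟩, ?_⟩
    apply Subtype.ext
    exact hinj (hFe ⟨g, _⟩).symm

theorem TG.conj [Lvl p] {g h : SL2R} (hg : g ∈ FrickeGroup p) (hh : TG p h) :
    TG p (g * h * g⁻¹) := by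
  rcases mem_Fricke_iff.1 hg with hg | hg
  · exact (hg.mul hh).mul hg.inv
  · exact (hg.mul_TG hh).mul hg.inv

theorem ram_moebius [Lvl p] {g : SL2R} (hg : g ∈ FrickeGroup p) {z : ℂ} (hz : 0 < z.im) :
    ram p (moebius g z) = ram p z := by
  have key : ∀ {g : SL2R}, g ∈ FrickeGroup p → ∀ {z : ℂ}, 0 < z.im → ∀ h ∈ SK p z,
      g * h * g⁻¹ ∈ SK p (moebius g z) := by
    intro g hg z hz h hh
    refine ⟨hh.1.conj hg, ?_⟩
    rw [moebius_mul _ _ (moebius_im_pos g hz), moebius_inv_moebius g hz, moebius_mul _ _ hz, hh.2]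
  have h1 : SK p (moebius g z) = (MulAut.conj g) '' SK p z := by
    ext k
    constructor
    · intro hk
      have := key (inv_mem hg) (moebius_im_pos g hz) k hk
      rw [moebius_inv_moebius g hz, inv_inv] at this
      exact ⟨_, this, by simp [mul_assoc]⟩
    · rintro ⟨h, hh, rfl⟩
      exact key hg hz h hh
  have h2 := ncard_SK (p := p) (moebius_im_pos g hz)
  rw [h1, Set.ncard_image_of_injective _ (MulAut.conj g).injective, ncard_SK hz] at h2
  omega

/-- The action of the Fricke involution on the values of the hauptmodul. -/
def io (p : ℕ) (x : ℂ) : ℂ := sx p + kap p / (x - sx p)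

theorem io_hm [Lvl p] {z : ℂ} (hz : 0 < z.im) : io p (hm p z) = hm p (Wf p z) := by
  rw [hm_Wf hz, io, hm, add_sub_cancel_right]

theorem io_io_hm [Lvl p] {z : ℂ} (hz : 0 < z.im) : io p (io p (hm p z)) = hm p z := by
  rw [io_hm hz, io_hm (Wf_im_pos p hz), Wf_Wf p hz]

theorem hm_moebius_TG [Lvl p] {g : SL2R} (hg : TG p g) {z : ℂ} (hz : 0 < z.im) :
    hm p (moebius g z) = hm p z := by
  obtain ⟨M, hM, e⟩ := hg
  rw [moebius_of_TG e, hm_mob hM hz]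

theorem hm_moebius_TA [Lvl p] {g : SL2R} (hg : TA p g) {z : ℂ} (hz : 0 < z.im) :
    hm p (moebius g z) = io p (hm p z) := by
  obtain ⟨M, hM, e⟩ := hg
  obtain ⟨γ, hγ, e'⟩ := hM.exists_mob hz
  rw [moebius_of_TA e, e', hm_mob hγ (Wf_im_pos p hz), io_hm hz]

theorem exists_TG_of_hm_eq [Lvl p] {z w : ℂ} (hz : 0 < z.im) (hw : 0 < w.im)
    (h : hm p w = hm p z) : ∃ g, TG p g ∧ moebius g z = w := by
  obtain ⟨γ, hγ, e⟩ := Eqv_of_hm_eq hz hw h.symm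
  obtain ⟨g, hg, e'⟩ := exists_TG_moebius hγ z
  exact ⟨g, hg, e'.trans e⟩

theorem exists_TA_of_hm_eq [Lvl p] {z w : ℂ} (hz : 0 < z.im) (hw : 0 < w.im)
    (h : hm p w = io p (hm p z)) : ∃ g, TA p g ∧ moebius g z = w := by
  rw [io_hm hz] at h
  obtain ⟨γ, hγ, e⟩ := Eqv_of_hm_eq (Wf_im_pos p hz) hw h.symm
  obtain ⟨g, hg, e'⟩ := exists_IsA_mob hγ hz
  exact ⟨g, hg, e'.trans e⟩

theorem exists_Fricke_iff [Lvl p] {z w : ℂ} (hz : 0 < z.im) (hw : 0 < w.im) :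
    (∃ g ∈ FrickeGroup p, moebius g z = w) ↔ hm p w = hm p z ∨ hm p w = io p (hm p z) := by
  constructor
  · rintro ⟨g, hg, rfl⟩
    exact (mem_Fricke_iff.1 hg).imp (fun h => hm_moebius_TG h hz) (fun h => hm_moebius_TA h hz)
  · rintro (h | h)
    · obtain ⟨g, hg, e⟩ := exists_TG_of_hm_eq hz hw h
      exact ⟨g, mem_Fricke_iff.2 (Or.inl hg), e⟩
    · obtain ⟨g, hg, e⟩ := exists_TA_of_hm_eq hz hw h
      exact ⟨g, mem_Fricke_iff.2 (Or.inr hg), e⟩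

open Classical in
/-- The order of the stabilizer of a point above a given value of the hauptmodul. -/
def wt (p : ℕ) (x : ℂ) : ℕ := if h : ∃ z : ℂ, 0 < z.im ∧ hm p z = x then ram p h.choose else 0

theorem wt_hm [Lvl p] {z : ℂ} (hz : 0 < z.im) : wt p (hm p z) = ram p z := by
  have h : ∃ w : ℂ, 0 < w.im ∧ hm p w = hm p z := ⟨z, hz, rfl⟩
  rw [wt, dif_pos h]
  obtain ⟨g, hg, e⟩ := exists_TG_of_hm_eq hz h.choose_spec.1 h.choose_spec.2
  conv_lhs => rw [← e]
  exact ram_moebius (mem_Fricke_iff.2 (Or.inl hg)) hz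

theorem wt_io [Lvl p] {z : ℂ} (hz : 0 < z.im) : wt p (io p (hm p z)) = ram p z := by
  obtain ⟨g, hg, e⟩ := exists_TA_of_hm_eq hz (Wf_im_pos p hz) (io_hm (p := p) hz).symm
  rw [io_hm hz, wt_hm (Wf_im_pos p hz), ← e]
  exact ram_moebius (mem_Fricke_iff.2 (Or.inr hg)) hz

theorem stabOrder_eq [Lvl p] {M : Matrix (Fin 2) (Fin 2) ℝ} (hM : PD M) :
    stabOrder (FrickeGroup p) M = if io p (hm p (cmPointC M)) = hm p (cmPointC M)
      then 2 * ram p (cmPointC M) else ram p (cmPointC M) := by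
  have hz := hM.im_pos
  have e1 : {g : SL2R | g ∈ FrickeGroup p ∧ (g.1)ᵀ * M * g.1 = M} =
      SK p (cmPointC M) ∪ {g | TA p g ∧ moebius g (cmPointC M) = cmPointC M} := by
    ext g
    have := hM.act_eq_iff hM rfl g
    simp only [SK, Set.mem_union, Set.mem_ofPred_eq, mem_Fricke_iff, ← this, eq_comm (a := M)]
    tauto
  have hK := ncard_SK (p := p) hz
  have hfin : (SK p (cmPointC M)).Finite := Set.finite_of_ncard_ne_zero (by
    have := ram_pos (p := p) hz; omega)
  rw [stabOrder, show Nat.card {g : SL2R // g ∈ FrickeGroup p ∧ (g.1)ᵀ * M * g.1 = M} =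
    Set.ncard {g : SL2R | g ∈ FrickeGroup p ∧ (g.1)ᵀ * M * g.1 = M} from rfl, e1]
  split_ifs with h
  · obtain ⟨g₀, hg₀, e₀⟩ := exists_TA_of_hm_eq hz hz h.symm
    have e2 : {g | TA p g ∧ moebius g (cmPointC M) = cmPointC M} =
        (g₀ * ·) '' SK p (cmPointC M) := by
      ext g
      constructor
      · rintro ⟨h1, h2⟩
        refine ⟨g₀⁻¹ * g, ⟨hg₀.inv.mul h1, ?_⟩, by simp⟩
        rw [moebius_mul _ _ hz, h2]
        conv_lhs => rw [← e₀]
        exact moebius_inv_moebius g₀ hz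
      · rintro ⟨k, hk, rfl⟩
        exact ⟨hg₀.mul_TG hk.1, by rw [moebius_mul _ _ hz, hk.2, e₀]⟩
    rw [Set.ncard_union_eq (Set.disjoint_left.2 fun g h1 h2 => not_TG_of_TA h2.1 h1.1) hfin
      (by rw [e2]; exact hfin.image _), e2, Set.ncard_image_of_injective _ (mul_right_injective g₀),
      hK]
    omega
  · have e2 : {g | TA p g ∧ moebius g (cmPointC M) = cmPointC M} = ∅ := by
      ext g
      simp only [Set.mem_ofPred_eq, Set.mem_empty_iff_false, iff_false]
      rintro ⟨h1, h2⟩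
      exact h (by rw [← hm_moebius_TA h1 hz, h2])
    rw [e2, Set.union_empty, hK]
    omega

theorem PD_formMat {a b c : ℤ} {d : ℤ} (hd : 0 < d) (ha : 0 < a) (h : b ^ 2 - 4 * a * c = -d) :
    PD (formMat a b c) ∧ (formMat a b c).det = d / 4 := by
  have h1 : (formMat a b c).det = d / 4 := by
    rw [formMat, Matrix.det_fin_two_of]
    have : (b : ℝ) ^ 2 - 4 * a * c = -d := by exact_mod_cast h
    linear_combination (-1 / 4) * this
  refine ⟨⟨by simpa [formMat] using ha, by simp [formMat], ?_⟩, h1⟩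
  rw [h1]
  have : (0 : ℝ) < d := by exact_mod_cast hd
  positivity

theorem PD_of_mem {d : ℤ} (hd : 0 < d) {M : Matrix (Fin 2) (Fin 2) ℝ} (h : M ∈ QdN d p) :
    PD M ∧ M.det = d / 4 := by
  obtain ⟨a, b, c, rfl, ha, hdisc, -⟩ := h
  exact PD_formMat hd ha hdisc

theorem exists_cm_Wf [Lvl p] {d : ℤ} (hd : 0 < d) {M : Matrix (Fin 2) (Fin 2) ℝ} (h : M ∈ QdN d p) :
    ∃ N ∈ QdN d p, cmPointC N = Wf p (cmPointC M) := by
  obtain ⟨a, b, c, rfl, ha, hdisc, a', rfl⟩ := h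
  have hp : (0 : ℤ) < p := by exact_mod_cast Lvl.pos p
  have hM := (PD_formMat hd ha hdisc).1
  have hc : 0 < c := by
    by_contra hc
    nlinarith [mul_nonneg ha.le (not_lt.1 hc |> neg_nonneg.2), sq_nonneg b]
  have hdisc' : (-b) ^ 2 - 4 * (p * c) * a' = -d := by rw [← hdisc]; ring
  have hN := (PD_formMat hd (mul_pos hp hc) hdisc').1
  refine ⟨formMat (p * c) (-b) a', ⟨_, _, _, rfl, mul_pos hp hc, hdisc', dvd_mul_right _ _⟩, ?_⟩
  symm
  rw [hN.eq_cmPointC_iff (Wf_im_pos p hM.im_pos)]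
  have h1 := (hM.eq_cmPointC_iff hM.im_pos).1 rfl
  have hz0 := ne_zero_of_im_pos hM.im_pos
  have hpC := Lvl.cast_ne p
  generalize cmPointC (formMat (p * a') b c) = w at h1 hz0 ⊢
  simp [formMat] at h1 ⊢
  rw [Wf]
  field_simp
  linear_combination h1

theorem formRel_iff [Lvl p] {d : ℤ} (hd : 0 < d) (Q Q' : QdN d p) :
    formRel (FrickeGroup p) (QdN d p) Q Q' ↔ hm p (cmPointC Q'.1) = hm p (cmPointC Q.1) ∨
      hm p (cmPointC Q'.1) = io p (hm p (cmPointC Q.1)) := by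
  obtain ⟨h1, e1⟩ := PD_of_mem hd Q.2
  obtain ⟨h2, e2⟩ := PD_of_mem hd Q'.2
  rw [← exists_Fricke_iff h1.im_pos h2.im_pos, formRel]
  constructor
  · rintro ⟨g, hg, e⟩
    refine ⟨g⁻¹, inv_mem hg, ?_⟩
    rw [← (h1.act_eq_iff h2 (e1.trans e2.symm) g).1 e, moebius_inv_moebius g h2.im_pos]
  · rintro ⟨g, hg, e⟩
    refine ⟨g⁻¹, inv_mem hg, (h1.act_eq_iff h2 (e1.trans e2.symm) _).2 ?_⟩
    rw [← e, moebius_inv_moebius g h1.im_pos]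

theorem classTrace_eq [Lvl p] {d : ℤ} (hd : 0 < d) {f φ : ℂ → ℂ}
    (hf : ∀ z : ℂ, 0 < z.im → f z = φ (hm p z) + φ (io p (hm p z))) {X : Finset ℂ}
    (hX : ∀ x, x ∈ X ↔ ∃ Q ∈ QdN d p, hm p (cmPointC Q) = x) :
    classTrace (FrickeGroup p) f (QdN d p) = ∑ x ∈ X, φ x / wt p x := by
  classical
  set H : QdN d p → ℂ := fun Q => hm p (cmPointC Q.1) with hH
  have hpos : ∀ Q : QdN d p, 0 < (cmPointC Q.1).im := fun Q => (PD_of_mem hd Q.2).1.im_pos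
  have hrel : ∀ Q Q' : QdN d p, formRel (FrickeGroup p) (QdN d p) Q Q' ↔
    H Q' = H Q ∨ H Q' = io p (H Q) := formRel_iff hd
  have hio : ∀ Q, io p (io p (H Q)) = H Q := fun Q => io_io_hm (hpos Q)
  let y : Quot (formRel (FrickeGroup p) (QdN d p)) → ℂ := fun O => H (Quot.out O)
  have hy : ∀ O O', y O' = y O ∨ y O' = io p (y O) → O = O' := fun O O' h => by
    rw [← Quot.out_eq O, ← Quot.out_eq O']
    exact Quot.sound ((hrel _ _).2 h)
  have hyX : ∀ O, y O ∈ X := fun O => (hX _).2 ⟨_, (Quot.out O).2, rfl⟩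
  have hex : ∀ Q Q', Quot.mk (formRel (FrickeGroup p) (QdN d p)) Q = Quot.mk _ Q' →
      H Q' = H Q ∨ H Q' = io p (H Q) := by
    intro Q Q' h
    induction Quot.eqvGen_exact h with
    | rel _ _ h' => exact (hrel _ _).1 h'
    | refl => exact Or.inl rfl
    | symm x y h' ih =>
      rcases ih (Quot.eqvGen_sound h') with h | h
      · exact Or.inl h.symm
      · exact Or.inr (by rw [h, hio])
    | trans x y z h1 h2 ih1 ih2 =>
      rcases ih1 (Quot.eqvGen_sound h1) with a | a <;> rcases ih2 (Quot.eqvGen_sound h2) with b | b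
      · exact Or.inl (b.trans a)
      · exact Or.inr (by rw [b, a])
      · exact Or.inr (b.trans a)
      · exact Or.inl (by rw [b, a, hio])
  have hfin : Finite (Quot (formRel (FrickeGroup p) (QdN d p))) :=
    Finite.of_injective (fun O => (⟨y O, hyX O⟩ : X)) fun O O' h =>
      hy O O' (Or.inl (congrArg Subtype.val h).symm)
  have := Fintype.ofFinite (Quot (formRel (FrickeGroup p) (QdN d p)))
  have hXU : X = Finset.univ.biUnion fun O => {y O, io p (y O)} := by
    ext x
    simp only [Finset.mem_biUnion, Finset.mem_univ, true_and, Finset.mem_insert,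
      Finset.mem_singleton]
    constructor
    · intro hx
      obtain ⟨Q, hQ, rfl⟩ := (hX x).1 hx
      exact ⟨Quot.mk _ ⟨Q, hQ⟩, hex _ ⟨Q, hQ⟩ (Quot.out_eq _)⟩
    · rintro ⟨O, rfl | rfl⟩
      · exact hyX O
      · obtain ⟨N, hN, e⟩ := exists_cm_Wf hd (Quot.out O).2
        exact (hX _).2 ⟨N, hN, by rw [e, ← io_hm (hpos _)]⟩
  rw [classTrace, finsum_eq_sum_of_fintype, hXU, Finset.sum_biUnion]
  · refine Finset.sum_congr rfl fun O _ => ?_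
    have hz := hpos (Quot.out O)
    have hr : (ram p (cmPointC (Quot.out O).1) : ℂ) ≠ 0 := by
      exact_mod_cast (ram_pos hz).ne'
    rw [hf _ hz, stabOrder_eq (PD_of_mem hd (Quot.out O).2).1]
    change (φ (y O) + φ (io p (y O))) / _ = _
    by_cases h : io p (y O) = y O
    · rw [if_pos h, h, Finset.pair_eq_singleton, Finset.sum_singleton, wt_hm hz]
      push_cast
      field_simp
      ring
    · rw [if_neg h, Finset.sum_pair (Ne.symm h), wt_hm hz, wt_io hz, add_div]
  · intro O _ O' _ hne
    rw [Function.onFun, Finset.disjoint_left]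
    intro x h1 h2
    refine hne (hy O O' ?_)
    have i1 : io p (io p (y O)) = y O := hio _
    have i2 : io p (io p (y O')) = y O' := hio _
    simp only [Finset.mem_insert, Finset.mem_singleton] at h1 h2
    rcases h1 with rfl | rfl <;> rcases h2 with h | h
    · exact Or.inl h.symm
    · exact Or.inr (by rw [h, i2])
    · exact Or.inr h.symm
    · exact Or.inl (by rw [← i2, ← h, i1])

end FrickeTrace
end

noncomputable section
namespace FrickeTrace
open Filter Topology Asymptotics
variable {p : ℕ}

theorem mob_eq_self_iff {N : M2} (hN : 0 < N.det) {z : ℂ} (hz : 0 < z.im) :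
    mob N z = z ↔ (N 1 0 : ℂ) * z ^ 2 + (N 1 1 - N 0 0) * z - N 0 1 = 0 := by
  rw [mob, div_eq_iff (den_ne_zero hN hz), den]
  constructor <;> intro h <;> linear_combination -h

theorem form_of_Fx {n : ℕ} (hn : 0 < n) {z : ℂ} (hz : 0 < z.im) {N : M2} (hN : N ∈ Fx p n z)
    (hc : 0 < N 1 0) : 0 < 4 * (n : ℤ) - (N 0 0 + N 1 1) ^ 2 ∧
      formMat (N 1 0) (N 1 1 - N 0 0) (-N 0 1) ∈ QdN (4 * (n : ℤ) - (N 0 0 + N 1 1) ^ 2) p ∧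
      cmPointC (formMat (N 1 0) (N 1 1 - N 0 0) (-N 0 1)) = z := by
  have h1 := (mob_eq_self_iff (MM.det_pos hn hN.1) hz).1 hN.2
  have hdet := hN.1.1
  rw [Matrix.det_fin_two] at hdet
  have hd : 0 < 4 * (n : ℤ) - (N 0 0 + N 1 1) ^ 2 := by
    have hi := congrArg Complex.im h1
    have hr := congrArg Complex.re h1
    simp [pow_two] at hi hr
    have e : ((N 1 1 : ℝ) - N 0 0) = -(2 * N 1 0 * z.re) :=
      mul_right_cancel₀ hz.ne' (by linarith)
    have hc' : (0 : ℝ) < N 1 0 := by exact_mod_cast hc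
    have : (0 : ℝ) < 4 * n - (N 0 0 + N 1 1) ^ 2 := by
      have hdet' : (N 0 0 : ℝ) * N 1 1 - N 0 1 * N 1 0 = n := by exact_mod_cast hdet
      have : (4 * n - (N 0 0 + N 1 1) ^ 2 : ℝ) = 4 * (N 1 0 * z.im) ^ 2 := by
        rw [e] at hr
        linear_combination -4 * hdet' + 4 * N 1 0 * hr
          - ((N 1 1 : ℝ) - N 0 0 - 2 * N 1 0 * z.re) * e
      rw [this]; positivity
    exact_mod_cast this
  have hdisc : (N 1 1 - N 0 0) ^ 2 - 4 * N 1 0 * -N 0 1 =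
      -(4 * (n : ℤ) - (N 0 0 + N 1 1) ^ 2) := by linear_combination -4 * hdet
  refine ⟨hd, ⟨_, _, _, rfl, hc, hdisc, hN.1.2⟩, ?_⟩
  symm
  rw [(PD_formMat hd hc hdisc).1.eq_cmPointC_iff hz]
  simp [formMat]
  linear_combination h1

theorem exists_Fx_of_form {n : ℕ} (hn : 0 < n) {r : ℤ} (hr : 0 < 4 * (n : ℤ) - r ^ 2)
    {Q : Matrix (Fin 2) (Fin 2) ℝ} (hQ : Q ∈ QdN (4 * (n : ℤ) - r ^ 2) p) :
    ∃ N ∈ Fx p n (cmPointC Q), 0 < N 1 0 ∧ N 0 0 + N 1 1 = r := by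
  obtain ⟨a, b, c, rfl, ha, hdisc, hpa⟩ := hQ
  have hM := (PD_formMat hr ha hdisc).1
  obtain ⟨s, hs⟩ : ∃ s, r - b = 2 * s := by
    have h1 : Even ((r - b) * (r + b)) := ⟨2 * (n - a * c), by linear_combination -hdisc⟩
    rcases Int.even_mul.1 h1 with h | h
    · exact h.two_dvd
    · obtain ⟨k, hk⟩ := h.two_dvd
      exact ⟨k - b, by linear_combination hk⟩
  have hdet : (!![s, -c; a, s + b] : M2).det = n := by
    rw [Matrix.det_fin_two_of]
    have : r = 2 * s + b := by linarith
    subst this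
    linarith
  refine ⟨!![s, -c; a, s + b], ⟨⟨hdet, by simpa using hpa⟩, ?_⟩, by simpa using ha, by simp; linarith⟩
  rw [mob_eq_self_iff (by rw [hdet]; exact_mod_cast hn) hM.im_pos]
  have h1 := (hM.eq_cmPointC_iff hM.im_pos).1 rfl
  generalize cmPointC (formMat a b c) = z at h1 ⊢
  simp [formMat] at h1 ⊢
  linear_combination h1

/-- The point above `x` is a Heegner point of discriminant `r ^ 2 - 4 * n`. -/
def TT (p n : ℕ) (x : ℂ) (r : ℤ) : Prop :=
  0 < 4 * (n : ℤ) - r ^ 2 ∧ ∃ Q ∈ QdN (4 * (n : ℤ) - r ^ 2) p, hm p (cmPointC Q) = x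

theorem TT_iff [Lvl p] {n : ℕ} (hn : 0 < n) {z : ℂ} (hz : 0 < z.im) {r : ℤ} :
    TT p n (hm p z) r ↔ ∃ N, (N ∈ Fx p n z ∧ 0 < N 1 0) ∧ N 0 0 + N 1 1 = r := by
  constructor
  · rintro ⟨hr, Q, hQ, hx⟩
    have hM := (PD_of_mem hr hQ).1
    obtain ⟨N, hN, hc, ht⟩ := exists_Fx_of_form hn hr hQ
    have hw := hM.im_pos
    obtain ⟨γ, hγ, e⟩ := Eqv_of_hm_eq hz hw hx.symm
    generalize cmPointC Q = w at hN hw e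
    have hNd := MM.det_pos hn hN.1
    have e1 : mob (γ.adjugate * (N * γ)) z = z := by
      rw [mob_mul hγ.adj.det_pos (by rw [Matrix.det_mul, hγ.det, mul_one]; exact hNd) hz,
        mob_mul hNd hγ.det_pos hz, e, hN.2, ← e, hγ.mob_adj_mob hz]
    have e2 : den (γ.adjugate * (N * γ)) z = den N w := by
      have h1 : den γ.adjugate w * den γ z = 1 := by
        rw [← e, ← den_mul hγ.det_pos hz, hγ.adj_mul]; simp [den]
      rw [den_mul (by rw [Matrix.det_mul, hγ.det, mul_one]; exact hNd) hz,
        den_mul hγ.det_pos hz, mob_mul hNd hγ.det_pos hz, e, hN.2]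
      linear_combination den N w * h1
    refine ⟨γ.adjugate * (N * γ), ⟨⟨⟨?_, ?_⟩, e1⟩, ?_⟩, ?_⟩
    · rw [Matrix.det_mul, Matrix.det_mul, hγ.det, hγ.adj.det, hN.1.1]; ring
    · have h1 := (MM.mul_right hγ hN.1).2
      rw [Matrix.mul_apply, Fin.sum_univ_two]
      exact dvd_add (hγ.adj.dvd.mul_right _) (h1.mul_left _)
    · have h1 := congrArg Complex.im e2
      simp only [den, add_im, mul_im, intCast_re, intCast_im, zero_mul, add_zero] at h1
      have h2 : (0 : ℝ) < ((γ.adjugate * (N * γ)) 1 0 : ℤ) * z.im := by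
        rw [h1]; exact mul_pos (by exact_mod_cast hc) hw
      exact_mod_cast pos_of_mul_pos_left h2 hz.le
    · have h1 : (γ.adjugate * (N * γ)).trace = N.trace := by
        rw [Matrix.trace_mul_comm, Matrix.mul_assoc, hγ.mul_adj, Matrix.mul_one]
      rw [Matrix.trace_fin_two, Matrix.trace_fin_two] at h1
      exact h1.trans ht
  · rintro ⟨N, ⟨hN, hc⟩, rfl⟩
    obtain ⟨h1, h2, h3⟩ := form_of_Fx hn hz hN hc
    exact ⟨h1, _, h2, by rw [h3]⟩

theorem nu_eq [Lvl p] {n : ℕ} (hn : 0 < n) {z : ℂ} (hz : 0 < z.im) :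
    nu p n z = Set.ncard {r : ℤ | TT p n (hm p z) r} := by
  have e : {r : ℤ | TT p n (hm p z) r} =
      (fun N : M2 => N 0 0 + N 1 1) '' {N | N ∈ Fx p n z ∧ 0 < N 1 0} := by
    ext r; exact TT_iff hn hz
  rw [e, Set.InjOn.ncard_image, nu]
  rintro N ⟨hN, hc⟩ N' ⟨hN', hc'⟩ h
  simp only at h
  obtain ⟨h1, h2, h3⟩ := form_of_Fx hn hz hN hc
  obtain ⟨h1', h2', h3'⟩ := form_of_Fx hn hz hN' hc'
  rw [← h] at h1' h2'
  obtain ⟨k1, d1⟩ := PD_of_mem h1 h2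
  obtain ⟨k2, d2⟩ := PD_of_mem h1' h2'
  have hE := k1.ext k2 (h3.trans h3'.symm) (d1.trans d2.symm)
  have a1 := congrFun (congrFun hE 0) 0
  have a2 := congrFun (congrFun hE 0) 1
  have a3 := congrFun (congrFun hE 1) 1
  simp only [formMat, Matrix.of_apply, Matrix.cons_val', Matrix.cons_val_zero, Matrix.cons_val_one,
    Matrix.cons_val_fin_one] at a1 a2 a3
  have b1 : N 1 0 = N' 1 0 := by exact_mod_cast a1
  have b2 : N 1 1 - N 0 0 = N' 1 1 - N' 0 0 := by
    have : ((N 1 1 - N 0 0 : ℤ) : ℝ) = ((N' 1 1 - N' 0 0 : ℤ) : ℝ) := by linarith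
    exact_mod_cast this
  have b3 : N 0 1 = N' 0 1 := by
    have : -N 0 1 = -N' 0 1 := by exact_mod_cast a3
    linarith
  ext i j
  fin_cases i <;> fin_cases j
  · change N 0 0 = N' 0 0; linarith
  · exact b3
  · exact b1
  · change N 1 1 = N' 1 1; linarith

theorem card_sq_eq (n k : ℕ) (hn : 0 < n) (hk : 0 < k) {J : Finset ℤ}
    (hJ : ∀ r : ℤ, r ^ 2 = 4 * n + k ^ 2 → r ∈ J) :
    (J.filter fun r => r ^ 2 = 4 * (n : ℤ) + k ^ 2).card =
      (n.divisorsAntidiagonal.filter fun x => x.2 = x.1 + k ∨ x.1 = x.2 + k).card := by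
  symm
  refine Finset.card_bij
    (fun x _ => if x.2 = x.1 + k then ((x.1 + x.2 : ℕ) : ℤ) else -((x.1 + x.2 : ℕ) : ℤ)) ?_ ?_ ?_
  · rintro ⟨a, b⟩ hx
    simp only [Finset.mem_filter, Nat.mem_divisorsAntidiagonal] at hx ⊢
    obtain ⟨⟨hab, -⟩, h⟩ := hx
    have hab' : (a : ℤ) * b = n := by exact_mod_cast hab
    have key : (if b = a + k then ((a + b : ℕ) : ℤ) else -((a + b : ℕ) : ℤ)) ^ 2 =
        4 * (n : ℤ) + k ^ 2 := by
      have : ((a : ℤ) + b) ^ 2 = 4 * n + k ^ 2 := by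
        rw [← hab']
        rcases h with rfl | rfl <;> push_cast <;> ring
      split_ifs <;> push_cast <;> linarith
    exact ⟨hJ _ key, key⟩
  · rintro ⟨a, b⟩ hx ⟨a', b'⟩ hx' h
    simp only [Finset.mem_filter, Nat.mem_divisorsAntidiagonal] at hx hx' h
    have hx2 := hx.2
    have hx2' := hx'.2
    rw [Prod.mk.injEq]
    split_ifs at h <;> omega
  · intro r hr
    rw [Finset.mem_filter] at hr
    have hr := hr.2
    obtain ⟨a, ha⟩ : ∃ a : ℕ, r.natAbs = 2 * a + k := by
      have hk2 : (k : ℤ) ^ 2 < r ^ 2 := by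
        have : (0 : ℤ) < n := by exact_mod_cast hn
        linarith
      have h1 : k < r.natAbs := by
        have := sq_lt_sq.1 hk2
        rw [Nat.abs_cast, Int.abs_eq_natAbs] at this
        exact_mod_cast this
      have h2 : Even ((r - k) * (r + k)) := ⟨2 * n, by linear_combination hr⟩
      have h3 : (2 : ℤ) ∣ r - k := by
        rcases Int.even_mul.1 h2 with h | h
        · exact h.two_dvd
        · obtain ⟨m, hm⟩ := h.two_dvd
          exact ⟨m - k, by linear_combination hm⟩
      refine ⟨(r.natAbs - k) / 2, by omega⟩
    have hab : a * (a + k) = n := by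
      have h1 : (r.natAbs : ℤ) ^ 2 = r ^ 2 := Int.natAbs_sq r
      rw [hr, ha] at h1
      push_cast at h1
      have : (a : ℤ) * (a + k) = n := by linarith
      exact_mod_cast this
    rcases le_total 0 r with h0 | h0
    · refine ⟨(a, a + k), ?_, ?_⟩
      · simp [hab, hn.ne']
      · simp only [if_true]; omega
    · refine ⟨(a + k, a), ?_, ?_⟩
      · simp [mul_comm (a + k), hab, hn.ne']
      · simp only
        rw [if_neg (by omega)]; omega

end FrickeTrace
end

noncomputable section
namespace FrickeTrace
open Filter Topology Asymptotics
variable {p : ℕ}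

/-- The function whose values at the zeros of the diagonal modular polynomial are summed. -/
def ph (p : ℕ) (x : ℂ) : ℂ := F2 p x - cW p / 2

theorem sum_classTrace [Lvl p] {n : ℕ} (hn : 0 < n) {f : ℂ → ℂ}
    (hf : ∀ z : ℂ, 0 < z.im → f z = ph p (hm p z) + ph p (io p (hm p z))) {J : Finset ℤ}
    (hJ : ∀ r : ℤ, r ^ 2 < 4 * n → r ∈ J) {R : Polynomial ℂ} {e : ℤ}
    (hR : R ≠ 0) (hs : R.eval (sx p : ℂ) ≠ 0)
    (h : ∀ z : ℂ, 0 < z.im → gn p n z = R.eval (hm p z) * up p z ^ e) :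
    12 * ∑ r ∈ J.filter (fun r => r ^ 2 < 4 * (n : ℤ)),
      classTrace (FrickeGroup p) f (QdN (4 * (n : ℤ) - r ^ 2) p) = (R.roots.map (ph p)).sum := by
  classical
  have hT : ∀ r ∈ J.filter (fun r => r ^ 2 < 4 * (n : ℤ)),
      classTrace (FrickeGroup p) f (QdN (4 * (n : ℤ) - r ^ 2) p) =
        ∑ x ∈ R.roots.toFinset, if TT p n x r then ph p x / wt p x else 0 := by
    intro r hr
    have hr : 0 < 4 * (n : ℤ) - r ^ 2 := by linarith [(Finset.mem_filter.1 hr).2]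
    rw [← Finset.sum_filter]
    refine classTrace_eq hr hf fun x => ?_
    rw [Finset.mem_filter, Multiset.mem_toFinset]
    refine ⟨fun hx => hx.2.2, fun hx => ⟨?_, hr, hx⟩⟩
    obtain ⟨Q, hQ, rfl⟩ := hx
    have hz := (PD_of_mem hr hQ).1.im_pos
    have h1 := rootMultiplicity_mul_ram hn hR h hz
    have h2 : 0 < nu p n (cmPointC Q) := by
      obtain ⟨N, hN, hc, -⟩ := exists_Fx_of_form hn hr hQ
      exact (Set.ncard_pos ((finite_Fx hn hz).subset fun _ h => h.1)).2 ⟨N, hN, hc⟩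
    rw [Polynomial.mem_roots hR, ← Polynomial.rootMultiplicity_pos hR]
    exact pos_of_mul_pos_left (a := R.rootMultiplicity _) (by rw [h1]; omega) (Nat.zero_le _)
  rw [Finset.sum_congr rfl hT, Finset.sum_comm, Finset.sum_multiset_map_count, Finset.mul_sum]
  refine Finset.sum_congr rfl fun x hx => ?_
  have hxr : R.eval x = 0 := (Polynomial.mem_roots hR).1 (Multiset.mem_toFinset.1 hx)
  obtain ⟨z, hz, rfl⟩ := exists_hm_eq (p := p) (x := x) (fun h => hs (h ▸ hxr))
  have h1 := rootMultiplicity_mul_ram hn hR h hz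
  have hr : (ram p z : ℂ) ≠ 0 := by exact_mod_cast (ram_pos hz).ne'
  have h2 : nu p n z = ((J.filter (fun r => r ^ 2 < 4 * (n : ℤ))).filter
      fun r => TT p n (hm p z) r).card := by
    rw [nu_eq hn hz, ← Set.ncard_coe_finset]
    congr 1
    ext r
    simp only [Finset.coe_filter, Finset.mem_filter, Set.mem_ofPred_eq]
    refine ⟨fun h => ⟨⟨hJ r (by linarith [h.1]), by linarith [h.1]⟩, h⟩, fun h => h.2⟩
  rw [← Finset.sum_filter, Finset.sum_const, ← h2, Polynomial.count_roots, wt_hm hz,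
    nsmul_eq_mul, nsmul_eq_mul]
  have h3 : (R.rootMultiplicity (hm p z) : ℂ) * ram p z = 12 * nu p n z := by exact_mod_cast h1
  field_simp
  linear_combination -ph p (hm p z) * h3

theorem card_sq_eq_zero {n : ℕ} (hn : 0 < n) {J : Finset ℤ} (hJ : ∀ r : ℤ, r ^ 2 = 4 * n → r ∈ J) :
    ((J.filter fun r => r ^ 2 = 4 * (n : ℤ)).card : ℤ) = 2 * sq n := by
  rw [sq_eq hn]
  split_ifs with h
  · obtain ⟨k, rfl⟩ := h
    have hk : (k : ℤ) ≠ 0 := by rintro h0; simp [show k = 0 by exact_mod_cast h0] at hn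
    have e : (J.filter fun r => r ^ 2 = 4 * ((k * k : ℕ) : ℤ)) = {2 * (k : ℤ), -(2 * (k : ℤ))} := by
      ext r
      have e1 : r ^ 2 = 4 * ((k * k : ℕ) : ℤ) ↔ r = 2 * (k : ℤ) ∨ r = -(2 * (k : ℤ)) := by
        rw [← sq_eq_sq_iff_eq_or_eq_neg]; push_cast; ring_nf
      rw [Finset.mem_filter, Finset.mem_insert, Finset.mem_singleton, ← e1]
      exact ⟨fun h => h.2, fun h => ⟨hJ r h, h⟩⟩
    rw [e, Finset.card_pair (by omega)]; norm_num
  · rw [mul_zero, Nat.cast_eq_zero, Finset.card_eq_zero, Finset.filter_eq_empty_iff]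
    intro r _ hr
    refine h ?_
    have h2 : Even r := by
      have : Even (r ^ 2) := ⟨2 * n, by linear_combination hr⟩
      exact (Int.even_pow.1 this).1
    obtain ⟨k, rfl⟩ := h2
    refine ⟨k.natAbs, ?_⟩
    have : (n : ℤ) = k.natAbs * k.natAbs := by rw [← Int.natCast_mul, Int.natAbs_mul_self]; linarith
    exact_mod_cast this

theorem bt_eq (n : ℕ) : bt n =
    (n.divisorsAntidiagonal.filter fun x => x.2 = x.1 + 1 ∨ x.1 = x.2 + 1).card +
      2 * (n.divisorsAntidiagonal.filter fun x => x.2 = x.1 + 2 ∨ x.1 = x.2 + 2).card := by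
  rw [bt, Finset.sum_add_distrib, ← Finset.sum_filter, ← Finset.sum_filter, Finset.sum_const,
    Finset.sum_const]
  simp [mul_comm]

theorem finsum_t2Star [Lvl p] {n : ℕ} (hn : 0 < n) {P : Polynomial ℂ}
    (hP : ∀ z : ℂ, 0 < z.im → P.eval (jnStar p z) = ph p (hm p z) + ph p (io p (hm p z))) :
    ∑ᶠ r : ℤ, t2Star p P (4 * (n : ℤ) - r ^ 2) = 2 * (n * cf p n) -
      cW p * (∑ d ∈ n.divisors, (d : ℂ) - ∑ x ∈ pDiv p n, ((p * x.2 : ℕ) : ℂ)) := by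
  obtain ⟨R, e, hR, hs, h, hsum⟩ := exists_poly_gn (p := p) hn
  set J : Finset ℤ := Finset.Icc (-(2 * n + 2)) (2 * n + 2) with hJ
  have hn' : (0 : ℤ) < n := by exact_mod_cast hn
  have hmem : ∀ r : ℤ, r ^ 2 ≤ 4 * n + 4 → r ∈ J := by
    intro r hr
    rw [hJ, Finset.mem_Icc, ← abs_le]
    exact abs_le_of_sq_le_sq (by nlinarith) (by linarith)
  have hp6 : ¬ (p = 6 ∨ p = 10) := by
    have := Lvl.mem (p := p)
    omega
  set u : ℂ := if p = 2 then 5 else 3 with hu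
  have ht : ∀ r : ℤ, t2Star p P (4 * (n : ℤ) - r ^ 2) =
      (if r ^ 2 < 4 * (n : ℤ) then classTrace (FrickeGroup p) (fun z => P.eval (jnStar p z))
        (QdN (4 * (n : ℤ) - r ^ 2) p) else 0) + (if r ^ 2 = 4 * (n : ℤ) then u else 0) +
      (if r ^ 2 = 4 * (n : ℤ) + (1 : ℕ) ^ 2 then (-1) else 0) +
      (if r ^ 2 = 4 * (n : ℤ) + (2 : ℕ) ^ 2 then (-2) else 0) := by
    intro r
    rw [t2Star, if_neg hp6, ← hu]
    push_cast
    generalize r ^ 2 = s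
    rcases lt_trichotomy s (4 * (n : ℤ)) with h | h | h
    · rw [if_pos (by linarith), if_pos h, if_neg h.ne, if_neg (by linarith), if_neg (by linarith)]
      ring
    · subst h
      simp
    · rw [if_neg (by linarith), if_neg (by linarith), if_neg h.not_gt, if_neg h.ne']
      by_cases h1 : s = 4 * n + 1
      · subst h1; simp
      · by_cases h2 : s = 4 * n + 4
        · subst h2; simp
        · rw [if_neg (by intro h; exact h1 (by linarith)),
            if_neg (by intro h; exact h2 (by linarith)), if_neg (by simpa using h1),
            if_neg (by exact h2)]
          ring
  rw [finsum_eq_sum_of_support_subset (s := J)]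
  · simp only [ht]
    rw [Finset.sum_add_distrib, Finset.sum_add_distrib, Finset.sum_add_distrib,
      ← Finset.sum_filter, ← Finset.sum_filter, ← Finset.sum_filter, ← Finset.sum_filter,
      Finset.sum_const, Finset.sum_const, Finset.sum_const,
      card_sq_eq n 1 hn one_pos (fun r hr => hmem r (by push_cast at hr; linarith)),
      card_sq_eq n 2 hn two_pos (fun r hr => hmem r (by push_cast at hr; linarith))]
    have h1 := sum_classTrace hn hP (J := J) (fun r hr => hmem r (by linarith)) hR hs h
    have h2 : ((J.filter fun r => r ^ 2 = 4 * (n : ℤ)).card : ℂ) = 2 * sq n := by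
      exact_mod_cast card_sq_eq_zero hn (J := J) (fun r hr => hmem r (by linarith))
    have hsum' : (R.roots.map (ph p)).sum = _ := hsum
    rw [hsum', bt_eq] at h1
    rw [nsmul_eq_mul, nsmul_eq_mul, nsmul_eq_mul, h2]
    have hu2 : 2 * u = 6 + if p = 2 then 4 else 0 := by
      rw [hu]; split_ifs <;> norm_num
    rw [← hu2] at h1
    linear_combination (1 / 12) * h1
  · intro r hr
    by_contra hrJ
    have h4 : 4 * (n : ℤ) + 4 < r ^ 2 := by
      by_contra h4; exact hrJ (hmem r (not_lt.1 h4))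
    refine hr ?_
    simp only
    rw [ht, if_neg (by linarith), if_neg (by linarith), if_neg (by push_cast; linarith),
      if_neg (by push_cast; linarith)]
    ring

end FrickeTrace
end

noncomputable section
namespace FrickeTrace
open Filter Topology Asymptotics
variable {p : ℕ}

theorem qExp_sub_principal_tendsto {f : ℂ → ℂ} {e : ℤ → ℂ} (hf : HasQExp f e (-2))
    (he2 : e (-2) = 1) (he1 : e (-1) = 0) (he0 : e 0 = 0) :
    Tendsto (fun z => f z - (qc z ^ 2)⁻¹) cusp (𝓝 0) := by
  have hs : ∀ z : ℂ, 0 < z.im →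
      HasSum (fun m : ℕ => e ((m : ℤ) + 1) * qc z ^ (m + 1)) (f z - (qc z ^ 2)⁻¹) := by
    intro z hz
    have h := hf.2 z hz
    have h3 : f z = (f z - (qc z ^ 2)⁻¹) + ∑ m ∈ Finset.range 3,
        e (-2 + (m : ℤ)) * qc z ^ (-2 + (m : ℤ)) := by
      simp only [Finset.sum_range_succ, Finset.sum_range_zero]
      norm_num [he2, he1, he0]
    rw [h3] at h
    refine ((hasSum_nat_add_iff 3).2 h).congr_fun fun m => ?_
    have h4 : -2 + ((m + 3 : ℕ) : ℤ) = ((m + 1 : ℕ) : ℤ) := by push_cast; ring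
    rw [h4, zpow_natCast]
    push_cast
    rfl
  have hI : 0 < Complex.I.im := by simp
  set r : ℝ := ‖qc Complex.I‖ with hr
  have hr0 : 0 < r := norm_pos_iff.2 (qc_ne_zero _)
  obtain ⟨C, hC⟩ := (hs _ hI).summable.tendsto_atTop_zero.norm.bddAbove_range
  have hC' : ∀ m : ℕ, ‖e ((m : ℤ) + 1)‖ * r ^ (m + 1) ≤ C := fun m => by
    have := hC ⟨m, rfl⟩
    simpa only [norm_mul, norm_pow] using this
  have hC0 : 0 ≤ C := le_trans (by positivity) (hC' 0)
  have hq : Tendsto (fun z => ‖qc z‖) cusp (𝓝 0) := by simpa using tendsto_qc_cusp.norm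
  have hlim : Tendsto (fun z => 2 * C / r * ‖qc z‖) cusp (𝓝 0) := by
    simpa using hq.const_mul (2 * C / r)
  refine squeeze_zero_norm' ?_ hlim
  filter_upwards [cusp_eventually_im 0, hq.eventually (gt_mem_nhds (half_pos hr0))] with z hz hzq
  rw [← (hs z hz).tsum_eq]
  have hb : HasSum (fun m : ℕ => C * (‖qc z‖ / r) * (1 / 2 : ℝ) ^ m) (C * (‖qc z‖ / r) * 2) :=
    hasSum_geometric_two.mul_left _
  refine (tsum_of_norm_bounded hb fun m => ?_).trans (le_of_eq (by ring))
  have h1 : ‖qc z‖ / r ≤ 1 / 2 := by rw [div_le_iff₀ hr0]; linarith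
  calc ‖e ((m : ℤ) + 1) * qc z ^ (m + 1)‖
      = (‖e ((m : ℤ) + 1)‖ * r ^ (m + 1)) * (‖qc z‖ / r * (‖qc z‖ / r) ^ m) := by
        rw [norm_mul, norm_pow, ← _root_.pow_succ', div_pow]
        field_simp
    _ ≤ C * (‖qc z‖ / r * (1 / 2) ^ m) := by
        gcongr
        exact hC' m
    _ = _ := by ring

theorem jnStar_eq_qc [Lvl p] {z : ℂ} (hz : 0 < z.im) :
    jnStar p z = (qc z)⁻¹ + qc z * (g1 p (qc z) + kap p / (up p z * qc z)) := by
  have h1 := qc_ne_zero z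
  have h2 := up_ne_zero p hz
  rw [jnStar_eq, hm_eq, G0_eq]
  field_simp
  ring

theorem tendsto_up_mul_qc [Lvl p] : Tendsto (fun z => up p z * qc z) cusp (𝓝 1) := by
  have h := ((analyticAt_of_ball (differentiableOn_G0 p)).continuousAt.tendsto.comp
    tendsto_qc_cusp).sub_const (sx p : ℂ) |>.mul tendsto_qc_cusp |>.const_add 1
  simp only [mul_zero, add_zero] at h
  refine h.congr fun z => ?_
  have h1 := qc_ne_zero z
  simp only [Function.comp, up_eq_G0]
  field_simp

theorem tendsto_jnStar_coeff [Lvl p] :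
    Tendsto (fun z => g1 p (qc z) + kap p / (up p z * qc z)) cusp (𝓝 (c1 p + kap p)) := by
  have h := (analyticAt_of_ball (differentiableOn_g1 p)).continuousAt.tendsto.comp
    tendsto_qc_cusp
  rw [g1_zero] at h
  have h2 := (tendsto_const_nhds (x := kap p)).div (tendsto_up_mul_qc (p := p)) one_ne_zero
  rw [div_one] at h2
  exact h.add h2

theorem tendsto_jnStar_sq [Lvl p] :
    Tendsto (fun z => jnStar p z ^ 2 - (qc z ^ 2)⁻¹) cusp (𝓝 (2 * (c1 p + kap p))) := by
  have hB := tendsto_jnStar_coeff (p := p)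
  have h := (hB.const_mul 2).add ((tendsto_qc_cusp.pow 2).mul (hB.pow 2))
  simp only [ne_eq, OfNat.ofNat_ne_zero, not_false_eq_true, zero_pow, zero_mul, add_zero] at h
  refine h.congr' ?_
  filter_upwards [cusp_eventually_im 0] with z hz
  have h1 := qc_ne_zero z
  rw [jnStar_eq_qc hz]
  generalize g1 p (qc z) + kap p / (up p z * qc z) = B
  field_simp
  ring

theorem tendsto_norm_jnStar [Lvl p] : Tendsto (fun z => ‖jnStar p z‖) cusp atTop := by
  have h1 : Tendsto (fun z => (qc z)⁻¹) cusp (Bornology.cobounded ℂ) :=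
    tendsto_inv₀_nhdsNE_zero.comp
      (tendsto_nhdsWithin_iff.2 ⟨tendsto_qc_cusp, Eventually.of_forall qc_ne_zero⟩)
  have h2 : Tendsto (fun z => jnStar p z - (qc z)⁻¹) cusp (𝓝 0) := by
    have h := tendsto_qc_cusp.mul (tendsto_jnStar_coeff (p := p))
    rw [zero_mul] at h
    refine h.congr' ?_
    filter_upwards [cusp_eventually_im 0] with z hz
    rw [jnStar_eq_qc hz]; ring
  have h3 := (tendsto_norm_atTop_iff_cobounded.2 h1).atTop_add h2.norm.neg
  refine tendsto_atTop_mono (fun z => ?_) h3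
  have := norm_sub_norm_le ((qc z)⁻¹) ((qc z)⁻¹ - jnStar p z)
  rw [sub_sub_cancel, norm_sub_rev _ (jnStar p z)] at this
  linarith

theorem polynomial_eq_zero_of_tendsto {D : Polynomial ℂ} {l : Filter ℂ} [l.NeBot] {f : ℂ → ℂ}
    (hf : Tendsto (fun z => ‖f z‖) l atTop) (hD : Tendsto (fun z => D.eval (f z)) l (𝓝 0)) :
    D = 0 := by
  rcases le_or_gt D.degree 0 with h | h
  · rw [Polynomial.eq_C_of_degree_le_zero h] at hD ⊢
    simp only [Polynomial.eval_C] at hD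
    rw [tendsto_nhds_unique tendsto_const_nhds hD, map_zero]
  · have h1 := D.tendsto_norm_atTop h hf
    exact absurd hD.norm (not_tendsto_nhds_of_tendsto_atTop h1 _)

theorem eval_jnStar_eq [Lvl p] {P : Polynomial ℂ} {e : ℤ → ℂ}
    (hP : HasQExp (fun z => Polynomial.eval (jnStar p z) P) e (-2))
    (he2 : e (-2) = 1) (he1 : e (-1) = 0) (he0 : e 0 = 0) (z : ℂ) (hz : 0 < z.im) :
    P.eval (jnStar p z) = ph p (hm p z) + ph p (io p (hm p z)) := by
  have h1 := (qExp_sub_principal_tendsto hP he2 he1 he0).sub (tendsto_jnStar_sq (p := p))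
    |>.add_const (2 * (c1 p + kap p))
  rw [zero_sub, neg_add_cancel] at h1
  have h2 : P - (Polynomial.X ^ 2 - Polynomial.C (2 * (c1 p + kap p))) = 0 := by
    refine polynomial_eq_zero_of_tendsto (tendsto_norm_jnStar (p := p)) (h1.congr fun z => ?_)
    simp only [Polynomial.eval_sub, Polynomial.eval_pow, Polynomial.eval_X, Polynomial.eval_C]
    ring
  rw [sub_eq_zero.1 h2]
  have h3 := up_ne_zero p hz
  have h4 : hm p z = up p z + sx p := rfl
  simp only [Polynomial.eval_sub, Polynomial.eval_pow, Polynomial.eval_X, Polynomial.eval_C,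
    ph, F2, io, jnStar_eq, h4, add_sub_cancel_right, c1]
  field_simp
  ring

theorem finsum_t2Star_neg_one (P : Polynomial ℂ) :
    ∑ᶠ r : ℤ, t2Star p P (4 * (((0 : ℕ) : ℤ) - 1) - r ^ 2) = -2 := by
  rw [finsum_eq_single _ (0 : ℤ)]
  · norm_num [t2Star]
  · intro r hr
    have : 0 < r ^ 2 := by positivity
    rw [t2Star, if_neg (by push_cast; linarith), if_neg (by push_cast; omega),
      if_neg (by push_cast; omega), if_neg (by push_cast; omega)]

theorem finsum_t2Star_zero [Lvl p] (P : Polynomial ℂ) :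
    ∑ᶠ r : ℤ, t2Star p P (4 * (((1 : ℕ) : ℤ) - 1) - r ^ 2) = (if p = 2 then 5 else 3) - 6 := by
  have hp6 : ¬ (p = 6 ∨ p = 10) := by
    rcases Lvl.mem (p := p) with h | h | h | h | h <;> omega
  rw [finsum_eq_sum_of_support_subset (s := Finset.Icc (-2 : ℤ) 2)]
  · have : Finset.Icc (-2 : ℤ) 2 = {-2, -1, 0, 1, 2} := by decide
    rw [this]
    norm_num [t2Star, hp6]
    ring
  · intro r hr
    simp only [Finset.coe_Icc, Set.mem_Icc]
    by_contra hc
    have : 4 < r ^ 2 := by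
      rcases lt_or_ge r (-2) with h | h
      · nlinarith
      · have : 2 < r := by
          by_contra h'
          exact hc ⟨h, not_lt.1 h'⟩
        nlinarith
    refine hr ?_
    simp only
    rw [t2Star, if_neg (by push_cast; linarith), if_neg (by push_cast; omega),
      if_neg (by push_cast; omega), if_neg (by push_cast; omega)]

theorem summable_sigma {x : ℂ} (hx : ‖x‖ < 1) :
    Summable fun n : ℕ => (∑ d ∈ n.divisors, (d : ℂ)) * x ^ n := by
  refine Summable.of_norm_bounded
    (summable_norm_pow_mul_geometric_of_norm_lt_one 2 hx) fun n => ?_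
  rw [norm_mul, norm_mul]
  gcongr
  refine (norm_sum_le _ _).trans ?_
  calc ∑ d ∈ n.divisors, ‖(d : ℂ)‖ ≤ ∑ _d ∈ n.divisors, (n : ℝ) := by
        refine Finset.sum_le_sum fun d hd => ?_
        rw [Complex.norm_natCast]
        exact_mod_cast Nat.divisor_le hd
    _ ≤ n * n := by
        rw [Finset.sum_const, nsmul_eq_mul]
        gcongr
        exact_mod_cast Nat.card_divisors_le_self n
    _ = _ := by rw [norm_pow, Complex.norm_natCast, pow_two]

theorem E2_eq {z : ℂ} (hz : 0 < z.im) :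
    E2 z = 1 - 24 * ∑' n : ℕ, (∑ d ∈ n.divisors, (d : ℂ)) * qc z ^ n := by
  rw [E2, (summable_sigma (norm_qc_lt_one hz)).tsum_eq_zero_add]
  simp

theorem sum_pDiv (p n : ℕ) :
    ∑ x ∈ pDiv p n, ((p * x.2 : ℕ) : ℂ) =
      if p ∣ n then (p : ℂ) * ∑ d ∈ (n / p).divisors, (d : ℂ) else 0 := by
  rw [pDiv]
  split_ifs with h
  · rw [Nat.sum_divisorsAntidiagonal' (f := fun _ y => ((p * y : ℕ) : ℂ)), Finset.mul_sum]
    simp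
  · simp

theorem hasSum_E2N [Lvl p] {z : ℂ} (hz : 0 < z.im) :
    HasSum (fun n : ℕ => (∑ d ∈ n.divisors, (d : ℂ) - ∑ x ∈ pDiv p n, ((p * x.2 : ℕ) : ℂ)) *
      qc z ^ n) ((E2N p z - ((p : ℂ) - 1)) / 24) := by
  have hp := Lvl.pos p
  have h1 := (summable_sigma (norm_qc_lt_one hz)).hasSum
  have h2 := (summable_sigma (norm_qc_lt_one (im_mul_pos p hz))).hasSum
  have hinj : Function.Injective (fun n : ℕ => p * n) := fun a b h => Nat.eq_of_mul_eq_mul_left hp h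
  have h3 : HasSum (fun n : ℕ => (if p ∣ n then ∑ d ∈ (n / p).divisors, (d : ℂ) else 0) *
      qc z ^ n) (∑' n : ℕ, (∑ d ∈ n.divisors, (d : ℂ)) * qc (p * z) ^ n) := by
    refine (hinj.hasSum_iff fun n hn => ?_).1 (h2.congr_fun fun n => ?_)
    · rw [if_neg, zero_mul]
      rintro ⟨m, rfl⟩
      exact hn ⟨m, rfl⟩
    · simp only [Function.comp]
      rw [if_pos (dvd_mul_right p n), Nat.mul_div_cancel_left n hp, qc_nat_mul, pow_mul]
  have h4 := h1.sub (h3.mul_left (p : ℂ))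
  have h5 : (E2N p z - ((p : ℂ) - 1)) / 24 =
      ∑' n : ℕ, (∑ d ∈ n.divisors, (d : ℂ)) * qc z ^ n -
        p * ∑' n : ℕ, (∑ d ∈ n.divisors, (d : ℂ)) * qc (p * z) ^ n := by
    rw [E2N, E2_eq hz, E2_eq (im_mul_pos p hz)]
    ring
  rw [h5]
  refine h4.congr_fun fun n => ?_
  rw [sum_pDiv]
  split_ifs <;> ring

theorem hasSum_deriv_G0 [Lvl p] {x : ℂ} (hx : ‖x‖ < 1) :
    HasSum (fun n : ℕ => (n : ℂ) * cf p n * x ^ n) (x * deriv (G0 p) x) := by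
  have h1 := (hasSum_tcoef ((differentiableOn_G0 p).deriv Metric.isOpen_ball) hx).mul_left x
  have h2 : x * deriv (G0 p) x = x * deriv (G0 p) x + ∑ n ∈ Finset.range 1,
      (n : ℂ) * cf p n * x ^ n := by simp
  rw [h2]
  refine (hasSum_nat_add_iff 1).1 (h1.congr_fun fun n => ?_)
  rw [cf, tcoef, tcoef, ← iteratedDeriv_succ', Nat.factorial_succ]
  have := Nat.factorial_ne_zero n
  push_cast
  have h3 : (n : ℂ) + 1 ≠ 0 := Nat.cast_add_one_ne_zero n
  field_simp
  ring

theorem cW_eq_div [Lvl p] :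
    cW p = 24 * ((3 - (p : ℂ) * (if p = 2 then 1 else 0)) / ((p : ℂ) - 1)) := by
  rw [cW, sx_cast]
  split_ifs with h
  · subst h; norm_num
  · ring

theorem weight_two_identity [Lvl p] {P : Polynomial ℂ} {e : ℤ → ℂ}
    (hP : HasQExp (fun z => Polynomial.eval (jnStar p z) P) e (-2))
    (he2 : e (-2) = 1) (he1 : e (-1) = 0) (he0 : e 0 = 0) {g τ : ℂ} (hτ : 0 < τ.im)
    (hG : HasSum (fun n : ℕ =>
      (∑ᶠ r : ℤ, t2Star p P (4 * ((n : ℤ) - 1) - r ^ 2)) * qc τ ^ ((n : ℤ) - 1)) g) :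
    2 * ((2 * Real.pi * Complex.I)⁻¹ * deriv (jn p) τ) - g =
      (3 - (p : ℂ) * (if p = 2 then 1 else 0)) / ((p : ℂ) - 1) * E2N p τ := by
  have hq := norm_qc_lt_one hτ
  have h1 := ((hasSum_deriv_G0 (p := p) hq).mul_left 2).sub
    ((hasSum_E2N (p := p) hτ).mul_left (cW p))
  have h2 : g = (g + 2 * (qc τ)⁻¹ - ((if p = 2 then 5 else 3) - 6)) + ∑ n ∈ Finset.range 2,
      (∑ᶠ r : ℤ, t2Star p P (4 * ((n : ℤ) - 1) - r ^ 2)) * qc τ ^ ((n : ℤ) - 1) := by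
    simp only [Finset.sum_range_succ, Finset.sum_range_zero, finsum_t2Star_neg_one,
      finsum_t2Star_zero]
    simp
  rw [h2] at hG
  have h3 := (hasSum_nat_add_iff 2).2 hG
  have h4 := (hasSum_nat_add_iff' 1).2 h1
  simp only [Finset.sum_range_one, Nat.cast_zero, zero_mul, mul_zero, Nat.divisors_zero,
    Finset.sum_empty, sum_pDiv, dvd_zero, if_true, Nat.zero_div, sub_zero] at h4
  have h5 := h3.unique (h4.congr_fun fun n => ?_)
  · have hj : jn p = hm p := funext fun z => jn_eq p z
    have hpi : (2 * Real.pi * Complex.I : ℂ) ≠ 0 := Complex.two_pi_I_ne_zero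
    have hp1 : (p : ℂ) - 1 ≠ 0 := sub_ne_zero.2 (by exact_mod_cast (Lvl.prime p).one_lt.ne')
    rw [hj, hm_deriv_eq hτ, inv_mul_cancel_left₀ hpi]
    rw [cW_eq_div] at h5
    have h6 : (6 : ℂ) - (if p = 2 then 5 else 3) =
        3 - (p : ℂ) * (if p = 2 then 1 else 0) := by
      split_ifs with h
      · subst h; norm_num
      · norm_num
    have h7 : (3 - (p : ℂ) * (if p = 2 then 1 else 0)) / ((p : ℂ) - 1) * ((p : ℂ) - 1) =
        3 - (p : ℂ) * (if p = 2 then 1 else 0) := div_mul_cancel₀ _ hp1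
    linear_combination -h5 + h6 - h7
  · have h8 : ((n + 2 : ℕ) : ℤ) - 1 = ((n + 1 : ℕ) : ℤ) := by push_cast; ring
    rw [h8, zpow_natCast, finsum_t2Star n.succ_pos (eval_jnStar_eq hP he2 he1 he0),
      sum_pDiv]
    ring

end FrickeTrace

end

end
/-- **Prime level identity of weight-2 forms.** For `p ∈ {2,3,5,7,13}`,
`2 j_p'(τ) - G₂^{(p*)}(τ) = ((3 - p σ₁(2/p))/(p-1)) E₂^{(p)}(τ)` on the upper half-plane,
where `j_p' = (2πi)⁻¹ d/dτ j_p` and `E₂^{(p)}(τ) = p E₂(pτ) - E₂(τ)`. -/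
theorem weight_two_identity_prime (p : ℕ) (hp : p ∈ ({2, 3, 5, 7, 13} : Set ℕ))
    (P : Polynomial ℂ) (e : ℤ → ℂ)
    (hP : HasQExp (fun z => Polynomial.eval (jnStar p z) P) e (-2))
    (he2 : e (-2) = 1) (he1 : e (-1) = 0) (he0 : e 0 = 0)
    (G : ℂ → ℂ)
    (hG : ∀ τ : ℂ, 0 < τ.im →
      HasSum (fun n : ℕ =>
          (∑ᶠ r : ℤ, t2Star p P (4 * ((n : ℤ) - 1) - r ^ 2)) * qc τ ^ ((n : ℤ) - 1))
        (G τ))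
    (τ : ℂ) (hτ : 0 < τ.im) :
    2 * ((2 * Real.pi * Complex.I)⁻¹ * deriv (jn p) τ) - G τ =
      (3 - (p : ℂ) * (if p = 2 then 1 else 0)) / ((p : ℂ) - 1) * E2N p τ := by
  have hl : FrickeTrace.Lvl p := ⟨by simpa using hp⟩
  exact FrickeTrace.weight_two_identity hP he2 he1 he0 hτ (hG τ hτ)
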